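/- There exist universal constants δ > 0 and C₁ > 0 such that for every quasisymmetric homeomorphism φ of ℝP¹ with cross-ratio norm ‖φ‖_cr < δ, the minimal Lagrangian extension Φ_ML: ℍ² → ℍ² of φ has maximal dilatation K(Φ_ML) satisfying ln K(Φ_ML) ≤ C₁ · ‖φ‖_cr. -/

import Mathlib

/-!
Common framework for formalizing "Maximal surfaces in Anti-de Sitter space, width of
convex hulls and quasiconformal extensions of quasisymmetric homeomorphisms" (A. Seppi).

Anti-de Sitter space is modeled projectively: `qform` is the bilinear form of
signature (2,2) on ℝ⁴, `AdS3` is the projectivization of its negative cone,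
and spacelike surfaces are recorded through (lifts of) smooth spacelike embeddings
of ℝ² into the quadric {⟨x,x⟩ = -1} (the double cover of AdS³), together with a
future-directed unit normal field and the associated shape operator.
-/

noncomputable section

open Real Set Filter Topology

namespace AdSPaper

/-- The bilinear form of signature `(2,2)` on `ℝ⁴`. -/
def qform (x y : Fin 4 → ℝ) : ℝ :=
  x 0 * y 0 + x 1 * y 1 - x 2 * y 2 - x 3 * y 3

/-- Quotient topology on a projectivization. -/
instance (K V : Type*) [DivisionRing K] [AddCommGroup V] [Module K V] [TopologicalSpace V] :
    TopologicalSpace (Projectivization K V) := by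
  unfold Projectivization
  infer_instance

/-- Real projective 3-space. -/
abbrev RP3 := Projectivization ℝ (Fin 4 → ℝ)

/-- The real projective line. -/
abbrev RP1 := Projectivization ℝ (Fin 2 → ℝ)

/-- The point of `ℝP³` determined by a nonzero vector of `ℝ⁴`. -/
def projPt (x : Fin 4 → ℝ) (hx : x ≠ 0) : RP3 := Projectivization.mk ℝ x hx

/-- Anti-de Sitter space: the projectivization of the negative cone of `qform`.
(The sign of `qform x x` does not depend on the chosen representative.) -/
def AdS3 : Set RP3 := {P | qform P.rep P.rep < 0}

/-- The boundary at infinity of Anti-de Sitter space: the projectivization of the null cone. -/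
def bdryAdS3 : Set RP3 := {P | qform P.rep P.rep = 0}

/-- The nonzero lifts of a subset of `ℝP³`. -/
def lifts (Γ : Set RP3) : Set (Fin 4 → ℝ) :=
  {x | ∃ hx : x ≠ 0, projPt x hx ∈ Γ}

/-- The (projective) convex hull of a set `Γ ⊆ ℝP³` contained in an affine chart:
the image of the convex hull of a coherent family of lifts of `Γ`, chosen on the positive
side of a linear hyperplane avoiding all lifts of `Γ` (i.e. an affine chart containing `Γ`). -/
def projConvexHull (Γ : Set RP3) : Set RP3 :=
  {P | ∃ L : (Fin 4 → ℝ) →ₗ[ℝ] ℝ, (∀ x ∈ lifts Γ, L x ≠ 0) ∧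
      ∃ (y : Fin 4 → ℝ) (hy : y ≠ 0), projPt y hy = P ∧
        y ∈ convexHull ℝ {x | x ∈ lifts Γ ∧ 0 < L x}}

/-- The width of (the convex hull of) a set `Γ ⊆ ℝP³`: the supremum of the lengths of
timelike geodesic segments `t ↦ [cos t • a + sin t • b]` contained in the convex hull of `Γ`. -/
def width (Γ : Set RP3) : ℝ :=
  sSup {T : ℝ | 0 ≤ T ∧ T < π ∧ ∃ a b : Fin 4 → ℝ,
      qform a a = -1 ∧ qform b b = -1 ∧ qform a b = 0 ∧
      ∀ t ∈ Icc (0 : ℝ) T, ∃ h : (Real.cos t • a + Real.sin t • b) ≠ 0,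
        projPt (Real.cos t • a + Real.sin t • b) h ∈ projConvexHull Γ}

/-- Inverse hyperbolic cosine. -/
def arcosh (x : ℝ) : ℝ := Real.log (x + Real.sqrt (x ^ 2 - 1))

/-! ### The projective line, cross-ratios and quasisymmetric homeomorphisms -/

/-- Determinant of a pair of vectors of ℝ². -/
def det2 (v w : Fin 2 → ℝ) : ℝ := v 0 * w 1 - v 1 * w 0

/-- The cross-ratio of a quadruple of points of `ℝP¹`, with the convention
`cr(z₁,z₂,z₃,z₄) = (z₄−z₁)(z₃−z₂)/((z₂−z₁)(z₃−z₄))`.  (The expression below is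
invariant under rescaling of each of the four representatives.) -/
def crossRatio (z₁ z₂ z₃ z₄ : RP1) : ℝ :=
  (det2 z₄.rep z₁.rep * det2 z₃.rep z₂.rep) / (det2 z₂.rep z₁.rep * det2 z₃.rep z₄.rep)

/-- The cyclic orientation invariant of a triple of points of `ℝP¹`
(for finite points `a,b,c` it equals `(a−b)(b−c)(c−a)` and its sign is scale invariant). -/
def tripleOrient (a b c : RP1) : ℝ :=
  det2 a.rep b.rep * det2 b.rep c.rep * det2 c.rep a.rep

/-- A map of `ℝP¹` is orientation-preserving if it preserves the cyclic orientation
of triples of points. -/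
def OrientationPreserving (φ : RP1 → RP1) : Prop :=
  ∀ a b c : RP1, 0 < tripleOrient a b c → 0 < tripleOrient (φ a) (φ b) (φ c)

/-- The set of cross-ratio distortions `|ln |cr(φ(Q))||` of symmetric quadruples
(`cr(Q) = -1`) under the map `φ`. -/
def crSet (φ : RP1 → RP1) : Set ℝ :=
  {r | ∃ z₁ z₂ z₃ z₄ : RP1, crossRatio z₁ z₂ z₃ z₄ = -1 ∧
      r = |Real.log (abs (crossRatio (φ z₁) (φ z₂) (φ z₃) (φ z₄)))|}

/-- The cross-ratio norm `‖φ‖_cr` of a circle map `φ`. -/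
def crNorm (φ : RP1 → RP1) : ℝ := sSup (crSet φ)

/-- A quasisymmetric homeomorphism of `ℝP¹`: an orientation-preserving homeomorphism
with finite cross-ratio norm. -/
def Quasisymmetric (φ : RP1 ≃ₜ RP1) : Prop :=
  OrientationPreserving ⇑φ ∧ BddAbove (crSet ⇑φ)

/-- The null vector of ℝ^{2,2} corresponding to the pair of lines `([v],[w]) ∈ ℝP¹ × ℝP¹`
under the standard identification of `∂∞AdS³` with `ℝP¹ × ℝP¹` (via the rank-one
2×2 matrix `v wᵀ`, identifying ℝ^{2,2} with 2×2 matrices with minus the determinant). -/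
def toBoundary (v w : Fin 2 → ℝ) : Fin 4 → ℝ :=
  ![(v 0 * w 0 - v 1 * w 1) / 2, (v 0 * w 1 + v 1 * w 0) / 2,
    (v 0 * w 0 + v 1 * w 1) / 2, (v 0 * w 1 - v 1 * w 0) / 2]

/-- The graph `gr(φ)` of a map `φ : ℝP¹ → ℝP¹`, as a curve in `∂∞AdS³ ⊆ ℝP³`. -/
def grGraph (φ : RP1 → RP1) : Set RP3 :=
  {P | ∃ (v w : Fin 2 → ℝ) (hv : v ≠ 0) (hw : w ≠ 0) (hx : toBoundary v w ≠ 0),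
      projPt (toBoundary v w) hx = P ∧
      φ (Projectivization.mk ℝ v hv) = Projectivization.mk ℝ w hw}

/-! ### Spacelike and maximal surfaces in AdS³ -/

/-- The global timelike vector field `x ↦ (0,0,−x₄,x₃)` on the quadric, fixing the
time orientation of AdS³. -/
def timeVec (x : Fin 4 → ℝ) : Fin 4 → ℝ := ![0, 0, -(x 3), x 2]

/-- A (lifted, parametrized) smooth spacelike embedded disc in AdS³: a smooth embedding
of ℝ² into the quadric `{⟨x,x⟩ = −1} ⊆ ℝ^{2,2}` (the double cover of AdS³), with spacelike
first fundamental form, together with its future-directed unit normal field and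
the associated shape operator `B = ∇N`. -/
structure SpacelikeSurface where
  /-- the embedding of ℝ² into the quadric -/
  emb : (Fin 2 → ℝ) → (Fin 4 → ℝ)
  /-- the future-directed unit normal vector field -/
  normal : (Fin 2 → ℝ) → (Fin 4 → ℝ)
  /-- the shape operator, in the coordinates of the parametrization -/
  shape : (Fin 2 → ℝ) → ((Fin 2 → ℝ) →ₗ[ℝ] (Fin 2 → ℝ))
  smooth_emb : ContDiff ℝ (⊤ : ℕ∞) emb
  smooth_normal : ContDiff ℝ (⊤ : ℕ∞) normal
  inj : Function.Injective emb
  on_quadric : ∀ y, qform (emb y) (emb y) = -1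
  spacelike : ∀ y v, v ≠ 0 → 0 < qform (fderiv ℝ emb y v) (fderiv ℝ emb y v)
  normal_unit : ∀ y, qform (normal y) (normal y) = -1
  normal_orth_base : ∀ y, qform (normal y) (emb y) = 0
  normal_orth : ∀ y v, qform (normal y) (fderiv ℝ emb y v) = 0
  normal_future : ∀ y, qform (normal y) (timeVec (emb y)) < 0
  shape_spec : ∀ y v, fderiv ℝ normal y v = fderiv ℝ emb y (shape y v)

namespace SpacelikeSurface

variable (S : SpacelikeSurface)

/-- A spacelike surface is maximal if its shape operator is traceless. -/
def IsMaximal : Prop := ∀ y, LinearMap.trace ℝ (Fin 2 → ℝ) (S.shape y) = 0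

/-- The surface as a subset of `ℝP³` (i.e. of AdS³). -/
def proj : Set RP3 :=
  {P | ∃ (y : Fin 2 → ℝ) (h : S.emb y ≠ 0), projPt (S.emb y) h = P}

/-- The asymptotic boundary `∂∞S` of the surface: the frontier `closure S \ S`. -/
def bdryAtInfinity : Set RP3 := closure S.proj \ S.proj

/-- The surface is entire if its frontier is contained in the boundary at
infinity of AdS³. -/
def IsEntire : Prop := S.bdryAtInfinity ⊆ bdryAdS3

/-- The nonnegative principal curvature `λ` at a point: for a maximal surface the
principal curvatures are `±λ` with `λ = √(−det B)`. -/
def lambdaAt (y : Fin 2 → ℝ) : ℝ := Real.sqrt (-(LinearMap.det (S.shape y)))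

/-- The supremum `‖λ‖∞` of the principal curvatures of the surface. -/
def lambdaSup : ℝ := ⨆ y, S.lambdaAt y

/-- Nonpositive curvature: by the Gauss equation `K = −1 + λ²`, this is `λ ≤ 1`. -/
def NonpositiveCurvature : Prop := ∀ y, S.lambdaAt y ≤ 1

/-- Uniformly negative curvature: `λ ≤ 1 − ε` for some `ε > 0`. -/
def UniformlyNegativeCurvature : Prop := ∃ ε > 0, ∀ y, S.lambdaAt y ≤ 1 - ε

/-- The set of non-umbilical points of a maximal surface (where `λ ≠ 0`). -/
def nonUmbilic : Set (Fin 2 → ℝ) := {y | LinearMap.det (S.shape y) ≠ 0}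

/-- The intrinsic distance of the induced Riemannian metric on the surface. -/
def idist (y₁ y₂ : Fin 2 → ℝ) : ℝ :=
  sInf {L | ∃ c : ℝ → (Fin 2 → ℝ), ContDiff ℝ (⊤ : ℕ∞) c ∧ c 0 = y₁ ∧ c 1 = y₂ ∧
      L = ∫ t in (0:ℝ)..(1:ℝ),
        Real.sqrt (qform (deriv (fun s => S.emb (c s)) t) (deriv (fun s => S.emb (c s)) t))}

/-- `F` is the intrinsic gradient field of the function `f` on `U ⊆ S`: the vector field
which is `I`-dual to the differential of `f`. -/
def IsGradientOn (U : Set (Fin 2 → ℝ)) (f : (Fin 2 → ℝ) → ℝ)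
    (F : (Fin 2 → ℝ) → (Fin 2 → ℝ)) : Prop :=
  ∀ y ∈ U, ∀ v, qform (fderiv ℝ S.emb y (F y)) (fderiv ℝ S.emb y v) = fderiv ℝ f y v

/-- `H` is the intrinsic Hessian (as a (1,1)-tensor) of a function with gradient field `F`
on `U ⊆ S`: the tangential part of the ambient flat derivative of the ambient gradient
field (the normal part, in the ambient coordinates, lies in `span{σ(y), N(y)}`). -/
def IsHessianOn (U : Set (Fin 2 → ℝ)) (F : (Fin 2 → ℝ) → (Fin 2 → ℝ))
    (H : (Fin 2 → ℝ) → ((Fin 2 → ℝ) →ₗ[ℝ] (Fin 2 → ℝ))) : Prop :=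
  ∀ y ∈ U, ∀ v, ∃ a b : ℝ,
    fderiv ℝ (fun y' => fderiv ℝ S.emb y' (F y')) y v
      = fderiv ℝ S.emb y (H y v) + a • S.emb y + b • S.normal y

/-- The squared norm `‖grad f‖²` of a gradient field `F`, for the induced metric. -/
def gradNormSq (F : (Fin 2 → ℝ) → (Fin 2 → ℝ)) (y : Fin 2 → ℝ) : ℝ :=
  qform (fderiv ℝ S.emb y (F y)) (fderiv ℝ S.emb y (F y))

/-- `Δf` is the Laplace–Beltrami operator of the induced metric applied to `f`, on `U`:
the trace of the intrinsic Hessian. -/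
def IsLaplacianOn (U : Set (Fin 2 → ℝ)) (f Δf : (Fin 2 → ℝ) → ℝ) : Prop :=
  ∃ F H, S.IsGradientOn U f F ∧ S.IsHessianOn U F H ∧
    ∀ y ∈ U, Δf y = LinearMap.trace ℝ (Fin 2 → ℝ) (H y)

/-- `c` parametrizes an intrinsic geodesic of the surface: the ambient acceleration
is orthogonal to the surface, i.e. lies in `span{σ(c t), N(c t)}`. -/
def IsIntrinsicGeodesic (c : ℝ → (Fin 2 → ℝ)) : Prop :=
  ∀ t, ∃ a b : ℝ,
    deriv (deriv (fun s => S.emb (c s))) t = a • S.emb (c t) + b • S.normal (c t)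

/-- `E` is a system of normal coordinates for the surface centered at `y₀` (i.e. the
exponential map of the induced metric at that point, read in an orthonormal frame). -/
def IsNormalCoordsAt (y₀ : Fin 2 → ℝ) (E : (Fin 2 → ℝ) → (Fin 2 → ℝ)) : Prop :=
  E 0 = y₀ ∧ (∀ v, S.IsIntrinsicGeodesic (fun t => E (t • v))) ∧
  ∀ v w : Fin 2 → ℝ,
    qform (deriv (fun t : ℝ => S.emb (E (t • v))) 0) (deriv (fun t : ℝ => S.emb (E (t • w))) 0)
      = v 0 * w 0 + v 1 * w 1

end SpacelikeSurface

/-- The normal flow at time `ρ`: the parametrization of the surface `S_ρ` at constant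
timelike distance `ρ` from `S`. -/
def parallelEmb (S : SpacelikeSurface) (ρ : ℝ) : (Fin 2 → ℝ) → (Fin 4 → ℝ) :=
  fun y => Real.cos ρ • S.emb y + Real.sin ρ • S.normal y

/-- The pull-back to `S` of the first fundamental form of the parallel surface `S_ρ`. -/
def Irho (S : SpacelikeSurface) (ρ : ℝ) (y : Fin 2 → ℝ) (v w : Fin 2 → ℝ) : ℝ :=
  qform (fderiv ℝ (parallelEmb S ρ) y v) (fderiv ℝ (parallelEmb S ρ) y w)

/-- The second fundamental form of the parallel surface `S_ρ`, via `II_ρ = ½ dI_ρ/dρ`. -/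
def IIrho (S : SpacelikeSurface) (ρ : ℝ) (y : Fin 2 → ℝ) (v w : Fin 2 → ℝ) : ℝ :=
  (1 / 2) * deriv (fun ρ' => Irho S ρ' y v w) ρ

/-! ### Euclidean balls and `C⁰`/`C²` norms on ℝ² -/

/-- The Euclidean ball of radius `r` centered at the origin of ℝ². -/
def eball (r : ℝ) : Set (Fin 2 → ℝ) := {z | Real.sqrt ((z 0) ^ 2 + (z 1) ^ 2) < r}

/-- The `C⁰` norm of a function on the Euclidean ball of radius `r`. -/
def C0norm (u : (Fin 2 → ℝ) → ℝ) (r : ℝ) : ℝ :=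
  sSup {a | ∃ z ∈ eball r, a = |u z|}

/-- The `C²` norm of a function on the Euclidean ball of radius `r`. -/
def C2norm (u : (Fin 2 → ℝ) → ℝ) (r : ℝ) : ℝ :=
  sSup {a | ∃ z ∈ eball r, a = |u z| + ‖fderiv ℝ u z‖ + ‖fderiv ℝ (fderiv ℝ u) z‖}

end AdSPaper
/-! ### The hyperbolic plane, quasiconformal dilatation and minimal Lagrangian maps -/

namespace AdSPaper

/-- The upper half-plane model of ℍ², as a subset of ℂ. -/
def Hset : Set ℂ := {z | 0 < z.im}

/-- The real inner product on ℂ ≅ ℝ². -/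
def rinner (v w : ℂ) : ℝ := v.re * w.re + v.im * w.im

/-- The Christoffel bilinear form of the hyperbolic metric `(dx² + dy²)/y²` on the
upper half-plane: `Γ_z(v,w) = (i / Im z) · (v·w)` (complex multiplication). -/
def Gamma (z v w : ℂ) : ℂ := (Complex.I / (z.im : ℂ)) * (v * w)

/-- The quasiconformal dilatation of a map `Φ` at the point `z`: the ratio between the
major and the minor axis of the image of a unit circle under the differential of `Φ`. -/
def dilatationAt (Φ : ℂ → ℂ) (z : ℂ) : ℝ :=
  (⨆ v : {v : ℂ // ‖v‖ = 1}, ‖fderiv ℝ Φ z (v : ℂ)‖) /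
    (⨅ v : {v : ℂ // ‖v‖ = 1}, ‖fderiv ℝ Φ z (v : ℂ)‖)

/-- The maximal dilatation `K(Φ)` of a map of the upper half-plane. -/
def maxDilatation (Φ : ℂ → ℂ) : ℝ := ⨆ z : Hset, dilatationAt Φ (z : ℂ)

/-- `Φ` is a minimal Lagrangian diffeomorphism of ℍ² (upper half-plane model): a smooth
diffeomorphism of ℍ² which is area-preserving and whose graph is minimal in ℍ² × ℍ²;
equivalently (Bonsante–Schlenker, Prop. 1.2.6 of Toulisse), `Φ*g = g(b·,b·)` for a
self-adjoint, `det = 1`, Codazzi bundle morphism `b`. -/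
def IsMinimalLagrangian (Φ : ℂ → ℂ) : Prop :=
  ContDiffOn ℝ (⊤ : ℕ∞) Φ Hset ∧ Set.BijOn Φ Hset Hset ∧
  (∃ Ψ : ℂ → ℂ, ContDiffOn ℝ (⊤ : ℕ∞) Ψ Hset ∧ Set.InvOn Ψ Φ Hset Hset) ∧
  ∃ b : ℂ → (ℂ →L[ℝ] ℂ),
    (∀ z ∈ Hset, ∀ v w : ℂ, rinner (b z v) w = rinner v (b z w)) ∧
    (∀ z ∈ Hset, LinearMap.det ((b z : ℂ →L[ℝ] ℂ) : ℂ →ₗ[ℝ] ℂ) = 1) ∧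
    (∀ z ∈ Hset, ∀ v w : ℂ,
      rinner (fderiv ℝ Φ z v) (fderiv ℝ Φ z w) / (Φ z).im ^ 2
        = rinner (b z v) (b z w) / z.im ^ 2) ∧
    (∀ z ∈ Hset, ∀ v w : ℂ,
      fderiv ℝ (fun u => b u w) z v + Gamma z v (b z w) - b z (Gamma z v w)
        = fderiv ℝ (fun u => b u v) z w + Gamma z w (b z v) - b z (Gamma z w v))

/-- The point of the boundary `∂ℍ² = ℝ ∪ {∞}` of the upper half-plane (inside the
Riemann sphere `ℂ ∪ {∞}`) corresponding to a point of `ℝP¹`. -/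
def rp1ToSphere (ξ : RP1) : OnePoint ℂ :=
  if ξ.rep 1 = 0 then OnePoint.infty
  else OnePoint.some ((ξ.rep 0 / ξ.rep 1 : ℝ) : ℂ)

/-- `Φ : ℍ² → ℍ²` extends the circle map `φ : ℝP¹ → ℝP¹`: at every boundary point `ξ`,
`Φ(z) → φ(ξ)` as `z → ξ` from inside the upper half-plane (in the Riemann sphere). -/
def ExtendsToBoundary (Φ : ℂ → ℂ) (φ : RP1 → RP1) : Prop :=
  ∀ ξ : RP1, Filter.Tendsto (fun z => OnePoint.some (Φ z))
      ((Filter.comap OnePoint.some (nhds (rp1ToSphere ξ))) ⊓ Filter.principal Hset)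
      (nhds (rp1ToSphere (φ ξ)))

/-- `Φ` is the (unique) minimal Lagrangian extension of the quasisymmetric
homeomorphism `φ` of `ℝP¹`. -/
def IsMinimalLagrangianExtension (Φ : ℂ → ℂ) (φ : RP1 → RP1) : Prop :=
  IsMinimalLagrangian Φ ∧ ExtendsToBoundary Φ φ

end AdSPaper

namespace AdSPaper

/-! ### Second order calculus on the upper half-plane -/

/-- Directional derivative of a real function on the plane. -/
def D (v : ℂ) (g : ℂ → ℝ) (z : ℂ) : ℝ := fderiv ℝ g z v

/-- Functions of class `C¹` on the half-plane. -/
def C1 (g : ℂ → ℝ) : Prop := ContDiffOn ℝ 1 g Hset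

/-- Functions of class `C²` on the half-plane. -/
def C2 (g : ℂ → ℝ) : Prop := ContDiffOn ℝ 2 g Hset

theorem isOpen_Hset : IsOpen Hset := isOpen_lt continuous_const Complex.continuous_im

theorem Hset_mem_nhds {z : ℂ} (hz : z ∈ Hset) : Hset ∈ 𝓝 z := isOpen_Hset.mem_nhds hz

theorem C2.c1 {g : ℂ → ℝ} (h : C2 g) : C1 g := ContDiffOn.of_le h (by norm_num)

theorem C1.differentiableAt {g : ℂ → ℝ} (h : C1 g) {z : ℂ} (hz : z ∈ Hset) :
    DifferentiableAt ℝ g z :=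
  (ContDiffOn.contDiffAt h (Hset_mem_nhds hz)).differentiableAt (by norm_num)

theorem C2.contDiffAt {g : ℂ → ℝ} (h : C2 g) {z : ℂ} (hz : z ∈ Hset) : ContDiffAt ℝ 2 g z :=
  ContDiffOn.contDiffAt h (Hset_mem_nhds hz)

theorem C2.differentiableAt {g : ℂ → ℝ} (h : C2 g) {z : ℂ} (hz : z ∈ Hset) :
    DifferentiableAt ℝ g z := h.c1.differentiableAt hz

theorem C2.D {g : ℂ → ℝ} (h : C2 g) (v : ℂ) : C1 (D v g) := by
  have h1 : ContDiffOn ℝ 1 (fderiv ℝ g) Hset :=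
    ContDiffOn.fderiv_of_isOpen h isOpen_Hset (by norm_num)
  exact h1.clm_apply contDiffOn_const

theorem C1.add {f g : ℂ → ℝ} (hf : C1 f) (hg : C1 g) : C1 (fun z => f z + g z) :=
  ContDiffOn.add hf hg
theorem C1.sub {f g : ℂ → ℝ} (hf : C1 f) (hg : C1 g) : C1 (fun z => f z - g z) :=
  ContDiffOn.sub hf hg
theorem C1.mul {f g : ℂ → ℝ} (hf : C1 f) (hg : C1 g) : C1 (fun z => f z * g z) :=
  ContDiffOn.mul hf hg
theorem C2.add {f g : ℂ → ℝ} (hf : C2 f) (hg : C2 g) : C2 (fun z => f z + g z) :=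
  ContDiffOn.add hf hg
theorem C2.sub {f g : ℂ → ℝ} (hf : C2 f) (hg : C2 g) : C2 (fun z => f z - g z) :=
  ContDiffOn.sub hf hg
theorem C2.mul {f g : ℂ → ℝ} (hf : C2 f) (hg : C2 g) : C2 (fun z => f z * g z) :=
  ContDiffOn.mul hf hg
theorem C2.const (c : ℝ) : C2 (fun _ => c) := contDiffOn_const
theorem C1.const (c : ℝ) : C1 (fun _ => c) := contDiffOn_const
theorem C2.div {f g : ℂ → ℝ} (hf : C2 f) (hg : C2 g) (h0 : ∀ z ∈ Hset, g z ≠ 0) :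
    C2 (fun z => f z / g z) := ContDiffOn.div hf hg h0
theorem C2.im : C2 Complex.im := Complex.imCLM.contDiff.contDiffOn
theorem C2.re : C2 Complex.re := Complex.reCLM.contDiff.contDiffOn
theorem C2.sqrt {f : ℂ → ℝ} (hf : C2 f) (h0 : ∀ z ∈ Hset, f z ≠ 0) :
    C2 (fun z => √(f z)) := ContDiffOn.sqrt hf h0

theorem D_congr {f g : ℂ → ℝ} (h : EqOn f g Hset) (v : ℂ) {z : ℂ} (hz : z ∈ Hset) :
    D v f z = D v g z := by
  unfold D
  rw [Filter.EventuallyEq.fderiv_eq (h.eventuallyEq_of_mem (Hset_mem_nhds hz))]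

theorem D_const (c : ℝ) (v z : ℂ) : D v (fun _ => c) z = 0 := by simp [D]

theorem D_im (v z : ℂ) : D v Complex.im z = v.im := by
  have : HasFDerivAt Complex.im Complex.imCLM z := Complex.imCLM.hasFDerivAt
  simp [D, this.fderiv]

theorem D_re (v z : ℂ) : D v Complex.re z = v.re := by
  have : HasFDerivAt Complex.re Complex.reCLM z := Complex.reCLM.hasFDerivAt
  simp [D, this.fderiv]

section
variable {f g : ℂ → ℝ} (v w : ℂ) {z : ℂ} (hz : z ∈ Hset)

theorem D_add (hf : C1 f) (hg : C1 g) (hz : z ∈ Hset) :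
    D v (fun u => f u + g u) z = D v f z + D v g z := by
  unfold D
  rw [fderiv_fun_add (hf.differentiableAt hz) (hg.differentiableAt hz)]; rfl

theorem D_sub (hf : C1 f) (hg : C1 g) (hz : z ∈ Hset) :
    D v (fun u => f u - g u) z = D v f z - D v g z := by
  unfold D
  rw [fderiv_fun_sub (hf.differentiableAt hz) (hg.differentiableAt hz)]; rfl

theorem D_mul (hf : C1 f) (hg : C1 g) (hz : z ∈ Hset) :
    D v (fun u => f u * g u) z = f z * D v g z + g z * D v f z := by
  unfold D
  rw [fderiv_fun_mul (hf.differentiableAt hz) (hg.differentiableAt hz)]; rfl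

theorem D_const_mul (c : ℝ) (hg : C1 g) (hz : z ∈ Hset) :
    D v (fun u => c * g u) z = c * D v g z := by
  rw [D_mul v (C1.const c) hg hz, D_const]; ring

theorem DD_add (hf : C2 f) (hg : C2 g) (hz : z ∈ Hset) :
    D v (D w (fun u => f u + g u)) z = D v (D w f) z + D v (D w g) z := by
  rw [D_congr (g := fun u => D w f u + D w g u) (fun u hu => D_add w hf.c1 hg.c1 hu) v hz,
    D_add v (hf.D w) (hg.D w) hz]

theorem DD_sub (hf : C2 f) (hg : C2 g) (hz : z ∈ Hset) :
    D v (D w (fun u => f u - g u)) z = D v (D w f) z - D v (D w g) z := by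
  rw [D_congr (g := fun u => D w f u - D w g u) (fun u hu => D_sub w hf.c1 hg.c1 hu) v hz,
    D_sub v (hf.D w) (hg.D w) hz]

theorem DD_const (c : ℝ) (z : ℂ) : D v (D w (fun _ => c)) z = 0 := by
  have : D w (fun _ => c) = fun _ => 0 := by funext u; exact D_const c w u
  rw [this, D_const]

theorem DD_mul (hf : C2 f) (hg : C2 g) (hz : z ∈ Hset) :
    D v (D w (fun u => f u * g u)) z =
      f z * D v (D w g) z + D v f z * D w g z + D v g z * D w f z + g z * D v (D w f) z := by
  rw [D_congr (g := fun u => f u * D w g u + g u * D w f u)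
      (fun u hu => D_mul w hf.c1 hg.c1 hu) v hz,
    D_add v (hf.c1.mul (hg.D w)) (hg.c1.mul (hf.D w)) hz,
    D_mul v hf.c1 (hg.D w) hz, D_mul v hg.c1 (hf.D w) hz]
  ring

theorem D_eq_iterated (hf : C2 f) (hz : z ∈ Hset) :
    D v (D w f) z = fderiv ℝ (fderiv ℝ f) z v w := by
  have h1 : ContDiffOn ℝ 1 (fderiv ℝ f) Hset :=
    ContDiffOn.fderiv_of_isOpen hf isOpen_Hset (by norm_num)
  have h2 : DifferentiableAt ℝ (fderiv ℝ f) z :=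
    (ContDiffOn.contDiffAt h1 (Hset_mem_nhds hz)).differentiableAt (by norm_num)
  unfold D
  rw [fderiv_clm_apply h2 (differentiableAt_const w)]
  simp

theorem DD_comm (hf : C2 f) (hz : z ∈ Hset) : D v (D w f) z = D w (D v f) z := by
  rw [D_eq_iterated v w hf hz, D_eq_iterated w v hf hz]
  have := (hf.contDiffAt hz).isSymmSndFDerivAt (by simp)
  exact this v w

theorem DD_im (z : ℂ) : D v (D w Complex.im) z = 0 := by
  have : D w Complex.im = fun _ => w.im := by funext u; exact D_im w u
  rw [this, D_const]

theorem DD_re (z : ℂ) : D v (D w Complex.re) z = 0 := by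
  have : D w Complex.re = fun _ => w.re := by funext u; exact D_re w u
  rw [this, D_const]
end

theorem D_smul_add (a b : ℝ) (v w : ℂ) (g : ℂ → ℝ) (z : ℂ) :
    D (a • v + b • w) g z = a * D v g z + b * D w g z := by
  unfold D; rw [map_add, map_smul, map_smul]; rfl

/-! ### The elliptic operator attached to a symmetric field -/

/-- The symmetric first order form with coefficient matrix `[[r, -q], [-q, p]]`. -/
def Bf (p q r : ℂ → ℝ) (f g : ℂ → ℝ) (z : ℂ) : ℝ :=
  z.im ^ 2 * (r z * (D 1 f z * D 1 g z)
    - q z * (D 1 f z * D Complex.I g z + D Complex.I f z * D 1 g z)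
    + p z * (D Complex.I f z * D Complex.I g z))

/-- The second order operator with principal part `[[r, -q], [-q, p]]`. -/
def Lop (p q r : ℂ → ℝ) (g : ℂ → ℝ) (z : ℂ) : ℝ :=
  z.im ^ 2 * (r z * D 1 (D 1 g) z - 2 * q z * D 1 (D Complex.I g) z
    + p z * D Complex.I (D Complex.I g) z)
  + z.im * (-(2 * q z) * D 1 g z + (p z - r z) * D Complex.I g z)

section
variable {p q r : ℂ → ℝ} {f g h : ℂ → ℝ} {z : ℂ}

theorem Bf_comm (f g : ℂ → ℝ) (z : ℂ) : Bf p q r f g z = Bf p q r g f z := by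
  unfold Bf; ring

theorem Bf_add_left (hf : C1 f) (hg : C1 g) (hz : z ∈ Hset) :
    Bf p q r (fun u => f u + g u) h z = Bf p q r f h z + Bf p q r g h z := by
  unfold Bf; rw [D_add _ hf hg hz, D_add _ hf hg hz]; ring

theorem Bf_sub_left (hf : C1 f) (hg : C1 g) (hz : z ∈ Hset) :
    Bf p q r (fun u => f u - g u) h z = Bf p q r f h z - Bf p q r g h z := by
  unfold Bf; rw [D_sub _ hf hg hz, D_sub _ hf hg hz]; ring

theorem Bf_mul_left (hf : C1 f) (hg : C1 g) (hz : z ∈ Hset) :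
    Bf p q r (fun u => f u * g u) h z = f z * Bf p q r g h z + g z * Bf p q r f h z := by
  unfold Bf; rw [D_mul _ hf hg hz, D_mul _ hf hg hz]; ring

theorem Bf_const_left (c : ℝ) : Bf p q r (fun _ => c) h z = 0 := by
  unfold Bf; rw [D_const, D_const]; ring

theorem Lop_add (hf : C2 f) (hg : C2 g) (hz : z ∈ Hset) :
    Lop p q r (fun u => f u + g u) z = Lop p q r f z + Lop p q r g z := by
  unfold Lop
  rw [D_add _ hf.c1 hg.c1 hz, D_add _ hf.c1 hg.c1 hz, DD_add _ _ hf hg hz, DD_add _ _ hf hg hz,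
    DD_add _ _ hf hg hz]; ring

theorem Lop_sub (hf : C2 f) (hg : C2 g) (hz : z ∈ Hset) :
    Lop p q r (fun u => f u - g u) z = Lop p q r f z - Lop p q r g z := by
  unfold Lop
  rw [D_sub _ hf.c1 hg.c1 hz, D_sub _ hf.c1 hg.c1 hz, DD_sub _ _ hf hg hz, DD_sub _ _ hf hg hz,
    DD_sub _ _ hf hg hz]; ring

theorem Lop_const (c : ℝ) : Lop p q r (fun _ => c) z = 0 := by
  unfold Lop; simp only [D_const, DD_const]; ring

theorem Lop_mul (hf : C2 f) (hg : C2 g) (hz : z ∈ Hset) :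
    Lop p q r (fun u => f u * g u) z =
      f z * Lop p q r g z + g z * Lop p q r f z + 2 * Bf p q r f g z := by
  unfold Lop Bf
  rw [D_mul _ hf.c1 hg.c1 hz, D_mul _ hf.c1 hg.c1 hz, DD_mul _ _ hf hg hz, DD_mul _ _ hf hg hz,
    DD_mul _ _ hf hg hz]
  ring

theorem Lop_const_mul (c : ℝ) (hg : C2 g) (hz : z ∈ Hset) :
    Lop p q r (fun u => c * g u) z = c * Lop p q r g z := by
  rw [Lop_mul (C2.const c) hg hz, Lop_const, Bf_const_left]; ring

theorem Lop_congr (h : EqOn f g Hset) (hz : z ∈ Hset) : Lop p q r f z = Lop p q r g z := by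
  have h1 : ∀ v, EqOn (D v f) (D v g) Hset := fun v u hu => D_congr h v hu
  unfold Lop
  rw [D_congr h _ hz, D_congr h _ hz, D_congr (h1 _) _ hz, D_congr (h1 _) _ hz,
    D_congr (h1 _) _ hz]

theorem Bf_congr_left (h' : EqOn f g Hset) (hz : z ∈ Hset) :
    Bf p q r f h z = Bf p q r g h z := by
  unfold Bf; rw [D_congr h' _ hz, D_congr h' _ hz]

theorem Bf_self_nonneg (hp : 0 < p z) (hdet : p z * r z - q z ^ 2 = 1) :
    0 ≤ Bf p q r f f z := by
  unfold Bf
  apply mul_nonneg (sq_nonneg _)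
  have : p z * (r z * (D 1 f z * D 1 f z)
    - q z * (D 1 f z * D Complex.I f z + D Complex.I f z * D 1 f z)
    + p z * (D Complex.I f z * D Complex.I f z)) =
      (D 1 f z) ^ 2 + (p z * D Complex.I f z - q z * D 1 f z) ^ 2 := by
    linear_combination (D 1 f z) ^ 2 * hdet
  by_contra hneg
  push Not at hneg
  nlinarith [mul_neg_of_pos_of_neg hp hneg, sq_nonneg (D 1 f z),
    sq_nonneg (p z * D Complex.I f z - q z * D 1 f z)]
end

/-! ### The maximum principle at infinity -/

theorem DD_nonpos_of_isLocalMax {g : ℂ → ℝ} (hg : C2 g) {z : ℂ} (hz : z ∈ Hset)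
    (hmax : IsLocalMax g z) (v : ℂ) : D v (D v g) z ≤ 0 := by
  by_contra hpos
  push Not at hpos
  set l : ℝ → ℂ := fun t => z + t • v with hl
  have hl0 : l 0 = z := by simp [hl]
  have hld : ∀ t, HasDerivAt l v t := by
    intro t
    have := ((hasDerivAt_id t).smul_const v).const_add z
    simpa [hl] using this
  have hlc : Continuous l := by fun_prop
  have hnear : ∀ᶠ t in 𝓝 (0 : ℝ), l t ∈ Hset :=
    hlc.continuousAt.eventually (by rw [hl0]; exact Hset_mem_nhds hz)
  have hd1 : ∀ᶠ t in 𝓝 (0 : ℝ), HasDerivAt (fun s => g (l s)) (D v g (l t)) t := by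
    filter_upwards [hnear] with t ht
    exact (hg.differentiableAt ht).hasFDerivAt.comp_hasDerivAt t (hld t)
  have hd1' : deriv (fun s => g (l s)) =ᶠ[𝓝 0] fun t => D v g (l t) := by
    filter_upwards [hd1] with t ht using ht.deriv
  have hd2 : HasDerivAt (fun t => D v g (l t)) (D v (D v g) z) 0 := by
    have h1 := ((hg.D v).differentiableAt hz).hasFDerivAt
    rw [← hl0] at h1
    have := h1.comp_hasDerivAt (0 : ℝ) (hld 0)
    rw [hl0] at this
    exact this
  have hdd : deriv (deriv (fun s => g (l s))) 0 = D v (D v g) z := by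
    rw [hd1'.deriv_eq, hd2.deriv]
  have hmaxl : IsLocalMax (fun s => g (l s)) 0 := by
    have h0 : Tendsto l (𝓝 0) (𝓝 z) := by
      have := hlc.tendsto 0
      rwa [hl0] at this
    have := h0.eventually hmax
    unfold IsLocalMax IsMaxFilter
    simpa [hl0] using this
  have hmin : IsLocalMin (fun s => g (l s)) 0 := by
    apply isLocalMin_of_deriv_deriv_pos
    · rw [hdd]; exact hpos
    · exact hmaxl.deriv_eq_zero
    · exact (hd1.self_of_nhds).continuousAt
  have hconst : (fun s => g (l s)) =ᶠ[𝓝 0] fun _ => g (l 0) := by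
    filter_upwards [hmaxl, hmin] with t h1 h2 using le_antisymm h1 h2
  have : deriv (deriv (fun s => g (l s))) 0 = 0 := by
    rw [hconst.deriv.deriv_eq]; simp
  rw [hdd] at this
  linarith

theorem D_eq_zero_of_isLocalMax {g : ℂ → ℝ} {z : ℂ} (hmax : IsLocalMax g z) (v : ℂ) :
    D v g z = 0 := by
  unfold D; rw [hmax.fderiv_eq_zero]; rfl

theorem Lop_nonpos_of_isLocalMax {p q r g : ℂ → ℝ} (hg : C2 g) {z : ℂ} (hz : z ∈ Hset)
    (hp : 0 < p z) (hdet : p z * r z - q z ^ 2 = 1) (hmax : IsLocalMax g z) :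
    Lop p q r g z ≤ 0 := by
  have h1 := DD_nonpos_of_isLocalMax hg hz hmax 1
  have h2 := DD_nonpos_of_isLocalMax hg hz hmax (p z • Complex.I + (-q z) • 1)
  have e2 : D (p z • Complex.I + (-q z) • 1) (D (p z • Complex.I + (-q z) • 1) g) z
      = p z ^ 2 * D Complex.I (D Complex.I g) z - 2 * p z * q z * D 1 (D Complex.I g) z
        + q z ^ 2 * D 1 (D 1 g) z := by
    rw [D_smul_add, DD_comm _ _ hg hz, DD_comm 1 _ hg hz, D_smul_add, D_smul_add,
      DD_comm Complex.I 1 hg hz]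
    ring
  rw [e2] at h2
  unfold Lop
  rw [D_eq_zero_of_isLocalMax hmax, D_eq_zero_of_isLocalMax hmax]
  have key : p z * (r z * D 1 (D 1 g) z - 2 * q z * D 1 (D Complex.I g) z
    + p z * D Complex.I (D Complex.I g) z) ≤ 0 := by
    nlinarith
  have : (r z * D 1 (D 1 g) z - 2 * q z * D 1 (D Complex.I g) z
    + p z * D Complex.I (D Complex.I g) z) ≤ 0 := nonpos_of_mul_nonpos_right key hp
  nlinarith [sq_nonneg z.im]

/-- The exhaustion function `(1 + x² + y²) / y`. -/
def exh (z : ℂ) : ℝ := (1 + z.re * z.re + z.im * z.im) / z.im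

theorem C2_exh : C2 exh := by
  apply C2.div _ C2.im (fun z hz => ne_of_gt hz)
  exact ((C2.const 1).add (C2.re.mul C2.re)).add (C2.im.mul C2.im)

theorem exh_ge {z : ℂ} (hz : z ∈ Hset) : 1 ≤ exh z := by
  have hy : 0 < z.im := hz
  rw [exh, le_div_iff₀ hy]
  nlinarith [sq_nonneg z.re, sq_nonneg (z.im - 1), sq_nonneg z.im]

theorem Lop_exh {p q r : ℂ → ℝ} {z : ℂ} (hz : z ∈ Hset) :
    Lop p q r exh z = (p z + r z) * exh z := by
  have hy : 0 < z.im := hz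
  have hyne : z.im ≠ 0 := hy.ne'
  have hEq : EqOn (fun u => u.im * exh u) (fun u => 1 + u.re * u.re + u.im * u.im) Hset := by
    intro u hu
    have : u.im ≠ 0 := ne_of_gt hu
    simp only [exh]; field_simp
  have hN : C2 (fun u : ℂ => 1 + u.re * u.re) := (C2.const 1).add (C2.re.mul C2.re)
  have h1 := Lop_congr (p := p) (q := q) (r := r) hEq hz
  rw [Lop_mul C2.im C2_exh hz, Lop_add hN (C2.im.mul C2.im) hz,
    Lop_add (C2.const 1) (C2.re.mul C2.re) hz, Lop_const, Lop_mul C2.re C2.re hz,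
    Lop_mul C2.im C2.im hz] at h1
  have h2 := Bf_congr_left (p := p) (q := q) (r := r) (h := Complex.im) hEq hz
  rw [Bf_mul_left C2.im.c1 C2_exh.c1 hz, Bf_add_left hN.c1 (C2.im.mul C2.im).c1 hz,
    Bf_add_left (C2.const 1).c1 (C2.re.mul C2.re).c1 hz, Bf_const_left,
    Bf_mul_left C2.re.c1 C2.re.c1 hz, Bf_mul_left C2.im.c1 C2.im.c1 hz,
    Bf_comm exh] at h2
  have h3 := hEq hz
  simp only [] at h3
  have b1 : Bf p q r Complex.im Complex.im z = z.im ^ 2 * p z := by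
    simp [Bf, D_im]
  have b2 : Bf p q r Complex.re Complex.re z = z.im ^ 2 * r z := by
    simp [Bf, D_re]
  have b3 : Bf p q r Complex.re Complex.im z = - (z.im ^ 2 * q z) := by
    simp [Bf, D_re, D_im]
  have l1 : Lop p q r Complex.im z = z.im * (p z - r z) := by
    simp [Lop, D_im, DD_im]
  have l2 : Lop p q r Complex.re z = - (z.im * (2 * q z)) := by
    simp [Lop, D_re, DD_re]
  rw [b1, b3] at h2
  rw [l1, l2, b1, b2] at h1
  have hB : Bf p q r Complex.im exh z = - (2 * z.re * q z * z.im) + 2 * z.im ^ 2 * p z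
      - exh z * z.im * p z := by
    apply mul_left_cancel₀ hyne
    linear_combination h2
  rw [hB] at h1
  apply mul_left_cancel₀ hyne
  linear_combination h1

theorem Lop_log_exh_le {p q r : ℂ → ℝ} {z : ℂ} (hz : z ∈ Hset) (hp : 0 < p z)
    (hdet : p z * r z - q z ^ 2 = 1) :
    Lop p q r (fun u => Real.log (exh u)) z ≤ p z + r z := by
  have hpos : ∀ u ∈ Hset, 0 < exh u := fun u hu => lt_of_lt_of_le one_pos (exh_ge hu)
  have hC : C2 (fun u => Real.log (exh u)) :=
    ContDiffOn.log C2_exh (fun u hu => (hpos u hu).ne')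
  set a : ℂ → ℝ := fun u => Real.log (exh u) with ha
  have h1 : ∀ v, EqOn (D v exh) (fun u => exh u * D v a u) Hset := by
    intro v u hu
    have : D v a u = (exh u)⁻¹ * D v exh u := by
      simp only [D, ha]
      rw [((C2_exh.differentiableAt hu).hasFDerivAt.log (hpos u hu).ne').fderiv]
      simp
    simp only [this]
    field_simp [(hpos u hu).ne']
  have h2 : ∀ v w, D v (D w exh) z = exh z * D v (D w a) z + D w a z * D v exh z := by
    intro v w
    rw [D_congr (h1 w) v hz, D_mul v C2_exh.c1 (hC.D w) hz]
  have h3 := Lop_exh (p := p) (q := q) (r := r) hz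
  have h4 : Lop p q r exh z = exh z * Lop p q r a z + exh z * Bf p q r a a z := by
    unfold Lop Bf
    rw [h2, h2, h2, h1 1 hz, h1 Complex.I hz]
    ring
  have h5 := Bf_self_nonneg (f := a) hp hdet
  have h6 : exh z * (Lop p q r a z + Bf p q r a a z) = exh z * (p z + r z) := by
    rw [mul_add, ← h4, h3]; ring
  have h7 := mul_left_cancel₀ (hpos z hz).ne' h6
  linarith

theorem isCompact_exh_le {N : ℝ} (hN : 0 < N) : IsCompact {z : ℂ | z ∈ Hset ∧ exh z ≤ N} := by
  have : {z : ℂ | z ∈ Hset ∧ exh z ≤ N} = {z : ℂ | 1 + z.re * z.re + z.im * z.im ≤ N * z.im} := by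
    ext z
    simp only [mem_ofPred_eq]
    constructor
    · rintro ⟨hz, h⟩
      rwa [exh, div_le_iff₀ hz] at h
    · intro h
      have hz : 0 < z.im := by
        by_contra hneg
        push Not at hneg
        nlinarith [sq_nonneg z.re, sq_nonneg z.im]
      exact ⟨hz, by rwa [exh, div_le_iff₀ hz]⟩
  rw [this]
  apply Metric.isCompact_of_isClosed_isBounded
  · exact isClosed_le (by fun_prop) (by fun_prop)
  · rw [isBounded_iff_forall_norm_le]
    refine ⟨N, fun z hz => ?_⟩
    simp only [mem_ofPred_eq] at hz
    have h1 : z.im ≤ N := by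
      by_contra h
      push Not at h
      nlinarith [sq_nonneg z.re]
    have h2 : ‖z‖ ^ 2 ≤ N ^ 2 := by
      rw [← Complex.normSq_eq_norm_sq, Complex.normSq_apply]
      nlinarith
    exact le_of_sq_le_sq h2 hN.le

/-- Omori–Yau type maximum principle for the operator `Lop`. -/
theorem max_principle {p q r P : ℂ → ℝ} {M K κ c : ℝ} (hP : C2 P) (hκ : 0 < κ)
    (hp : ∀ z ∈ Hset, 0 < p z) (hdet : ∀ z ∈ Hset, p z * r z - q z ^ 2 = 1)
    (hM : ∀ z ∈ Hset, p z + r z ≤ M) (hK : ∀ z ∈ Hset, P z ≤ K)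
    (hL : ∀ z ∈ Hset, κ * (P z - c) ≤ Lop p q r P z) : ∀ z ∈ Hset, P z ≤ c := by
  intro z₁ hz₁
  have hpos : ∀ u ∈ Hset, 0 < exh u := fun u hu => lt_of_lt_of_le one_pos (exh_ge hu)
  have ha0 : ∀ u ∈ Hset, 0 ≤ Real.log (exh u) := fun u hu => Real.log_nonneg (exh_ge hu)
  have hC : C2 (fun u => Real.log (exh u)) :=
    ContDiffOn.log C2_exh (fun u hu => (hpos u hu).ne')
  have main : ∀ δ > 0, κ * (P z₁ - δ * Real.log (exh z₁) - c) ≤ δ * M := by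
    intro δ hδ
    set N := Real.exp (Real.log (exh z₁) + (K - P z₁) / δ + 1) with hN
    have hNpos : 0 < N := Real.exp_pos _
    have hKP : 0 ≤ (K - P z₁) / δ := div_nonneg (by linarith [hK z₁ hz₁]) hδ.le
    have hz₁N : exh z₁ ≤ N := by
      rw [← Real.log_le_log_iff (hpos _ hz₁) hNpos, hN, Real.log_exp]; linarith
    have hcont : ContinuousOn (fun u => P u - δ * Real.log (exh u))
        {z : ℂ | z ∈ Hset ∧ exh z ≤ N} :=
      (ContinuousOn.sub (ContDiffOn.continuousOn hP)
        (continuousOn_const.mul (ContDiffOn.continuousOn hC))).mono (fun u hu => hu.1)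
    obtain ⟨z₀, hz₀, hmax⟩ := (isCompact_exh_le hNpos).exists_isMaxOn ⟨z₁, hz₁, hz₁N⟩ hcont
    have hge := hmax (show z₁ ∈ {z : ℂ | z ∈ Hset ∧ exh z ≤ N} from ⟨hz₁, hz₁N⟩)
    simp only [mem_ofPred_eq] at hge
    have hall : ∀ u ∈ Hset, P u - δ * Real.log (exh u) ≤ P z₀ - δ * Real.log (exh z₀) := by
      intro u hu
      by_cases hun : exh u ≤ N
      · exact hmax (show u ∈ {z : ℂ | z ∈ Hset ∧ exh z ≤ N} from ⟨hu, hun⟩)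
      · push Not at hun
        have h1 : Real.log N < Real.log (exh u) := Real.log_lt_log hNpos hun
        rw [hN, Real.log_exp] at h1
        have h2 := mul_lt_mul_of_pos_left h1 hδ
        have h3 : δ * ((K - P z₁) / δ) = K - P z₁ := by field_simp
        have h4 := hK u hu
        nlinarith
    have hloc : IsLocalMax (fun u => P u - δ * Real.log (exh u)) z₀ := by
      filter_upwards [Hset_mem_nhds hz₀.1] with u hu using hall u hu
    have hδC : C2 (fun u => δ * Real.log (exh u)) := (C2.const δ).mul hC
    have h5 := Lop_nonpos_of_isLocalMax (q := q) (r := r) (hP.sub hδC) hz₀.1 (hp _ hz₀.1)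
      (hdet _ hz₀.1) hloc
    rw [Lop_sub hP hδC hz₀.1, Lop_const_mul δ hC hz₀.1] at h5
    have h6 := Lop_log_exh_le (q := q) (r := r) hz₀.1 (hp _ hz₀.1) (hdet _ hz₀.1)
    have h7 := hL z₀ hz₀.1
    have h8 := hM z₀ hz₀.1
    have h9 := ha0 z₀ hz₀.1
    have h10 : δ * Lop p q r (fun u => Real.log (exh u)) z₀ ≤ δ * M :=
      mul_le_mul_of_nonneg_left (h6.trans h8) hδ.le
    have h11 : P z₁ - δ * Real.log (exh z₁) - c ≤ P z₀ - c := by nlinarith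
    nlinarith [mul_le_mul_of_nonneg_left h11 hκ.le]
  have hlim : Tendsto (fun δ : ℝ => κ * (P z₁ - δ * Real.log (exh z₁) - c)) (𝓝[>] 0)
      (𝓝 (κ * (P z₁ - 0 * Real.log (exh z₁) - c))) := by
    apply Tendsto.mono_left _ nhdsWithin_le_nhds
    apply Continuous.tendsto; fun_prop
  have hlim2 : Tendsto (fun δ : ℝ => δ * M) (𝓝[>] 0) (𝓝 (0 * M)) := by
    apply Tendsto.mono_left _ nhdsWithin_le_nhds
    apply Continuous.tendsto; fun_prop
  have := le_of_tendsto_of_tendsto hlim hlim2 (by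
    filter_upwards [self_mem_nhdsWithin] with δ hδ using main δ hδ)
  rw [zero_mul, zero_mul, sub_zero] at this
  by_contra hneg
  push Not at hneg
  nlinarith [mul_pos hκ (sub_pos.2 hneg)]

/-! ### Codazzi fields -/

/-- A positive self-adjoint Codazzi field of determinant one on the half-plane, given by
its matrix `[[p, q], [q, r]]`. -/
structure CodazziField (p q r : ℂ → ℝ) : Prop where
  c2p : C2 p
  c2q : C2 q
  c2r : C2 r
  pos : ∀ z ∈ Hset, 0 < p z
  det : ∀ z ∈ Hset, p z * r z - q z ^ 2 = 1
  cod₁ : ∀ z ∈ Hset, z.im * (D 1 q z - D Complex.I p z) = r z - p z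
  cod₂ : ∀ z ∈ Hset, z.im * (D 1 r z - D Complex.I q z) = -2 * q z

namespace CodazziField
variable {p q r : ℂ → ℝ} (h : CodazziField p q r) {z : ℂ}
include h

theorem pos' (hz : z ∈ Hset) : 0 < r z := by
  have h1 := h.pos z hz
  have h2 := h.det z hz
  by_contra h3
  push Not at h3
  nlinarith [mul_nonneg h1.le (neg_nonneg.2 h3), sq_nonneg (q z)]

theorem trace_ge (hz : z ∈ Hset) : 2 ≤ p z + r z := by
  have h1 := h.pos z hz
  have h2 := h.det z hz
  have h3 := h.pos' hz
  nlinarith [sq_nonneg (p z - r z), sq_nonneg (q z)]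

theorem D_det (v : ℂ) (hz : z ∈ Hset) :
    p z * D v r z + r z * D v p z - 2 * q z * D v q z = 0 := by
  have h1 : EqOn (fun u => p u * r u - q u * q u) (fun _ => 1) Hset := by
    intro u hu; have := h.det u hu; simp only []; linarith
  have h2 := D_congr h1 v hz
  rw [D_sub v (h.c2p.c1.mul h.c2r.c1) (h.c2q.c1.mul h.c2q.c1) hz,
    D_mul v h.c2p.c1 h.c2r.c1 hz, D_mul v h.c2q.c1 h.c2q.c1 hz, D_const] at h2
  linarith

theorem DD_det (v : ℂ) (hz : z ∈ Hset) :
    p z * D v (D v r) z + 2 * D v p z * D v r z + r z * D v (D v p) z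
      - 2 * q z * D v (D v q) z - 2 * D v q z ^ 2 = 0 := by
  have h1 : EqOn (fun u => p u * r u - q u * q u) (fun _ => 1) Hset := by
    intro u hu; have := h.det u hu; simp only []; linarith
  have h1' : EqOn (D v (fun u => p u * r u - q u * q u)) (D v (fun _ => 1)) Hset :=
    fun u hu => D_congr h1 v hu
  have h2 := D_congr h1' v hz
  rw [DD_sub v v (h.c2p.mul h.c2r) (h.c2q.mul h.c2q) hz,
    DD_mul v v h.c2p h.c2r hz, DD_mul v v h.c2q h.c2q hz, DD_const] at h2
  linarith

theorem D_cod₁ (v : ℂ) (hz : z ∈ Hset) :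
    z.im * (D v (D 1 q) z - D v (D Complex.I p) z) + (D 1 q z - D Complex.I p z) * v.im
      = D v r z - D v p z := by
  have h1 : EqOn (fun u => u.im * (D 1 q u - D Complex.I p u)) (fun u => r u - p u) Hset :=
    fun u hu => h.cod₁ u hu
  have h2 := D_congr h1 v hz
  rw [D_mul v C2.im.c1 ((h.c2q.D 1).sub (h.c2p.D Complex.I)) hz,
    D_sub v (h.c2q.D 1) (h.c2p.D Complex.I) hz, D_sub v h.c2r.c1 h.c2p.c1 hz, D_im] at h2
  exact h2

theorem D_cod₂ (v : ℂ) (hz : z ∈ Hset) :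
    z.im * (D v (D 1 r) z - D v (D Complex.I q) z) + (D 1 r z - D Complex.I q z) * v.im
      = -2 * D v q z := by
  have h1 : EqOn (fun u => u.im * (D 1 r u - D Complex.I q u)) (fun u => -2 * q u) Hset :=
    fun u hu => h.cod₂ u hu
  have h2 := D_congr h1 v hz
  rw [D_mul v C2.im.c1 ((h.c2r.D 1).sub (h.c2q.D Complex.I)) hz,
    D_sub v (h.c2r.D 1) (h.c2q.D Complex.I) hz, D_const_mul v _ h.c2q.c1 hz, D_im] at h2
  exact h2

theorem Lop_trace (hz : z ∈ Hset) :
    ((p z + r z) ^ 2 - 4) * Lop p q r (fun u => p u + r u) z =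
      - ((p z + r z) ^ 2 - 4) ^ 2
      + 2 * (p z + r z) * Bf p q r (fun u => p u + r u) (fun u => p u + r u) z := by
  have hy : 0 < z.im := hz
  have a1 := h.D_cod₁ 1 hz
  have a2 := h.D_cod₁ Complex.I hz
  have a3 := h.D_cod₂ 1 hz
  have a4 := h.D_cod₂ Complex.I hz
  have b1 := h.DD_det 1 hz
  have b2 := h.DD_det Complex.I hz
  have c1 := h.D_det 1 hz
  have c2 := h.D_det Complex.I hz
  have d1 := h.cod₁ z hz
  have d2 := h.cod₂ z hz
  have d0 := h.det z hz
  have hp := h.pos z hz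
  have hr := h.pos' hz
  rw [DD_comm Complex.I 1 h.c2q hz] at a2
  rw [DD_comm Complex.I 1 h.c2r hz] at a4
  unfold Lop Bf
  rw [D_add _ h.c2p.c1 h.c2r.c1 hz, D_add _ h.c2p.c1 h.c2r.c1 hz, DD_add _ _ h.c2p h.c2r hz,
    DD_add _ _ h.c2p h.c2r hz, DD_add _ _ h.c2p h.c2r hz]
  simp only [Complex.one_im, Complex.I_im, mul_zero, add_zero, mul_one] at a1 a2 a3 a4
  generalize D 1 (D 1 p) z = pxx at *
  generalize D 1 (D 1 q) z = qxx at *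
  generalize D 1 (D 1 r) z = rxx at *
  generalize D 1 (D Complex.I p) z = pxy at *
  generalize D 1 (D Complex.I q) z = qxy at *
  generalize D 1 (D Complex.I r) z = rxy at *
  generalize D Complex.I (D Complex.I p) z = pyy at *
  generalize D Complex.I (D Complex.I q) z = qyy at *
  generalize D Complex.I (D Complex.I r) z = ryy at *
  generalize D 1 p z = px at *
  generalize D 1 q z = qx at *
  generalize D 1 r z = rx at *
  generalize D Complex.I p z = py at *
  generalize D Complex.I q z = qy at *
  generalize D Complex.I r z = ry at *
  generalize p z = p at *
  generalize q z = q at *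
  generalize r z = r at *
  generalize z.im = y at *
  have key : y ^ 2 * (r * (pxx + rxx) - 2 * q * (pxy + rxy) + p * (pyy + ryy)) =
      y ^ 2 * (- 2 * px * rx + 2 * qx ^ 2 - 2 * py * ry + 2 * qy ^ 2)
      + y * ((r - p) * (-2 * qx + (ry - py) - (qx - py)) + 2 * q * (rx - px)
        - 2 * q * (-2 * qy - (rx - qy))) := by
    linear_combination y ^ 2 * b1 + y ^ 2 * b2 + y * (r - p) * (a3 + a2) + 2 * y * q * a1
      - 2 * q * y * a4
  have hpy : py = qx + (p - r) / y := by field_simp; linarith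
  have hrx : rx = qy - 2 * q / y := by field_simp; linarith
  have hpx : px = (2 * q * qx - p * rx) / r := by field_simp; linarith
  have hry : ry = (2 * q * qy - r * py) / p := by field_simp; linarith
  have hr' : r = (1 + q ^ 2) / p := by field_simp; linarith
  rw [key]
  have hq : (1 + q ^ 2) ≠ 0 := by positivity
  subst hpx hry
  subst hpy hrx
  subst hr'
  field_simp
  ring

end CodazziField

/-- The square of the positive principal curvature, `(τ - 2) / (τ + 2)`. -/
def curvSq (p r : ℂ → ℝ) (z : ℂ) : ℝ := (p z + r z - 2) / (p z + r z + 2)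

namespace CodazziField
variable {p q r : ℂ → ℝ} (h : CodazziField p q r) {z : ℂ}
include h

theorem c2_trace : C2 (fun u => p u + r u) := h.c2p.add h.c2r

theorem c2_curvSq : C2 (curvSq p r) := by
  apply C2.div
  · exact h.c2_trace.sub (C2.const 2)
  · exact h.c2_trace.add (C2.const 2)
  · intro z hz; have := h.trace_ge hz; positivity

theorem curvSq_nonneg (hz : z ∈ Hset) : 0 ≤ curvSq p r z := by
  have := h.trace_ge hz
  exact div_nonneg (by linarith) (by linarith)

theorem neg_four_mul_le_Lop_curvSq (hz : z ∈ Hset) :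
    -4 * curvSq p r z ≤ Lop p q r (curvSq p r) z := by
  have hF := h.c2_curvSq
  have ht := h.c2_trace
  rcases eq_or_lt_of_le (h.trace_ge hz) with heq | hlt
  · have h0 : curvSq p r z = 0 := by simp [curvSq, ← heq]
    have hmax : IsLocalMax (fun u => (-1) * curvSq p r u) z := by
      filter_upwards [Hset_mem_nhds hz] with u hu
      rw [h0]; linarith [h.curvSq_nonneg hu]
    have h1 := Lop_nonpos_of_isLocalMax (q := q) (r := r) ((C2.const (-1)).mul hF) hz
      (h.pos z hz) (h.det z hz) hmax
    rw [Lop_const_mul _ hF hz] at h1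
    rw [h0]; linarith
  · have hEq : EqOn (fun u => (p u + r u + 2) * curvSq p r u) (fun u => p u + r u - 2) Hset := by
      intro u hu
      have := h.trace_ge hu
      have h2 : p u + r u + 2 ≠ 0 := by positivity
      simp only [curvSq]; field_simp
    have ht2 := ht.add (C2.const 2)
    have h1 := Lop_congr (p := p) (q := q) (r := r) hEq hz
    rw [Lop_mul ht2 hF hz, Lop_add ht (C2.const 2) hz, Lop_sub ht (C2.const 2) hz, Lop_const,
      Bf_add_left ht.c1 (C2.const 2).c1 hz, Bf_const_left] at h1
    have h2 := Bf_congr_left (p := p) (q := q) (r := r) (h := fun u => p u + r u) hEq hz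
    rw [Bf_mul_left ht2.c1 hF.c1 hz, Bf_sub_left ht.c1 (C2.const 2).c1 hz,
      Bf_add_left ht.c1 (C2.const 2).c1 hz, Bf_const_left,
      Bf_comm (curvSq p r)] at h2
    have h3 := h.Lop_trace hz
    have h4 := hEq hz
    have hB := Bf_self_nonneg (f := fun u => p u + r u) (h.pos z hz) (h.det z hz)
    simp only [] at h4
    generalize Bf p q r (fun u => p u + r u) (fun u => p u + r u) z = B at *
    generalize Bf p q r (fun u => p u + r u) (curvSq p r) z = BF at *
    generalize Lop p q r (curvSq p r) z = LF at *
    generalize Lop p q r (fun u => p u + r u) z = Lt at *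
    generalize curvSq p r z = F at *
    generalize p z + r z = t at *
    have t2 : 0 < t - 2 := by linarith
    have t3 : 0 < t + 2 := by linarith
    have hF' : F = (t - 2) / (t + 2) := by field_simp; linarith
    have hLt : Lt = -(t ^ 2 - 4) + 2 * t * B / (t ^ 2 - 4) := by
      have : t ^ 2 - 4 ≠ 0 := by nlinarith
      field_simp; linarith
    have hBF : BF = 4 * B / (t + 2) ^ 2 := by
      subst hF'
      field_simp at h2 ⊢
      linarith
    have hLF : LF = -4 * F + 16 * B / ((t + 2) ^ 3 * (t - 2)) := by
      have e : t ^ 2 - 4 = (t - 2) * (t + 2) := by ring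
      have : LF = (Lt - F * Lt - 2 * BF) / (t + 2) := by field_simp; linarith
      rw [this, hLt, hBF, hF', e]
      field_simp
      ring
    rw [hLF]
    have : 0 ≤ 16 * B / ((t + 2) ^ 3 * (t - 2)) := by positivity
    linarith
end CodazziField

/-! ### Harmonicity of minimal Lagrangian maps -/

/-- A map `X + iY` of the half-plane into itself which pulls back the hyperbolic metric to
`g(b·, b·)`, where `b` is the Codazzi field `[[p, q], [q, r]]`. -/
structure MinLagData (p q r X Y : ℂ → ℝ) : Prop extends CodazziField p q r where
  c2X : C2 X
  c2Y : C2 Y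
  Ypos : ∀ z ∈ Hset, 0 < Y z
  met₁₁ : ∀ z ∈ Hset, z.im * z.im * (D 1 X z * D 1 X z + D 1 Y z * D 1 Y z)
    = Y z * Y z * (p z * p z + q z * q z)
  met₁₂ : ∀ z ∈ Hset, z.im * z.im * (D 1 X z * D Complex.I X z + D 1 Y z * D Complex.I Y z)
    = Y z * Y z * (q z * (p z + r z))
  met₂₂ : ∀ z ∈ Hset, z.im * z.im *
      (D Complex.I X z * D Complex.I X z + D Complex.I Y z * D Complex.I Y z)
    = Y z * Y z * (q z * q z + r z * r z)

/-- Differentiating a metric identity. -/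
theorem D_metric {a b c d Y s : ℂ → ℝ} (ha : C1 a) (hb : C1 b) (hc : C1 c) (hd : C1 d)
    (hY : C1 Y) (hs : C1 s)
    (h : ∀ z ∈ Hset, z.im * z.im * (a z * b z + c z * d z) = Y z * Y z * s z) (v : ℂ) {z : ℂ}
    (hz : z ∈ Hset) :
    2 * z.im * v.im * (a z * b z + c z * d z) + z.im ^ 2 * (a z * D v b z + b z * D v a z
      + c z * D v d z + d z * D v c z) = 2 * Y z * D v Y z * s z + Y z ^ 2 * D v s z := by
  have h1 : EqOn (fun z : ℂ => z.im * z.im * (a z * b z + c z * d z))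
    (fun z => Y z * Y z * s z) Hset := h
  have h2 := D_congr h1 v hz
  have i1 : C1 Complex.im := C2.im.c1
  rw [D_mul v (i1.mul i1) ((ha.mul hb).add (hc.mul hd)) hz, D_mul v i1 i1 hz,
    D_add v (ha.mul hb) (hc.mul hd) hz, D_mul v ha hb hz, D_mul v hc hd hz,
    D_mul v (hY.mul hY) hs hz, D_mul v hY hY hz, D_im] at h2
  linear_combination h2

namespace MinLagData
variable {p q r X Y : ℂ → ℝ} (h : MinLagData p q r X Y) {z : ℂ}
include h

theorem harmonic (hz : z ∈ Hset) :
    Y z * Lop p q r X z = 2 * Bf p q r X Y z ∧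
    Y z * Lop p q r Y z = Bf p q r Y Y z - Bf p q r X X z := by
  have hy : 0 < z.im := hz
  have hY : 0 < Y z := h.Ypos z hz
  have s11 : C1 (fun z => p z * p z + q z * q z) :=
    (h.c2p.c1.mul h.c2p.c1).add (h.c2q.c1.mul h.c2q.c1)
  have s12 : C1 (fun z => q z * (p z + r z)) := h.c2q.c1.mul (h.c2p.c1.add h.c2r.c1)
  have s22 : C1 (fun z => q z * q z + r z * r z) :=
    (h.c2q.c1.mul h.c2q.c1).add (h.c2r.c1.mul h.c2r.c1)
  have X1 := h.c2X.D 1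
  have X2 := h.c2X.D Complex.I
  have Y1 := h.c2Y.D 1
  have Y2 := h.c2Y.D Complex.I
  have d11 := fun v => D_metric X1 X1 Y1 Y1 h.c2Y.c1 s11 h.met₁₁ v hz
  have d12 := fun v => D_metric X1 X2 Y1 Y2 h.c2Y.c1 s12 h.met₁₂ v hz
  have d22 := fun v => D_metric X2 X2 Y2 Y2 h.c2Y.c1 s22 h.met₂₂ v hz
  have ds11 : ∀ v, D v (fun z => p z * p z + q z * q z) z = 2 * p z * D v p z + 2 * q z * D v q z := by
    intro v
    rw [D_add v (h.c2p.c1.mul h.c2p.c1) (h.c2q.c1.mul h.c2q.c1) hz, D_mul v h.c2p.c1 h.c2p.c1 hz,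
      D_mul v h.c2q.c1 h.c2q.c1 hz]; ring
  have ds22 : ∀ v, D v (fun z => q z * q z + r z * r z) z = 2 * q z * D v q z + 2 * r z * D v r z := by
    intro v
    rw [D_add v (h.c2q.c1.mul h.c2q.c1) (h.c2r.c1.mul h.c2r.c1) hz, D_mul v h.c2r.c1 h.c2r.c1 hz,
      D_mul v h.c2q.c1 h.c2q.c1 hz]; ring
  have ds12 : ∀ v, D v (fun z => q z * (p z + r z)) z
      = q z * (D v p z + D v r z) + (p z + r z) * D v q z := by
    intro v
    rw [D_mul v h.c2q.c1 (h.c2p.c1.add h.c2r.c1) hz, D_add v h.c2p.c1 h.c2r.c1 hz]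
  have e11x := d11 1
  have e11y := d11 Complex.I
  have e12x := d12 1
  have e12y := d12 Complex.I
  have e22x := d22 1
  have e22y := d22 Complex.I
  rw [ds11] at e11x e11y
  rw [ds12] at e12x e12y
  rw [ds22] at e22x e22y
  clear ds11 ds12 ds22 d11 d12 d22
  rw [DD_comm Complex.I 1 h.c2X hz, DD_comm Complex.I 1 h.c2Y hz] at e11y e12y
  simp only [Complex.one_im, Complex.I_im] at e11x e11y e12x e12y e22x e22y
  have m11 := h.met₁₁ z hz
  have m12 := h.met₁₂ z hz
  have m22 := h.met₂₂ z hz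
  have c1 := h.D_det 1 hz
  have c2 := h.D_det Complex.I hz
  have d1 := h.cod₁ z hz
  have d2 := h.cod₂ z hz
  have d0 := h.det z hz
  have hp := h.pos z hz
  have hr := h.toCodazziField.pos' hz
  unfold Lop Bf
  generalize D 1 (D 1 X) z = Xxx at *
  generalize D 1 (D Complex.I X) z = Xxy at *
  generalize D Complex.I (D Complex.I X) z = Xyy at *
  generalize D 1 (D 1 Y) z = Yxx at *
  generalize D 1 (D Complex.I Y) z = Yxy at *
  generalize D Complex.I (D Complex.I Y) z = Yyy at *
  generalize D 1 X z = Xx at *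
  generalize D Complex.I X z = Xy at *
  generalize D 1 Y z = Yx at *
  generalize D Complex.I Y z = Yy at *
  generalize D 1 p z = px at *
  generalize D 1 q z = qx at *
  generalize D 1 r z = rx at *
  generalize D Complex.I p z = py at *
  generalize D Complex.I q z = qy at *
  generalize D Complex.I r z = ry at *
  generalize p z = p at *
  generalize q z = q at *
  generalize r z = r at *
  generalize Y z = Y at *
  generalize z.im = y at *
  have hpy : py = qx + (p - r) / y := by field_simp; linarith
  have hrx : rx = qy - 2 * q / y := by field_simp; linarith
  have hpx : px = (2 * q * qx - p * rx) / r := by field_simp; linarith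
  have hry : ry = (2 * q * qy - r * py) / p := by field_simp; linarith
  have hr' : r = (1 + q ^ 2) / p := by field_simp; linarith
  have hq : (1 + q ^ 2) ≠ 0 := by positivity
  have sc1 : y * (r * (p * px + q * qx) - 2 * q * (p * py + q * qy)
      + p * (qy * (p + r) + q * (py + ry)) - p * (q * qx + r * rx)) - (p + r) ^ 2 * q = 0 := by
    subst hpx hry
    subst hpy hrx
    subst hr'
    field_simp
    ring
  have sc2 : y * (r * (qx * (p + r) + q * (px + rx) - (p * py + q * qy))
      - 2 * q * (q * qx + r * rx) + p * (q * qy + r * ry))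
      + (p + r) * (r * p - r ^ 2 - 2 * q ^ 2) = 0 := by
    subst hpx hry
    subst hpy hrx
    subst hr'
    field_simp
    ring
  clear hpy hrx hpx hry hr' c1 c2 d1 d2
  set T1 : ℝ := Y * (y ^ 2 * (r * Xxx - 2 * q * Xxy + p * Xyy)
    + y * (-(2 * q) * Xx + (p - r) * Xy))
    - 2 * (y ^ 2 * (r * (Xx * Yx) - q * (Xx * Yy + Xy * Yx) + p * (Xy * Yy))) with hT1
  set T2 : ℝ := Y * (y ^ 2 * (r * Yxx - 2 * q * Yxy + p * Yyy)
    + y * (-(2 * q) * Yx + (p - r) * Yy))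
    - (y ^ 2 * (r * (Yx * Yx) - q * (Yx * Yy + Yy * Yx) + p * (Yy * Yy))
      - y ^ 2 * (r * (Xx * Xx) - q * (Xx * Xy + Xy * Xx) + p * (Xy * Xy))) with hT2
  have o1 : y * (T1 * Xx + T2 * Yx) = 0 := by
    rw [hT1, hT2]
    linear_combination y * Y * (r / 2 * e11x - q * e11y + p * (e12y - e22x / 2))
      + Y ^ 3 * sc1 + y * (-(r * Yx - 2 * q * Yy)) * m11
      + (y * (-2 * p * Yy) - Y * (p + r)) * m12 + y * p * Yx * m22
  have o2 : y * (T1 * Xy + T2 * Yy) = 0 := by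
    rw [hT1, hT2]
    linear_combination y * Y * (r * (e12x - e11y / 2) - q * e22x + p / 2 * e22y)
      + Y ^ 3 * sc2 + (y * r * Yy + Y * r) * m11
      + (y * (-2 * r * Yx) - 2 * Y * q) * m12 + (y * (2 * q * Yx - p * Yy) - Y * r) * m22
  have o1' := (mul_eq_zero.1 o1).resolve_left hy.ne'
  have o2' := (mul_eq_zero.1 o2).resolve_left hy.ne'
  have hJ : y ^ 4 * (Xx * Yy - Xy * Yx) ^ 2 = Y ^ 4 := by
    have e1 : y ^ 4 * (Xx * Yy - Xy * Yx) ^ 2 = (Y * Y * (p * p + q * q)) * (Y * Y * (q * q + r * r))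
        - (Y * Y * (q * (p + r))) ^ 2 := by
      rw [← m11, ← m12, ← m22]; ring
    have e2 : (p * p + q * q) * (q * q + r * r) - (q * (p + r)) ^ 2 = 1 := by
      have : (p * p + q * q) * (q * q + r * r) - (q * (p + r)) ^ 2 = (p * r - q ^ 2) ^ 2 := by ring
      rw [this, d0]; norm_num
    rw [e1]; linear_combination Y ^ 4 * e2
  have hJ0 : Xx * Yy - Xy * Yx ≠ 0 := by
    intro h0; rw [h0] at hJ
    have : 0 < Y ^ 4 := by positivity
    simp at hJ; linarith
  have t1 : T1 = 0 := by
    have : T1 * (Xx * Yy - Xy * Yx) = 0 := by linear_combination Yy * o1' - Yx * o2'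
    exact (mul_eq_zero.1 this).resolve_right hJ0
  have t2 : T2 = 0 := by
    have : T2 * (Xx * Yy - Xy * Yx) = 0 := by linear_combination Xx * o2' - Xy * o1'
    exact (mul_eq_zero.1 this).resolve_right hJ0
  constructor
  · linarith
  · linarith

end MinLagData

/-! ### The hyperbolic distance between two maps -/

/-- The hyperbolic cosine of the distance between `X + iY` and `U + iV`. -/
def coshDist (X Y U V : ℂ → ℝ) (z : ℂ) : ℝ :=
  ((X z - U z) * (X z - U z) + Y z * Y z + V z * V z) / (2 * (Y z * V z))

theorem coshDist_ge_one {X Y U V : ℂ → ℝ} {z : ℂ} (hY : 0 < Y z) (hV : 0 < V z) :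
    1 ≤ coshDist X Y U V z := by
  unfold coshDist
  rw [le_div_iff₀ (by positivity)]
  nlinarith [sq_nonneg (X z - U z), sq_nonneg (Y z - V z)]

theorem C2_coshDist {X Y U V : ℂ → ℝ} (hX : C2 X) (hY : C2 Y) (hU : C2 U) (hV : C2 V)
    (pY : ∀ z ∈ Hset, 0 < Y z) (pV : ∀ z ∈ Hset, 0 < V z) : C2 (coshDist X Y U V) := by
  apply C2.div
  · exact (((hX.sub hU).mul (hX.sub hU)).add (hY.mul hY)).add (hV.mul hV)
  · exact (C2.const 2).mul (hY.mul hV)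
  · intro z hz; have := pY z hz; have := pV z hz; positivity

theorem Lop_coshDist {p q r X Y U V : ℂ → ℝ} (hX : C2 X) (hY : C2 Y) (hU : C2 U) (hV : C2 V)
    (pY : ∀ z ∈ Hset, 0 < Y z) (pV : ∀ z ∈ Hset, 0 < V z) {z : ℂ} (hz : z ∈ Hset)
    (eX : Y z * Lop p q r X z = 2 * Bf p q r X Y z)
    (eY : Y z * Lop p q r Y z = Bf p q r Y Y z - Bf p q r X X z) :
    Lop p q r (coshDist X Y U V) z =
      coshDist X Y U V z * (Bf p q r X X z + Bf p q r Y Y z) / Y z ^ 2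
      + coshDist X Y U V z * (Bf p q r U U z + Bf p q r V V z) / V z ^ 2
      + 2 / (Y z * V z) * (-Bf p q r X U z - (X z - U z) / V z * Bf p q r X V z
        + (X z - U z) / Y z * Bf p q r Y U z
        + ((X z - U z) ^ 2 - Y z ^ 2 - V z ^ 2) / (2 * Y z * V z) * Bf p q r Y V z)
      - (X z - U z) / Y z * ((Lop p q r U z - 2 * Bf p q r U V z / V z) / V z)
      + (V z ^ 2 - Y z ^ 2 - (X z - U z) ^ 2) / (2 * Y z * V z)
        * ((Lop p q r V z - (Bf p q r V V z - Bf p q r U U z) / V z) / V z) := by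
  have hY0 := pY z hz
  have hV0 := pV z hz
  have hQ := C2_coshDist hX hY hU hV pY pV
  have hEq : EqOn (fun u => (2 * (Y u * V u)) * coshDist X Y U V u)
      (fun u => (X u - U u) * (X u - U u) + Y u * Y u + V u * V u) Hset := by
    intro u hu
    have h1 := pY u hu
    have h2 := pV u hu
    simp only [coshDist]; field_simp
  have hζ := hX.sub hU
  have hζζ := hζ.mul hζ
  have hYY := hY.mul hY
  have hVV := hV.mul hV
  have hYV := hY.mul hV
  have h2YV := (C2.const 2).mul hYV
  have l1 := Lop_congr (p := p) (q := q) (r := r) hEq hz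
  rw [Lop_mul h2YV hQ hz, Lop_const_mul 2 hYV hz, Lop_mul hY hV hz,
    Lop_add (hζζ.add hYY) hVV hz, Lop_add hζζ hYY hz, Lop_mul hζ hζ hz, Lop_mul hY hY hz,
    Lop_mul hV hV hz, Lop_sub hX hU hz, Bf_mul_left (C2.const 2).c1 hYV.c1 hz, Bf_const_left,
    Bf_mul_left hY.c1 hV.c1 hz, Bf_sub_left hX.c1 hU.c1 hz,
    Bf_comm X, Bf_comm U (fun z => X z - U z), Bf_sub_left hX.c1 hU.c1 hz,
    Bf_sub_left hX.c1 hU.c1 hz, Bf_comm U X] at l1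
  have b : ∀ h : ℂ → ℝ, 2 * (Y z * V z) * Bf p q r (coshDist X Y U V) h z
      + coshDist X Y U V z * (2 * (Y z * Bf p q r V h z + V z * Bf p q r Y h z))
      = 2 * (X z - U z) * (Bf p q r X h z - Bf p q r U h z) + 2 * Y z * Bf p q r Y h z
        + 2 * V z * Bf p q r V h z := by
    intro h
    have b1 := Bf_congr_left (p := p) (q := q) (r := r) (h := h) hEq hz
    rw [Bf_mul_left h2YV.c1 hQ.c1 hz, Bf_mul_left (C2.const 2).c1 hYV.c1 hz, Bf_const_left,
      Bf_mul_left hY.c1 hV.c1 hz, Bf_add_left (hζζ.add hYY).c1 hVV.c1 hz,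
      Bf_add_left hζζ.c1 hYY.c1 hz, Bf_mul_left hζ.c1 hζ.c1 hz, Bf_mul_left hY.c1 hY.c1 hz,
      Bf_mul_left hV.c1 hV.c1 hz, Bf_sub_left hX.c1 hU.c1 hz] at b1
    linear_combination b1
  have bY := b Y
  have bV := b V
  rw [Bf_comm (coshDist X Y U V), Bf_comm V Y, Bf_comm U Y] at bY
  rw [Bf_comm (coshDist X Y U V)] at bV
  have hq := hEq hz
  simp only [] at hq
  generalize Lop p q r (coshDist X Y U V) z = LQ at *
  generalize Lop p q r X z = LX at *
  generalize Lop p q r Y z = LY at *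
  generalize Lop p q r U z = LU at *
  generalize Lop p q r V z = LV at *
  generalize Bf p q r Y (coshDist X Y U V) z = BYQ at *
  generalize Bf p q r V (coshDist X Y U V) z = BVQ at *
  generalize coshDist X Y U V z = Q at *
  generalize Bf p q r X X z = Bxx at *
  generalize Bf p q r X Y z = Bxy at *
  generalize Bf p q r Y Y z = Byy at *
  generalize Bf p q r U U z = Buu at *
  generalize Bf p q r U V z = Buv at *
  generalize Bf p q r V V z = Bvv at *
  generalize Bf p q r X U z = Bxu at *
  generalize Bf p q r X V z = Bxv at *
  generalize Bf p q r Y U z = Byu at *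
  generalize Bf p q r Y V z = Byv at *
  generalize X z = X at *
  generalize Y z = Y at *
  generalize U z = U at *
  generalize V z = V at *
  have hLX : LX = 2 * Bxy / Y := by field_simp; linarith
  have hLY : LY = (Byy - Bxx) / Y := by field_simp; linarith
  have hQv : Q = ((X - U) * (X - U) + Y * Y + V * V) / (2 * (Y * V)) := by field_simp; linarith
  have hBY : BYQ = (2 * (X - U) * (Bxy - Byu) + 2 * Y * Byy + 2 * V * Byv
    - Q * (2 * (Y * Byv + V * Byy))) / (2 * (Y * V)) := by
    field_simp; linarith
  have hBV : BVQ = (2 * (X - U) * (Bxv - Buv) + 2 * Y * Byv + 2 * V * Bvv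
    - Q * (2 * (Y * Bvv + V * Byv))) / (2 * (Y * V)) := by
    field_simp; linarith
  have hLQ : LQ = (((X - U) * (LX - LU) + (X - U) * (LX - LU)
      + 2 * (Bxx - Bxu - (Bxu - Buu)) + (Y * LY + Y * LY + 2 * Byy) + (V * LV + V * LV + 2 * Bvv))
      - Q * (2 * (Y * LV + V * LY + 2 * Byv)) - 4 * (Y * BVQ + V * BYQ)) / (2 * (Y * V)) := by
    field_simp; linarith
  rw [hLQ, hBY, hBV, hLX, hLY, hQv]
  field_simp
  ring

/-- Positivity of the pointwise quadratic form in the Hessian of the distance function. -/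
theorem dist_form_nonneg {Y V ζ : ℝ} (hY : 0 < Y) (hV : 0 < V) (a b u v : ℝ) :
    0 ≤ (ζ ^ 2 + Y ^ 2 + V ^ 2) / (2 * Y * V) * (a ^ 2 + b ^ 2 + u ^ 2 + v ^ 2)
      + 2 * (-(a * u) - ζ / V * (a * v) + ζ / Y * (b * u)
        + (ζ ^ 2 - Y ^ 2 - V ^ 2) / (2 * Y * V) * (b * v)) := by
  set Q := (ζ ^ 2 + Y ^ 2 + V ^ 2) / (2 * Y * V) with hQ
  set Dd := (ζ ^ 2 - Y ^ 2 - V ^ 2) / (2 * Y * V) with hD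
  have hQ1 : 0 < Q := by positivity
  have key : Q ^ 2 * (u ^ 2 + v ^ 2) = (u + ζ / V * v) ^ 2 + (ζ / Y * u + Dd * v) ^ 2
      + ((V ^ 2 - Y ^ 2 - ζ ^ 2) / (2 * Y * V) * u + ζ / Y * v) ^ 2 := by
    rw [hQ, hD]; field_simp; ring
  have : 0 ≤ Q * (Q * (a ^ 2 + b ^ 2 + u ^ 2 + v ^ 2)
      + 2 * (-(a * u) - ζ / V * (a * v) + ζ / Y * (b * u) + Dd * (b * v))) := by
    have e : Q * (Q * (a ^ 2 + b ^ 2 + u ^ 2 + v ^ 2)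
      + 2 * (-(a * u) - ζ / V * (a * v) + ζ / Y * (b * u) + Dd * (b * v))) =
      (Q * a - (u + ζ / V * v)) ^ 2 + (Q * b + (ζ / Y * u + Dd * v)) ^ 2
      + ((V ^ 2 - Y ^ 2 - ζ ^ 2) / (2 * Y * V) * u + ζ / Y * v) ^ 2 := by
      linear_combination key
    rw [e]; positivity
  exact nonneg_of_mul_nonneg_right this hQ1

theorem dist_form_half_le {Y V ζ : ℝ} (hY : 0 < Y) (hV : 0 < V) (a b u v u' v' : ℝ) :
    ((ζ ^ 2 + Y ^ 2 + V ^ 2) / (2 * Y * V) * (a ^ 2 + b ^ 2 + u ^ 2 + v ^ 2)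
      + 2 * (-(a * u) - ζ / V * (a * v) + ζ / Y * (b * u)
        + (ζ ^ 2 - Y ^ 2 - V ^ 2) / (2 * Y * V) * (b * v))) / 2
      - (ζ ^ 2 + Y ^ 2 + V ^ 2) / (2 * Y * V) * ((u' - u) ^ 2 + (v' - v) ^ 2)
    ≤ (ζ ^ 2 + Y ^ 2 + V ^ 2) / (2 * Y * V) * (a ^ 2 + b ^ 2 + u' ^ 2 + v' ^ 2)
      + 2 * (-(a * u') - ζ / V * (a * v') + ζ / Y * (b * u')
        + (ζ ^ 2 - Y ^ 2 - V ^ 2) / (2 * Y * V) * (b * v')) := by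
  have := dist_form_nonneg (ζ := ζ) hY hV a b (2 * u' - u) (2 * v' - v)
  nlinarith

/-- The pairing of an orthogonal matrix with the mixed Hessian of the distance. -/
theorem orth_pairing_ge {Y V ζ g₁ g₂ g₃ g₄ : ℝ} (hY : 0 < Y) (hV : 0 < V)
    (h₁ : g₁ ^ 2 + g₂ ^ 2 = 1) (h₂ : g₃ ^ 2 + g₄ ^ 2 = 1) (h₃ : g₁ * g₃ + g₂ * g₄ = 0) :
    -((ζ ^ 2 + Y ^ 2 + V ^ 2) / (2 * Y * V) + 1) ≤ -g₁ - ζ / V * g₃ + ζ / Y * g₂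
      + (ζ ^ 2 - Y ^ 2 - V ^ 2) / (2 * Y * V) * g₄ := by
  set Q := (ζ ^ 2 + Y ^ 2 + V ^ 2) / (2 * Y * V) with hQ
  set Dd := (ζ ^ 2 - Y ^ 2 - V ^ 2) / (2 * Y * V) with hD
  have hQ1 : 1 ≤ Q := by
    rw [hQ, le_div_iff₀ (by positivity)]; nlinarith [sq_nonneg ζ, sq_nonneg (Y - V)]
  have i1 : (Dd - 1) ^ 2 + (ζ * (1 / Y + 1 / V)) ^ 2 = (Q + 1) ^ 2 := by
    rw [hQ, hD]; field_simp; ring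
  have i2 : (Dd + 1) ^ 2 + (ζ * (1 / Y - 1 / V)) ^ 2 = (Q - 1) ^ 2 := by
    rw [hQ, hD]; field_simp; ring
  have hd : (g₁ * g₄ - g₂ * g₃ - 1) * (g₁ * g₄ - g₂ * g₃ + 1) = 0 := by
    linear_combination (g₃ ^ 2 + g₄ ^ 2) * h₁ + h₂ - (g₁ * g₃ + g₂ * g₄) * h₃
  have cs : ∀ a b s : ℝ, 0 ≤ s → a ^ 2 + b ^ 2 = s ^ 2 → -s ≤ a * g₁ + b * g₂ := by
    intro a b s hs hab
    have : (a * g₁ + b * g₂) ^ 2 ≤ s ^ 2 := by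
      have : (a * g₁ + b * g₂) ^ 2 + (a * g₂ - b * g₁) ^ 2 = s ^ 2 := by
        linear_combination (a ^ 2 + b ^ 2) * h₁ + hab
      nlinarith [sq_nonneg (a * g₂ - b * g₁)]
    exact (abs_le.1 (abs_le_of_sq_le_sq this hs)).1
  rcases mul_eq_zero.1 hd with hd | hd
  · have e3 : g₃ = -g₂ := by
      linear_combination -g₃ * h₁ + g₁ * h₃ - g₂ * hd
    have e4 : g₄ = g₁ := by
      linear_combination -g₄ * h₁ + g₂ * h₃ + g₁ * hd
    have := cs (Dd - 1) (ζ * (1 / Y + 1 / V)) (Q + 1) (by linarith) i1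
    rw [e3, e4]
    have e : (Dd - 1) * g₁ + ζ * (1 / Y + 1 / V) * g₂ =
      -g₁ - ζ / V * -g₂ + ζ / Y * g₂ + Dd * g₁ := by ring
    linarith
  · have e3 : g₃ = g₂ := by
      linear_combination -g₃ * h₁ + g₁ * h₃ - g₂ * hd
    have e4 : g₄ = -g₁ := by
      linear_combination -g₄ * h₁ + g₂ * h₃ + g₁ * hd
    have := cs (-(Dd + 1)) (ζ * (1 / Y - 1 / V)) (Q - 1) (by linarith)
      (by linear_combination i2)
    rw [e3, e4]
    have e : -(Dd + 1) * g₁ + ζ * (1 / Y - 1 / V) * g₂ =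
      -g₁ - ζ / V * g₂ + ζ / Y * g₂ + Dd * -g₁ := by ring
    linarith

/-- Lower bound for the Hessian of the distance on a pair of normalized differentials. -/
theorem hessian_form_ge {Y V ζ p q r x₁ x₂ y₁ y₂ u₁ u₂ v₁ v₂ : ℝ} (hY : 0 < Y) (hV : 0 < V)
    (hp : 0 < p) (hdet : p * r - q ^ 2 = 1) (m₁₁ : x₁ ^ 2 + y₁ ^ 2 = p ^ 2 + q ^ 2)
    (m₁₂ : x₁ * x₂ + y₁ * y₂ = q * (p + r)) (m₂₂ : x₂ ^ 2 + y₂ ^ 2 = q ^ 2 + r ^ 2) :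
    (ζ ^ 2 + Y ^ 2 + V ^ 2) / (2 * Y * V) * (p + r) - (ζ ^ 2 + Y ^ 2 + V ^ 2) / (2 * Y * V) - 1
      - (ζ ^ 2 + Y ^ 2 + V ^ 2) / (2 * Y * V) * (p + r)
        * ((u₁ - 1) ^ 2 + u₂ ^ 2 + v₁ ^ 2 + (v₂ - 1) ^ 2)
    ≤ (ζ ^ 2 + Y ^ 2 + V ^ 2) / (2 * Y * V) *
        ((r * x₁ ^ 2 - 2 * q * x₁ * x₂ + p * x₂ ^ 2) + (r * y₁ ^ 2 - 2 * q * y₁ * y₂ + p * y₂ ^ 2)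
        + (r * u₁ ^ 2 - 2 * q * u₁ * u₂ + p * u₂ ^ 2)
        + (r * v₁ ^ 2 - 2 * q * v₁ * v₂ + p * v₂ ^ 2))
      + 2 * (-(r * x₁ * u₁ - q * (x₁ * u₂ + x₂ * u₁) + p * x₂ * u₂)
        - ζ / V * (r * x₁ * v₁ - q * (x₁ * v₂ + x₂ * v₁) + p * x₂ * v₂)
        + ζ / Y * (r * y₁ * u₁ - q * (y₁ * u₂ + y₂ * u₁) + p * y₂ * u₂)
        + (ζ ^ 2 - Y ^ 2 - V ^ 2) / (2 * Y * V)
          * (r * y₁ * v₁ - q * (y₁ * v₂ + y₂ * v₁) + p * y₂ * v₂)) := by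
  have f1 := dist_form_half_le (ζ := ζ) hY hV x₁ y₁ 1 0 u₁ v₁
  have f2 := dist_form_half_le (ζ := ζ) hY hV (p * x₂ - q * x₁) (p * y₂ - q * y₁) (-q) p
    (p * u₂ - q * u₁) (p * v₂ - q * v₁)
  have o := orth_pairing_ge (ζ := ζ) (g₁ := r * x₁ - q * x₂) (g₂ := r * y₁ - q * y₂)
    (g₃ := p * x₂ - q * x₁) (g₄ := p * y₂ - q * y₁) hY hV
    (by linear_combination r ^ 2 * m₁₁ - 2 * q * r * m₁₂ + q ^ 2 * m₂₂
          + (p * r - q ^ 2 + 1) * hdet)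
    (by linear_combination q ^ 2 * m₁₁ - 2 * p * q * m₁₂ + p ^ 2 * m₂₂
          + (p * r - q ^ 2 + 1) * hdet)
    (by linear_combination -(r * q) * m₁₁ + (p * r + q ^ 2) * m₁₂ - p * q * m₂₂)
  have hQ0 : 0 < (ζ ^ 2 + Y ^ 2 + V ^ 2) / (2 * Y * V) := by positivity
  set Q := (ζ ^ 2 + Y ^ 2 + V ^ 2) / (2 * Y * V) with hQ
  set Dd := (ζ ^ 2 - Y ^ 2 - V ^ 2) / (2 * Y * V) with hD
  generalize ζ / V = s at *
  generalize ζ / Y = t at *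
  have hpr : p * r = 1 + q ^ 2 := by linarith
  have err : (u₁ - 1) ^ 2 + (v₁ - 0) ^ 2 + ((p * u₂ - q * u₁ - -q) ^ 2 + (p * v₂ - q * v₁ - p) ^ 2)
      ≤ p * (p + r) * ((u₁ - 1) ^ 2 + u₂ ^ 2 + v₁ ^ 2 + (v₂ - 1) ^ 2) := by
    have e : p * (p + r) * ((u₁ - 1) ^ 2 + u₂ ^ 2 + v₁ ^ 2 + (v₂ - 1) ^ 2)
        - ((u₁ - 1) ^ 2 + (v₁ - 0) ^ 2
          + ((p * u₂ - q * u₁ - -q) ^ 2 + (p * v₂ - q * v₁ - p) ^ 2))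
        = u₂ ^ 2 + (v₂ - 1) ^ 2 + (q * u₂ + p * (u₁ - 1)) ^ 2 + (q * (v₂ - 1) + p * v₁) ^ 2 := by
      linear_combination ((u₁ - 1) ^ 2 + u₂ ^ 2 + v₁ ^ 2 + (v₂ - 1) ^ 2) * hpr
    have : 0 ≤ u₂ ^ 2 + (v₂ - 1) ^ 2 + (q * u₂ + p * (u₁ - 1)) ^ 2
      + (q * (v₂ - 1) + p * v₁) ^ 2 := by positivity
    linarith
  have errQ := mul_le_mul_of_nonneg_left err hQ0.le
  have po := mul_le_mul_of_nonneg_left o hp.le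
  apply le_of_mul_le_mul_left _ hp
  have N : x₁ ^ 2 + y₁ ^ 2 + (p * x₂ - q * x₁) ^ 2 + (p * y₂ - q * y₁) ^ 2 = p * (p + r) := by
    linear_combination (1 + q ^ 2) * m₁₁ - 2 * p * q * m₁₂ + p ^ 2 * m₂₂
      + (p * r - q ^ 2) * hdet
  have k1 : (p * r - (1 + q ^ 2)) * (Q * (x₁ ^ 2 + y₁ ^ 2 + u₁ ^ 2 + v₁ ^ 2)
      + 2 * (-(x₁ * u₁) - s * (x₁ * v₁) + t * (y₁ * u₁) + Dd * (y₁ * v₁))) = 0 := by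
    rw [hpr]; ring
  have k2 : (p * r - (1 + q ^ 2)) * (-x₁ + t * y₁) = 0 := by rw [hpr]; ring
  have k3 : (p * r - (1 + q ^ 2)) * Q = 0 := by rw [hpr]; ring
  have k4 : Q * (x₁ ^ 2 + y₁ ^ 2 + (p * x₂ - q * x₁) ^ 2 + (p * y₂ - q * y₁) ^ 2)
    = Q * (p * (p + r)) := by rw [N]
  clear N err o m₁₁ m₁₂ m₂₂ hdet hpr hQ hD
  linarith

/-- `U + iV` is a comparison map: almost conformal and almost harmonic up to `e`. -/
structure ComparisonAt (p q r U V : ℂ → ℝ) (e : ℝ) (z : ℂ) : Prop where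
  first_order : (z.im * D 1 U z / V z - 1) ^ 2 + (z.im * D Complex.I U z / V z) ^ 2
    + (z.im * D 1 V z / V z) ^ 2 + (z.im * D Complex.I V z / V z - 1) ^ 2 ≤ e ^ 2
  tension_re : |Lop p q r U z - 2 * Bf p q r U V z / V z| ≤ e * (p z + r z) * V z
  tension_im : |Lop p q r V z - (Bf p q r V V z - Bf p q r U U z) / V z|
    ≤ e * (p z + r z) * V z

theorem tension_absorb {Q τ e w : ℝ} (he : 0 ≤ e) (he' : e ≤ 1 / 16) (hQ : 1 ≤ Q) (hτ : 2 ≤ τ)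
    (hw : 0 ≤ w) (hwQ : w ^ 2 = Q ^ 2 - 1) :
    (τ - 2) * Q / 2 + (Q - 1) / 2 - 66 * e ^ 2
      ≤ Q * τ - Q - 1 - Q * τ * e ^ 2 - 2 * (e * τ * w) := by
  have h1 : w ≤ Q := by nlinarith
  have h2 : 4 * e * w ≤ (Q - 1) / 4 + 64 * e ^ 2 := by
    apply le_of_sq_le_sq _ (by nlinarith [sq_nonneg e])
    have e1 : (4 * e * w) ^ 2 = 16 * e ^ 2 * (Q ^ 2 - 1) := by rw [← hwQ]; ring
    rw [e1]
    have h3 : e ^ 2 ≤ 1 / 256 := by nlinarith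
    nlinarith [mul_nonneg (sq_nonneg (Q - 1)) (sub_nonneg.2 h3), sq_nonneg (e ^ 2),
      mul_nonneg (sub_nonneg.2 hQ) (sq_nonneg e)]
  have h4 : e ^ 2 ≤ e / 16 := by nlinarith
  have h5 : 0 ≤ (τ - 2) * Q := mul_nonneg (by linarith) (by linarith)
  have h6 : e * ((τ - 2) * w) ≤ e * ((τ - 2) * Q) :=
    mul_le_mul_of_nonneg_left (mul_le_mul_of_nonneg_left h1 (by linarith)) he
  have h7 : e * ((τ - 2) * Q) ≤ 1 / 16 * ((τ - 2) * Q) := mul_le_mul_of_nonneg_right he' h5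
  have h8 : e ^ 2 * ((τ - 2) * Q) ≤ 1 / 256 * ((τ - 2) * Q) :=
    mul_le_mul_of_nonneg_right (by linarith) h5
  have h9 : e ^ 2 * (Q - 1) ≤ 1 / 256 * (Q - 1) :=
    mul_le_mul_of_nonneg_right (by linarith) (by linarith)
  nlinarith

/-- The value of the form with matrix `[[r, -q], [-q, p]]`. -/
def cof (p q r a₁ a₂ b₁ b₂ : ℝ) : ℝ := r * (a₁ * b₁) - q * (a₁ * b₂ + a₂ * b₁) + p * (a₂ * b₂)

theorem Bf_eq_cof (p q r f g : ℂ → ℝ) (z : ℂ) : Bf p q r f g z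
    = z.im ^ 2 * cof (p z) (q z) (r z) (D 1 f z) (D Complex.I f z) (D 1 g z) (D Complex.I g z) :=
  rfl

theorem hessian_tension_ge {y Y V ζ p q r x₁ x₂ y₁ y₂ u₁ u₂ v₁ v₂ Q e T₁ T₂ : ℝ}
    (hY : 0 < Y) (hV : 0 < V) (hp : 0 < p) (hτ : 2 ≤ p + r) (hdet : p * r - q ^ 2 = 1)
    (m₁₁ : y * y * (x₁ * x₁ + y₁ * y₁) = Y * Y * (p * p + q * q))
    (m₁₂ : y * y * (x₁ * x₂ + y₁ * y₂) = Y * Y * (q * (p + r)))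
    (m₂₂ : y * y * (x₂ * x₂ + y₂ * y₂) = Y * Y * (q * q + r * r))
    (hQ : Q = (ζ ^ 2 + Y ^ 2 + V ^ 2) / (2 * Y * V)) (hQ1 : 1 ≤ Q)
    (he : 0 ≤ e) (he' : e ≤ 1 / 16)
    (c1 : (y * u₁ / V - 1) ^ 2 + (y * u₂ / V) ^ 2 + (y * v₁ / V) ^ 2 + (y * v₂ / V - 1) ^ 2
      ≤ e ^ 2)
    (c2 : |T₁| ≤ e * (p + r) * V) (c3 : |T₂| ≤ e * (p + r) * V) :
    (p + r - 2) * Q / 2 + (Q - 1) / 2 - 66 * e ^ 2 ≤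
      Q * (y ^ 2 * cof p q r x₁ x₂ x₁ x₂ + y ^ 2 * cof p q r y₁ y₂ y₁ y₂) / Y ^ 2
      + Q * (y ^ 2 * cof p q r u₁ u₂ u₁ u₂ + y ^ 2 * cof p q r v₁ v₂ v₁ v₂) / V ^ 2
      + 2 / (Y * V) * (-(y ^ 2 * cof p q r x₁ x₂ u₁ u₂) - ζ / V * (y ^ 2 * cof p q r x₁ x₂ v₁ v₂)
        + ζ / Y * (y ^ 2 * cof p q r y₁ y₂ u₁ u₂)
        + (ζ ^ 2 - Y ^ 2 - V ^ 2) / (2 * Y * V) * (y ^ 2 * cof p q r y₁ y₂ v₁ v₂))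
      - ζ / Y * (T₁ / V) + (V ^ 2 - Y ^ 2 - ζ ^ 2) / (2 * Y * V) * (T₂ / V) := by
  have main := hessian_form_ge (ζ := ζ) (p := p) (q := q) (r := r)
    (x₁ := y / Y * x₁) (x₂ := y / Y * x₂) (y₁ := y / Y * y₁) (y₂ := y / Y * y₂)
    (u₁ := y / V * u₁) (u₂ := y / V * u₂) (v₁ := y / V * v₁) (v₂ := y / V * v₂) hY hV hp
    hdet (by field_simp; linarith only [m₁₁]) (by field_simp; linarith only [m₁₂])
    (by field_simp; linarith only [m₂₂])
  rw [← hQ] at main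
  have hw2 : (ζ / Y) ^ 2 + ((V ^ 2 - Y ^ 2 - ζ ^ 2) / (2 * Y * V)) ^ 2 = Q ^ 2 - 1 := by
    rw [hQ]; field_simp; ring
  generalize (V ^ 2 - Y ^ 2 - ζ ^ 2) / (2 * Y * V) = k at *
  generalize (ζ ^ 2 - Y ^ 2 - V ^ 2) / (2 * Y * V) = Dd at *
  obtain ⟨w, hw⟩ : ∃ w, w = √(Q ^ 2 - 1) := ⟨_, rfl⟩
  have hwsq : w ^ 2 = Q ^ 2 - 1 := by rw [hw]; exact Real.sq_sqrt (by nlinarith only [hQ1])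
  have hw0 : 0 ≤ w := by rw [hw]; exact Real.sqrt_nonneg _
  have k1 : |ζ / Y| ≤ w := abs_le_of_sq_le_sq (by nlinarith only [sq_nonneg k, hw2, hwsq]) hw0
  have k2 : |k| ≤ w :=
    abs_le_of_sq_le_sq (by nlinarith only [sq_nonneg (ζ / Y), hw2, hwsq]) hw0
  have t1 : |T₁ / V| ≤ e * (p + r) := by
    rw [abs_div, abs_of_pos hV, div_le_iff₀ hV]; exact c2
  have t2 : |T₂ / V| ≤ e * (p + r) := by
    rw [abs_div, abs_of_pos hV, div_le_iff₀ hV]; exact c3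
  have s1 : ζ / Y * (T₁ / V) ≤ w * (e * (p + r)) := by
    refine (le_abs_self _).trans ?_
    rw [abs_mul]; exact mul_le_mul k1 t1 (abs_nonneg _) hw0
  have s2 : -(w * (e * (p + r))) ≤ k * (T₂ / V) := by
    refine le_trans ?_ (neg_abs_le _)
    rw [abs_mul]; exact neg_le_neg (mul_le_mul k2 t2 (abs_nonneg _) hw0)
  have ab := tension_absorb (τ := p + r) he he' hQ1 hτ hw0 hwsq
  have c1' : (y / V * u₁ - 1) ^ 2 + (y / V * u₂) ^ 2 + (y / V * v₁) ^ 2 + (y / V * v₂ - 1) ^ 2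
      ≤ e ^ 2 := by
    refine le_trans (le_of_eq ?_) c1; ring
  have q1 := mul_le_mul_of_nonneg_left c1'
    (mul_nonneg (by linarith only [hQ1]) (by linarith only [hτ]) : 0 ≤ Q * (p + r))
  have main' := (sub_le_sub_left q1 (Q * (p + r) - Q - 1)).trans main
  have fin : ∀ A B C : ℝ, Q * (p + r) - Q - 1 - Q * (p + r) * e ^ 2 ≤ A →
      B ≤ w * (e * (p + r)) → -(w * (e * (p + r))) ≤ C →
      (p + r - 2) * Q / 2 + (Q - 1) / 2 - 66 * e ^ 2 ≤ A - B + C := by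
    intro A B C hA hB hC
    linarith only [ab, hA, hB, hC]
  refine fin _ _ _ (main'.trans (le_of_eq ?_)) s1 s2
  unfold cof
  generalize ζ / V = s
  generalize ζ / Y = t
  rw [div_eq_mul_inv, div_eq_mul_inv y V, div_eq_mul_inv 2 (Y * V), mul_inv]
  rw [div_eq_mul_inv (Q * _) (Y ^ 2), div_eq_mul_inv (Q * _) (V ^ 2)]
  rw [← inv_pow, ← inv_pow]
  generalize Y⁻¹ = Y'
  generalize V⁻¹ = V'
  ring

namespace MinLagData
variable {p q r X Y U V : ℂ → ℝ} (h : MinLagData p q r X Y) {z : ℂ} {e : ℝ}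
include h

theorem Lop_coshDist_ge (hU : C2 U) (hV : C2 V) (pV : ∀ z ∈ Hset, 0 < V z) (hz : z ∈ Hset)
    (he : 0 ≤ e) (he' : e ≤ 1 / 16) (hc : ComparisonAt p q r U V e z) :
    (p z + r z - 2) * coshDist X Y U V z / 2 + (coshDist X Y U V z - 1) / 2 - 66 * e ^ 2
      ≤ Lop p q r (coshDist X Y U V) z := by
  have hQe : coshDist X Y U V z
      = ((X z - U z) ^ 2 + Y z ^ 2 + V z ^ 2) / (2 * Y z * V z) := by
    unfold coshDist; congr 1 <;> ring
  rw [Lop_coshDist h.c2X h.c2Y hU hV h.Ypos pV hz (h.harmonic hz).1 (h.harmonic hz).2]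
  have := hessian_tension_ge (h.Ypos z hz) (pV z hz) (h.pos z hz)
    (h.toCodazziField.trace_ge hz) (h.det z hz) (h.met₁₁ z hz) (h.met₁₂ z hz) (h.met₂₂ z hz) hQe
    (coshDist_ge_one (X := X) (U := U) (h.Ypos z hz) (pV z hz)) he he' hc.first_order
    hc.tension_re hc.tension_im
  simpa only [Bf_eq_cof] using this

/-- The curvature is quadratically small once a good comparison map at finite distance
is available. -/
theorem curvSq_le (hU : C2 U) (hV : C2 V) (pV : ∀ z ∈ Hset, 0 < V z)
    (he : 0 ≤ e) (he' : e ≤ 1 / 16) (hc : ∀ z ∈ Hset, ComparisonAt p q r U V e z) {M K : ℝ}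
    (hM : ∀ z ∈ Hset, p z + r z ≤ M) (hK : ∀ z ∈ Hset, coshDist X Y U V z ≤ K) :
    ∀ z ∈ Hset, curvSq p r z ≤ 528 * e ^ 2 := by
  have hQ := C2_coshDist h.c2X h.c2Y hU hV h.Ypos pV
  have hF := h.toCodazziField.c2_curvSq
  have h4Q := (C2.const 4).mul hQ
  have hF1 : ∀ z ∈ Hset, curvSq p r z ≤ 1 := by
    intro z hz
    have := h.toCodazziField.trace_ge hz
    unfold curvSq
    rw [div_le_one (by linarith)]; linarith
  have hP := max_principle (p := p) (q := q) (r := r)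
    (P := fun u => curvSq p r u + 4 * coshDist X Y U V u) (K := 1 + 4 * K) (κ := 1 / 2)
    (c := 4 + 528 * e ^ 2) (hF.add h4Q) (by norm_num) h.pos h.det hM
    (fun z hz => by linarith [hF1 z hz, hK z hz])
    (fun z hz => by
      rw [Lop_add hF h4Q hz, Lop_const_mul 4 hQ hz]
      have l1 := h.toCodazziField.neg_four_mul_le_Lop_curvSq hz
      have l2 := h.Lop_coshDist_ge hU hV pV hz he he' (hc z hz)
      have hQ1 := coshDist_ge_one (X := X) (U := U) (h.Ypos z hz) (pV z hz)
      have hτ := h.toCodazziField.trace_ge hz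
      have hF0 := h.toCodazziField.curvSq_nonneg hz
      have h4F : 4 * curvSq p r z ≤ p z + r z - 2 := by
        unfold curvSq
        rw [mul_div_assoc', div_le_iff₀ (by linarith)]
        nlinarith
      have h5 : p z + r z - 2 ≤ (p z + r z - 2) * coshDist X Y U V z := by
        nlinarith
      linarith)
  intro z hz
  have := hP z hz
  have hQ1 := coshDist_ge_one (X := X) (U := U) (h.Ypos z hz) (pV z hz)
  linarith

end MinLagData

/-! ### Almost affine behaviour of quasisymmetric maps of the line -/

/-- A homeomorphism of the line whose ratio of adjacent increments of equal steps is
at most `1 + ε`. -/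
structure QSLine (f : ℝ → ℝ) (ε : ℝ) : Prop where
  cont : Continuous f
  mono : StrictMono f
  right_le : ∀ x h, 0 < h → f (x + h) - f x ≤ (1 + ε) * (f x - f (x - h))
  left_le : ∀ x h, 0 < h → f x - f (x - h) ≤ (1 + ε) * (f (x + h) - f x)

namespace QSLine
variable {f : ℝ → ℝ} {ε : ℝ}

theorem reflect_le (h : QSLine f ε) (hε : 0 ≤ ε) (x : ℝ) {t : ℝ} (ht : 0 ≤ t) :
    |(f (x + t) - f x) - (f x - f (x - t))| ≤ ε * (f (x + t) - f x) ∧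
    |(f (x + t) - f x) - (f x - f (x - t))| ≤ ε * (f x - f (x - t)) := by
  rcases ht.eq_or_lt with rfl | ht
  · simp
  have h1 := h.right_le x t ht
  have h2 := h.left_le x t ht
  have h3 := h.mono (show x < x + t by linarith)
  have h4 := h.mono (show x - t < x by linarith)
  rcases le_total (f (x + t) - f x) (f x - f (x - t)) with h5 | h5
  · rw [abs_of_nonpos (by linarith)]
    constructor
    · linarith
    · nlinarith
  · rw [abs_of_nonneg (by linarith)]
    constructor
    · nlinarith
    · linarith

theorem affine_unit (h : QSLine f ε) (hε : 0 ≤ ε) (x : ℝ) {y : ℝ} (hy : 0 < y) {t : ℝ}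
    (ht : t ∈ Icc (0 : ℝ) 1) :
    |f (x + t * y) - f x - t * (f (x + y) - f x)| ≤ ε / 2 * (f (x + y) - f x) := by
  set w := f (x + y) - f x with hw
  set g : ℝ → ℝ := fun t => f (x + t * y) - f x - t * w with hg
  have hcont : Continuous fun t => |g t| := by
    have := h.cont; fun_prop
  obtain ⟨m, hm, hmax⟩ := isCompact_Icc.exists_isMaxOn (s := Icc (0:ℝ) 1) ⟨0, by simp⟩
    hcont.continuousOn
  have hg0 : g 0 = 0 := by simp [hg]
  have hg1 : g 1 = 0 := by simp [hg, hw]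
  have key : |g m| ≤ |g m| / 2 + ε / 4 * w := by
    have mid : ∀ a b : ℝ, 0 ≤ a → a ≤ b → b ≤ 1 → |g ((a + b) / 2) - (g a + g b) / 2| ≤ ε / 4 * w := by
      intro a b ha hab hb
      have h1 := h.reflect_le hε (x + (a + b) / 2 * y) (t := (b - a) / 2 * y)
        (mul_nonneg (by linarith) hy.le)
      rw [show x + (a + b) / 2 * y + (b - a) / 2 * y = x + b * y by ring,
        show x + (a + b) / 2 * y - (b - a) / 2 * y = x + a * y by ring] at h1
      have h2 : f (x + b * y) ≤ f (x + y) := h.mono.monotone (by nlinarith)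
      have h3 : f x ≤ f (x + a * y) := h.mono.monotone (by nlinarith)
      have h4 : g ((a + b) / 2) - (g a + g b) / 2 = -((f (x + b * y) - f (x + (a + b) / 2 * y)
          - (f (x + (a + b) / 2 * y) - f (x + a * y))) / 2) := by
        simp only [hg]; ring
      rw [h4, abs_neg, abs_div, abs_two]
      nlinarith [h1.1, h1.2]
    rcases le_total m (1 / 2) with hm2 | hm2
    · have h1 := mid 0 (2 * m) le_rfl (by linarith [hm.1]) (by linarith)
      have h2 : |g (2 * m)| ≤ |g m| := hmax ⟨by linarith [hm.1], by linarith⟩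
      rw [show (0 + 2 * m) / 2 = m by ring, hg0] at h1
      rw [abs_le] at h1 h2 ⊢
      constructor <;> linarith
    · have h1 := mid (2 * m - 1) 1 (by linarith) (by linarith [hm.2]) le_rfl
      have h2 : |g (2 * m - 1)| ≤ |g m| := hmax ⟨by linarith, by linarith [hm.2]⟩
      rw [show (2 * m - 1 + 1) / 2 = m by ring, hg1] at h1
      rw [abs_le] at h1 h2 ⊢
      constructor <;> linarith
  have := hmax ht
  have h5 : |g t| ≤ |g m| := this
  show |g t| ≤ _
  linarith

/-- On an interval of size comparable to `y` around `x`, the map is close to an affine one. -/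
theorem affine (h : QSLine f ε) (hε : 0 ≤ ε) (hε' : ε ≤ 1 / 2) (x : ℝ) {y : ℝ} (hy : 0 < y) {t : ℝ}
    (ht : |t| ≤ 2) :
    |f (x + t * y) - f x - t * (f (x + y) - f x)| ≤ 5 * ε * (f (x + y) - f x) := by
  have hw : 0 < f (x + y) - f x := sub_pos.2 (h.mono (by linarith))
  set w := f (x + y) - f x with hw'
  have hεw : 0 ≤ ε * w := by positivity
  have A := fun t ht => h.affine_unit hε x hy (t := t) ht
  have B : ∀ t ∈ Icc (1 : ℝ) 2, |f (x + t * y) - f x - t * w| ≤ 3 / 2 * ε * w := by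
    intro t ht
    have h1 := (h.reflect_le hε (x + y) (t := (t - 1) * y) (by nlinarith [ht.1])).2
    have h2 := A (2 - t) ⟨by linarith [ht.2], by linarith [ht.1]⟩
    rw [show x + y + (t - 1) * y = x + t * y by ring,
      show x + y - (t - 1) * y = x + (2 - t) * y by ring] at h1
    have h3 : f x ≤ f (x + (2 - t) * y) := h.mono.monotone (by nlinarith [ht.2])
    rw [← hw'] at h2
    have h4 : ε * (f (x + y) - f (x + (2 - t) * y)) ≤ ε * w := by
      apply mul_le_mul_of_nonneg_left _ hε; linarith
    rw [abs_le] at *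
    constructor <;> linarith
  have E : ∀ t ∈ Icc (0 : ℝ) 2, |f (x + t * y) - f x - t * w| ≤ 3 / 2 * ε * w := by
    intro t ht
    rcases le_total t 1 with h1 | h1
    · have := A t ⟨ht.1, h1⟩
      rw [← hw'] at this
      linarith
    · exact B t ⟨h1, ht.2⟩
  rw [abs_le] at ht
  rcases le_total 0 t with h0 | h0
  · have := E t ⟨h0, ht.2⟩
    linarith
  · have h1 := (h.reflect_le hε x (t := (-t) * y) (by nlinarith)).1
    have h2 := E (-t) ⟨by linarith, by linarith⟩
    rw [show x - -t * y = x + t * y by ring] at h1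
    have h4 : f (x + -t * y) - f x ≤ 3 * w := by
      have := (abs_le.1 h2).2
      nlinarith
    have h5 : ε * (f (x + -t * y) - f x) ≤ ε * (3 * w) := mul_le_mul_of_nonneg_left h4 hε
    rw [abs_le] at *
    constructor <;> linarith

end QSLine

/-! ### A comparison map built from second primitives -/

/-- The primitive of a function on the line vanishing at the origin. -/
def primitive (f : ℝ → ℝ) (s : ℝ) : ℝ := ∫ t in (0 : ℝ)..s, f t

theorem hasDerivAt_primitive {f : ℝ → ℝ} (hf : Continuous f) (s : ℝ) :
    HasDerivAt (primitive f) (f s) s :=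
  intervalIntegral.integral_hasDerivAt_right (hf.intervalIntegrable _ _)
    (hf.stronglyMeasurableAtFilter _ _) hf.continuousAt

theorem continuous_primitive {f : ℝ → ℝ} (hf : Continuous f) : Continuous (primitive f) :=
  continuous_iff_continuousAt.2 fun s => (hasDerivAt_primitive hf s).continuousAt

theorem contDiff_primitive {f : ℝ → ℝ} (hf : Continuous f) : ContDiff ℝ 1 (primitive f) := by
  rw [contDiff_one_iff_deriv]
  refine ⟨fun s => (hasDerivAt_primitive hf s).differentiableAt, ?_⟩
  rwa [show deriv (primitive f) = f from funext fun s => (hasDerivAt_primitive hf s).deriv]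

theorem contDiff_primitive_primitive {f : ℝ → ℝ} (hf : Continuous f) :
    ContDiff ℝ 2 (primitive (primitive f)) := by
  have hc := continuous_primitive hf
  rw [show (2 : WithTop ℕ∞) = 1 + 1 by norm_num, contDiff_succ_iff_deriv]
  refine ⟨fun s => (hasDerivAt_primitive hc s).differentiableAt, by simp, ?_⟩
  rw [show deriv (primitive (primitive f)) = primitive f from
    funext fun s => (hasDerivAt_primitive hc s).deriv]
  exact contDiff_primitive hf

theorem abs_le_of_abs_deriv_le {E E' : ℝ → ℝ} {B : ℝ} (h0 : E 0 = 0)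
    (hd : ∀ t, HasDerivAt E (E' t) t) (hB : ∀ t, |t| ≤ 2 → |E' t| ≤ B) {t : ℝ} (ht : |t| ≤ 2) :
    |E t| ≤ 2 * B := by
  have hB0 : 0 ≤ B := (abs_nonneg _).trans (hB t ht)
  have := Convex.norm_image_sub_le_of_norm_hasDerivWithin_le (f := E) (f' := E') (C := B)
    (s := Icc (-2 : ℝ) 2) (x := 0) (y := t) (fun s _ => (hd s).hasDerivWithinAt)
    (fun s hs => hB s (abs_le.2 hs)) (convex_Icc _ _) (by constructor <;> norm_num) (abs_le.1 ht)
  rw [h0, sub_zero, sub_zero, Real.norm_eq_abs, Real.norm_eq_abs] at this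
  nlinarith

namespace QSLine
variable {f : ℝ → ℝ} {ε : ℝ}

theorem primitive_affine (h : QSLine f ε) (hε : 0 ≤ ε) (hε' : ε ≤ 1 / 2) (x : ℝ) {y : ℝ}
    (hy : 0 < y) {t : ℝ} (ht : |t| ≤ 2) :
    |primitive f (x + t * y) - primitive f x - f x * t * y - (f (x + y) - f x) * t ^ 2 * y / 2|
      ≤ 10 * ε * (f (x + y) - f x) * y := by
  have := abs_le_of_abs_deriv_le
    (E := fun t => primitive f (x + t * y) - primitive f x - f x * t * y
      - (f (x + y) - f x) * t ^ 2 * y / 2)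
    (E' := fun t => y * (f (x + t * y) - f x - t * (f (x + y) - f x)))
    (B := 5 * ε * (f (x + y) - f x) * y) (by simp)
    (fun t => by
      have h1 : HasDerivAt (fun t : ℝ => x + t * y) y t := by
        simpa using ((hasDerivAt_id t).mul_const y).const_add x
      have h2 := (hasDerivAt_primitive h.cont (x + t * y)).comp t h1
      have h3 : HasDerivAt (fun t : ℝ => f x * t * y) (f x * 1 * y) t :=
        ((hasDerivAt_id t).const_mul (f x)).mul_const y
      have h4 : HasDerivAt (fun t : ℝ => (f (x + y) - f x) * t ^ 2 * y / 2)
          ((f (x + y) - f x) * (2 * t) * y / 2) t := by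
        simpa using (((hasDerivAt_pow 2 t).const_mul (f (x + y) - f x)).mul_const y).div_const 2
      exact (((h2.sub_const (primitive f x)).sub h3).sub h4).congr_deriv (by ring))
    (fun t ht => by
      rw [abs_mul, abs_of_pos hy]
      nlinarith [h.affine hε hε' x hy ht]) ht
  linarith

theorem primitive_primitive_affine (h : QSLine f ε) (hε : 0 ≤ ε) (hε' : ε ≤ 1 / 2) (x : ℝ)
    {y : ℝ} (hy : 0 < y) {t : ℝ} (ht : |t| ≤ 2) :
    |primitive (primitive f) (x + t * y) - primitive (primitive f) x - primitive f x * t * y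
      - f x * t ^ 2 * y ^ 2 / 2 - (f (x + y) - f x) * t ^ 3 * y ^ 2 / 6|
      ≤ 20 * ε * (f (x + y) - f x) * y ^ 2 := by
  have := abs_le_of_abs_deriv_le
    (E := fun t => primitive (primitive f) (x + t * y) - primitive (primitive f) x
      - primitive f x * t * y - f x * t ^ 2 * y ^ 2 / 2 - (f (x + y) - f x) * t ^ 3 * y ^ 2 / 6)
    (E' := fun t => y * (primitive f (x + t * y) - primitive f x - f x * t * y
      - (f (x + y) - f x) * t ^ 2 * y / 2))
    (B := 10 * ε * (f (x + y) - f x) * y ^ 2) (by simp)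
    (fun t => by
      have h1 : HasDerivAt (fun t : ℝ => x + t * y) y t := by
        simpa using ((hasDerivAt_id t).mul_const y).const_add x
      have h2 := (hasDerivAt_primitive (continuous_primitive h.cont) (x + t * y)).comp t h1
      have h3 : HasDerivAt (fun t : ℝ => primitive f x * t * y) (primitive f x * 1 * y) t :=
        ((hasDerivAt_id t).const_mul (primitive f x)).mul_const y
      have h4 : HasDerivAt (fun t : ℝ => f x * t ^ 2 * y ^ 2 / 2)
          (f x * (2 * t) * y ^ 2 / 2) t := by
        simpa using (((hasDerivAt_pow 2 t).const_mul (f x)).mul_const (y ^ 2)).div_const 2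
      have h5 : HasDerivAt (fun t : ℝ => (f (x + y) - f x) * t ^ 3 * y ^ 2 / 6)
          ((f (x + y) - f x) * (3 * t ^ 2) * y ^ 2 / 6) t := by
        simpa using (((hasDerivAt_pow 3 t).const_mul (f (x + y) - f x)).mul_const
          (y ^ 2)).div_const 6
      exact ((((h2.sub_const (primitive (primitive f) x)).sub h3).sub h4).sub h5).congr_deriv
        (by ring))
    (fun t ht => by
      rw [abs_mul, abs_of_pos hy]
      nlinarith [h.primitive_affine hε hε' x hy ht]) ht
  linarith

end QSLine

/-- A finite difference operator with five nodes. -/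
def comb (a b c d e : ℝ) (g : ℝ → ℝ) (z : ℂ) : ℝ :=
  a * g (z.re + 2 * z.im) + b * g (z.re + z.im) + c * g z.re + d * g (z.re - z.im)
    + e * g (z.re - 2 * z.im)

theorem hasFDerivAt_re (z : ℂ) : HasFDerivAt Complex.re Complex.reCLM z :=
  Complex.reCLM.hasFDerivAt
theorem hasFDerivAt_im (z : ℂ) : HasFDerivAt Complex.im Complex.imCLM z :=
  Complex.imCLM.hasFDerivAt

theorem D_comb {g g' : ℝ → ℝ} (hg : ∀ s, HasDerivAt g (g' s) s) (a b c d e : ℝ) (v z : ℂ) :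
    D v (comb a b c d e g) z
      = v.re * comb a b c d e g' z + v.im * comb (2 * a) b 0 (-d) (-2 * e) g' z := by
  have hr := hasFDerivAt_re z
  have hi := hasFDerivAt_im z
  have h1 := ((hg _).comp_hasFDerivAt z (hr.add (hi.const_mul 2))).const_mul a
  have h2 := ((hg _).comp_hasFDerivAt z (hr.add hi)).const_mul b
  have h3 := ((hg _).comp_hasFDerivAt z hr).const_mul c
  have h4 := ((hg _).comp_hasFDerivAt z (hr.sub hi)).const_mul d
  have h5 := ((hg _).comp_hasFDerivAt z (hr.sub (hi.const_mul 2))).const_mul e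
  have h6 : HasFDerivAt (comb a b c d e g) _ z := (((h1.add h2).add h3).add h4).add h5
  unfold D
  rw [h6.fderiv]
  simp [comb]
  ring

theorem C2_comb {g : ℝ → ℝ} (hg : ContDiff ℝ 2 g) (a b c d e : ℝ) : C2 (comb a b c d e g) := by
  have hr : ContDiff ℝ 2 Complex.re := Complex.reCLM.contDiff
  have hi : ContDiff ℝ 2 Complex.im := Complex.imCLM.contDiff
  apply ContDiff.contDiffOn
  unfold comb
  fun_prop

/-- The finite difference operator divided by the square of the height. -/
def combDiv (a b c d e : ℝ) (g : ℝ → ℝ) (z : ℂ) : ℝ := comb a b c d e g z / (z.im * z.im)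

theorem C2_combDiv {g : ℝ → ℝ} (hg : ContDiff ℝ 2 g) (a b c d e : ℝ) :
    C2 (combDiv a b c d e g) :=
  (C2_comb hg a b c d e).div (C2.im.mul C2.im) fun z hz => by
    have : 0 < z.im := hz
    positivity

theorem D_combDiv {g g₁ g₂ : ℝ → ℝ} (hg : ContDiff ℝ 2 g) (h₁ : ∀ s, HasDerivAt g (g₁ s) s)
    (h₂ : ∀ s, HasDerivAt g₁ (g₂ s) s) (a b c d e : ℝ) {z : ℂ} (hz : z ∈ Hset) :
    let G := combDiv a b c d e g
    z.im * z.im * G z = comb a b c d e g z ∧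
    z.im * z.im * D 1 G z = comb a b c d e g₁ z ∧
    z.im * z.im * D Complex.I G z + 2 * z.im * G z = comb (2 * a) b 0 (-d) (-2 * e) g₁ z ∧
    z.im * z.im * D 1 (D 1 G) z = comb a b c d e g₂ z ∧
    z.im * z.im * D 1 (D Complex.I G) z + 2 * z.im * D 1 G z
      = comb (2 * a) b 0 (-d) (-2 * e) g₂ z ∧
    z.im * z.im * D Complex.I (D Complex.I G) z + 4 * z.im * D Complex.I G z + 2 * G z
      = comb (4 * a) b 0 d (4 * e) g₂ z := by
  intro G
  have hG : C2 G := C2_combDiv hg a b c d e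
  have hS : C2 (fun z : ℂ => z.im * z.im) := C2.im.mul C2.im
  have hE : EqOn (fun z : ℂ => z.im * z.im * G z) (comb a b c d e g) Hset := by
    intro z hz
    have : z.im ≠ 0 := ne_of_gt hz
    simp only [G, combDiv]
    field_simp
  have hD : ∀ v, ∀ z ∈ Hset, D v (fun z : ℂ => z.im * z.im * G z) z
      = v.re * comb a b c d e g₁ z + v.im * comb (2 * a) b 0 (-d) (-2 * e) g₁ z := by
    intro v z hz
    rw [D_congr hE v hz, D_comb h₁]
  have hD1 := fun v => D_mul v hS.c1 hG.c1 hz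
  have dS : ∀ (v : ℂ), ∀ z ∈ Hset, D v (fun z : ℂ => z.im * z.im) z = 2 * v.im * z.im := by
    intro v z hz
    rw [D_mul v C2.im.c1 C2.im.c1 hz, D_im]; ring
  have ddS : ∀ v w : ℂ, D v (D w (fun z : ℂ => z.im * z.im)) z = 2 * v.im * w.im := by
    intro v w
    rw [D_congr (fun u hu => dS w u hu) v hz, D_const_mul v _ C2.im.c1 hz, D_im]; ring
  have hDD1 := fun v w => DD_mul v w hS hG hz
  have e1 : D 1 (fun z : ℂ => z.im * z.im * G z) z = comb a b c d e g₁ z := by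
    rw [hD 1 z hz]; simp
  have e2 : D Complex.I (fun z : ℂ => z.im * z.im * G z) z
      = comb (2 * a) b 0 (-d) (-2 * e) g₁ z := by
    rw [hD _ z hz]; simp
  have e1' : EqOn (D 1 (fun z : ℂ => z.im * z.im * G z)) (comb a b c d e g₁) Hset := by
    intro z hz; rw [hD 1 z hz]; simp
  have e2' : EqOn (D Complex.I (fun z : ℂ => z.im * z.im * G z))
      (comb (2 * a) b 0 (-d) (-2 * e) g₁) Hset := by
    intro z hz; rw [hD _ z hz]; simp
  have e3 : D 1 (D 1 (fun z : ℂ => z.im * z.im * G z)) z = comb a b c d e g₂ z := by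
    rw [D_congr e1' _ hz, D_comb h₂]; simp
  have e4 : D 1 (D Complex.I (fun z : ℂ => z.im * z.im * G z)) z
      = comb (2 * a) b 0 (-d) (-2 * e) g₂ z := by
    rw [D_congr e2' _ hz, D_comb h₂]; simp
  have e5 : D Complex.I (D Complex.I (fun z : ℂ => z.im * z.im * G z)) z
      = comb (4 * a) b 0 d (4 * e) g₂ z := by
    rw [D_congr e2' _ hz, D_comb h₂]; simp only [comb, Complex.I_re, Complex.I_im]; ring
  rw [hD1, dS _ z hz] at e1 e2
  simp only [hDD1, ddS, dS _ z hz] at e3 e4 e5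
  simp only [Complex.one_im, Complex.I_im] at e1 e2 e3 e4 e5
  exact ⟨hE hz, by linarith, by linarith, by linarith, by linarith, by linarith⟩

theorem abs_mul_le_of_le_one {a b κ : ℝ} (ha : |a| ≤ κ) (hb : |b| ≤ κ) (hκ : κ ≤ 1) :
    |a * b| ≤ κ := by
  rw [abs_mul]
  nlinarith [abs_nonneg a, abs_nonneg b]

theorem abs_div_le_of_abs_le {p q r A B C v m κ : ℝ} (hp : 0 < p) (hr : 0 < r)
    (hq : q ^ 2 ≤ p * r) (hA : |A| ≤ m) (hB : |B| ≤ m) (hC : |C| ≤ m) (hv : |v| ≤ κ)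
    (hκ : κ ≤ 1 / 100) :
    |(p * A + q * B + r * C) / (1 + v)| ≤ 2 * m * (p + r) * (1 + v) := by
  have hm : 0 ≤ m := (abs_nonneg _).trans hA
  have hq' : |q| ≤ (p + r) / 2 := by
    apply abs_le_of_sq_le_sq _ (by linarith)
    nlinarith [sq_nonneg (p - r)]
  have hv' := abs_le.1 hv
  have hv0 : 0 < 1 + v := by linarith
  rw [abs_div, abs_of_pos hv0, div_le_iff₀ hv0]
  have h1 : |p * A + q * B + r * C| ≤ p * m + (p + r) / 2 * m + r * m := by
    refine (abs_add_three _ _ _).trans ?_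
    rw [abs_mul, abs_mul, abs_mul, abs_of_pos hp, abs_of_pos hr]
    gcongr
  have h2 : 0 ≤ m * (p + r) := by positivity
  nlinarith [mul_nonneg h2 (show (0:ℝ) ≤ (1 + v) * (1 + v) - 3 / 4 by nlinarith)]

theorem abs_tension_le {p q r w κ u₁ u₂ u₃ u₄ u₅ v v₁ v₂ v₃ v₄ v₅ : ℝ} (hp : 0 < p) (hr : 0 < r)
    (hq : q ^ 2 ≤ p * r) (hw : 0 < w) (hκ : κ ≤ 1 / 100)
    (hu₁ : |u₁| ≤ κ) (hu₂ : |u₂| ≤ κ) (hu₃ : |u₃| ≤ κ) (hu₄ : |u₄| ≤ κ) (hu₅ : |u₅| ≤ κ)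
    (hv : |v| ≤ κ) (hv₁ : |v₁| ≤ κ) (hv₂ : |v₂| ≤ κ) (hv₃ : |v₃| ≤ κ) (hv₄ : |v₄| ≤ κ)
    (hv₅ : |v₅| ≤ κ) :
    |w * (r * u₃ - 2 * q * u₄ + p * u₅ - 2 * q * (1 + u₁) + (p - r) * u₂)
      - 2 * (w ^ 2 * (r * (1 + u₁) * v₁ - q * ((1 + u₁) * (1 + v₂) + u₂ * v₁)
        + p * u₂ * (1 + v₂))) / (w * (1 + v))| ≤ 40 * κ * (p + r) * (w * (1 + v)) ∧
    |w * (r * v₃ - 2 * q * v₄ + p * v₅ - 2 * q * v₁ + (p - r) * (1 + v₂))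
      - (w ^ 2 * (r * v₁ * v₁ - q * (v₁ * (1 + v₂) + (1 + v₂) * v₁) + p * (1 + v₂) * (1 + v₂))
        - w ^ 2 * (r * (1 + u₁) * (1 + u₁) - q * ((1 + u₁) * u₂ + u₂ * (1 + u₁)) + p * u₂ * u₂))
        / (w * (1 + v))| ≤ 40 * κ * (p + r) * (w * (1 + v)) := by
  have hκ1 : κ ≤ 1 := by linarith
  have hκ0 : 0 ≤ κ := (abs_nonneg _).trans hu₁
  have hv' := abs_le.1 hv
  have hv0 : 0 < 1 + v := by linarith
  have P := fun {a b : ℝ} (ha : |a| ≤ κ) (hb : |b| ≤ κ) => abs_le.1 (abs_mul_le_of_le_one ha hb hκ1)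
  have m1 := P hv hu₅
  have m2 := P hv hu₂
  have m3 := P hu₂ hv₂
  have m4 := P hv hu₃
  have m5 := P hu₁ hv₁
  have m6 := P hv hu₄
  have m7 := P hu₁ hv
  have m8 := P hu₁ hv₂
  have m9 := P hu₂ hv₁
  have m10 := P hv hv₅
  have m11 := P hv₂ hv
  have m12 := P hv₂ hv₂
  have m13 := P hu₂ hu₂
  have m14 := P hv hv₃
  have m15 := P hv₁ hv₁
  have m16 := P hu₁ hu₁
  have m17 := P hv hv₄
  have m18 := P hv hv₁
  have m19 := P hv₁ hv₂
  have m20 := P hu₁ hu₂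
  rw [abs_le] at hu₁ hu₂ hu₃ hu₄ hu₅ hv₁ hv₂ hv₃ hv₄ hv₅
  constructor
  · have key := abs_div_le_of_abs_le (A := (1 + v) * (u₅ + u₂) - 2 * u₂ * (1 + v₂))
      (B := -2 * (1 + v) * u₄ - 2 * ((1 + u₁) * (v - v₂) - u₂ * v₁))
      (C := (1 + v) * (u₃ - u₂) - 2 * (1 + u₁) * v₁) (m := 20 * κ) hp hr hq
      (by rw [abs_le]; constructor <;> linarith) (by rw [abs_le]; constructor <;> linarith)
      (by rw [abs_le]; constructor <;> linarith) hv hκ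
    have := mul_le_mul_of_nonneg_left key hw.le
    rw [← abs_of_pos hw, ← abs_mul, abs_of_pos hw] at this
    refine (le_of_eq ?_).trans (this.trans (le_of_eq (by ring)))
    congr 1
    field_simp
    ring
  · have key := abs_div_le_of_abs_le (A := (1 + v) * v₅ + (1 + v₂) * (v - v₂) + u₂ * u₂)
      (B := -2 * (1 + v) * (v₄ + v₁) + 2 * v₁ * (1 + v₂) - 2 * (1 + u₁) * u₂)
      (C := (1 + v) * v₃ - v₁ * v₁ + (1 + u₁) * (1 + u₁) - (1 + v) * (1 + v₂))
      (m := 20 * κ) hp hr hq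
      (by rw [abs_le]; constructor <;> linarith) (by rw [abs_le]; constructor <;> linarith)
      (by rw [abs_le]; constructor <;> linarith) hv hκ
    have := mul_le_mul_of_nonneg_left key hw.le
    rw [← abs_of_pos hw, ← abs_mul, abs_of_pos hw] at this
    refine (le_of_eq ?_).trans (this.trans (le_of_eq (by ring)))
    congr 1
    field_simp
    ring

/-- Real part of the comparison map. -/
def compU (f : ℝ → ℝ) : ℂ → ℝ := combDiv 0 1 (-2) 1 0 (primitive (primitive f))

/-- Imaginary part of the comparison map. -/
def compV (f : ℝ → ℝ) : ℂ → ℝ := combDiv (1 / 2) (-1) 0 1 (-1 / 2) (primitive (primitive f))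

namespace QSLine
variable {f : ℝ → ℝ} {ε : ℝ}

theorem c2_compU (h : QSLine f ε) : C2 (compU f) :=
  C2_combDiv (contDiff_primitive_primitive h.cont) _ _ _ _ _

theorem c2_compV (h : QSLine f ε) : C2 (compV f) :=
  C2_combDiv (contDiff_primitive_primitive h.cont) _ _ _ _ _

theorem taylor (h : QSLine f ε) (hε : 0 ≤ ε) (hε' : ε ≤ 1 / 2) (x : ℝ) {y : ℝ}
    (hy : 0 < y) {t : ℝ} (ht : |t| ≤ 2) :
    ∃ a b c : ℝ, |a| ≤ 5 * ε ∧ |b| ≤ 10 * ε ∧ |c| ≤ 20 * ε ∧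
      f (x + t * y) = f x + (f (x + y) - f x) * (t + a) ∧
      primitive f (x + t * y) = primitive f x + f x * t * y
        + (f (x + y) - f x) * y * (t ^ 2 / 2 + b) ∧
      primitive (primitive f) (x + t * y) = primitive (primitive f) x + primitive f x * t * y
        + f x * t ^ 2 * y ^ 2 / 2 + (f (x + y) - f x) * y ^ 2 * (t ^ 3 / 6 + c) := by
  have hw : 0 < f (x + y) - f x := sub_pos.2 (h.mono (by linarith))
  have h1 := h.affine hε hε' x hy ht
  have h2 := h.primitive_affine hε hε' x hy ht
  have h3 := h.primitive_primitive_affine hε hε' x hy ht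
  set w := f (x + y) - f x with hw'
  refine ⟨(f (x + t * y) - f x - t * w) / w, (primitive f (x + t * y) - primitive f x - f x * t * y
    - w * t ^ 2 * y / 2) / (w * y), (primitive (primitive f) (x + t * y) - primitive (primitive f) x
    - primitive f x * t * y - f x * t ^ 2 * y ^ 2 / 2 - w * t ^ 3 * y ^ 2 / 6) / (w * y ^ 2),
    ?_, ?_, ?_, ?_, ?_, ?_⟩
  · rw [abs_div, abs_of_pos hw, div_le_iff₀ hw]; linarith
  · rw [abs_div, abs_of_pos (show 0 < w * y by positivity), div_le_iff₀ (by positivity)]; linarith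
  · rw [abs_div, abs_of_pos (show 0 < w * y ^ 2 by positivity), div_le_iff₀ (by positivity)]
    linarith
  · field_simp; ring
  · field_simp; ring
  · field_simp; ring

/-- Normalized derivatives of the comparison map. -/
theorem comp_normalized (h : QSLine f ε) (hε : 0 ≤ ε) (hε' : ε ≤ 1 / 2) {z : ℂ} (hz : z ∈ Hset) :
    ∃ u u₁ u₂ u₃ u₄ u₅ v v₁ v₂ v₃ v₄ v₅ : ℝ,
      (|u| ≤ 1000 * ε ∧ |u₁| ≤ 1000 * ε ∧ |u₂| ≤ 1000 * ε ∧ |u₃| ≤ 1000 * ε ∧ |u₄| ≤ 1000 * ε ∧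
        |u₅| ≤ 1000 * ε) ∧
      (|v| ≤ 1000 * ε ∧ |v₁| ≤ 1000 * ε ∧ |v₂| ≤ 1000 * ε ∧ |v₃| ≤ 1000 * ε ∧ |v₄| ≤ 1000 * ε ∧
        |v₅| ≤ 1000 * ε) ∧
      (compU f z = f z.re + (f (z.re + z.im) - f z.re) * u ∧
        z.im * D 1 (compU f) z = (f (z.re + z.im) - f z.re) * (1 + u₁) ∧
        z.im * D Complex.I (compU f) z = (f (z.re + z.im) - f z.re) * u₂ ∧
        z.im ^ 2 * D 1 (D 1 (compU f)) z = (f (z.re + z.im) - f z.re) * u₃ ∧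
        z.im ^ 2 * D 1 (D Complex.I (compU f)) z = (f (z.re + z.im) - f z.re) * u₄ ∧
        z.im ^ 2 * D Complex.I (D Complex.I (compU f)) z = (f (z.re + z.im) - f z.re) * u₅) ∧
      (compV f z = (f (z.re + z.im) - f z.re) * (1 + v) ∧
        z.im * D 1 (compV f) z = (f (z.re + z.im) - f z.re) * v₁ ∧
        z.im * D Complex.I (compV f) z = (f (z.re + z.im) - f z.re) * (1 + v₂) ∧
        z.im ^ 2 * D 1 (D 1 (compV f)) z = (f (z.re + z.im) - f z.re) * v₃ ∧
        z.im ^ 2 * D 1 (D Complex.I (compV f)) z = (f (z.re + z.im) - f z.re) * v₄ ∧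
        z.im ^ 2 * D Complex.I (D Complex.I (compV f)) z = (f (z.re + z.im) - f z.re) * v₅) := by
  have hy : 0 < z.im := hz
  have hc := continuous_primitive h.cont
  have dU := D_combDiv (contDiff_primitive_primitive h.cont) (hasDerivAt_primitive hc)
    (hasDerivAt_primitive h.cont) 0 1 (-2) 1 0 hz
  have dV := D_combDiv (contDiff_primitive_primitive h.cont) (hasDerivAt_primitive hc)
    (hasDerivAt_primitive h.cont) (1 / 2) (-1) 0 1 (-1 / 2) hz
  obtain ⟨a₂, b₂, c₂, ha₂, hb₂, hc₂, A₂, B₂, C₂⟩ := h.taylor hε hε' z.re hy (t := 2) (by norm_num)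
  obtain ⟨a₁, b₁, c₁, ha₁, hb₁, hc₁, A₁, B₁, C₁⟩ := h.taylor hε hε' z.re hy (t := 1) (by norm_num)
  obtain ⟨a₃, b₃, c₃, ha₃, hb₃, hc₃, A₃, B₃, C₃⟩ := h.taylor hε hε' z.re hy (t := -1) (by norm_num)
  obtain ⟨a₄, b₄, c₄, ha₄, hb₄, hc₄, A₄, B₄, C₄⟩ := h.taylor hε hε' z.re hy (t := -2) (by norm_num)
  rw [one_mul] at A₁ B₁ C₁
  rw [neg_one_mul, ← sub_eq_add_neg] at A₃ B₃ C₃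
  rw [neg_mul, ← sub_eq_add_neg] at A₄ B₄ C₄
  simp only [comb, A₂, B₂, C₂, B₁, C₁, A₃, B₃, C₃, A₄, B₄, C₄] at dU dV
  change z.im * z.im * compU f z = _ ∧ z.im * z.im * D 1 (compU f) z = _ ∧
    z.im * z.im * D Complex.I (compU f) z + 2 * z.im * compU f z = _ ∧
    z.im * z.im * D 1 (D 1 (compU f)) z = _ ∧
    z.im * z.im * D 1 (D Complex.I (compU f)) z + 2 * z.im * D 1 (compU f) z = _ ∧
    z.im * z.im * D Complex.I (D Complex.I (compU f)) z + 4 * z.im * D Complex.I (compU f) z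
      + 2 * compU f z = _ at dU
  change z.im * z.im * compV f z = _ ∧ z.im * z.im * D 1 (compV f) z = _ ∧
    z.im * z.im * D Complex.I (compV f) z + 2 * z.im * compV f z = _ ∧
    z.im * z.im * D 1 (D 1 (compV f)) z = _ ∧
    z.im * z.im * D 1 (D Complex.I (compV f)) z + 2 * z.im * D 1 (compV f) z = _ ∧
    z.im * z.im * D Complex.I (D Complex.I (compV f)) z + 4 * z.im * D Complex.I (compV f) z
      + 2 * compV f z = _ at dV
  have hA₁ : f (z.re + z.im) = f z.re + (f (z.re + z.im) - f z.re) := by ring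
  set w := f (z.re + z.im) - f z.re with hw
  rw [hA₁] at dU dV
  obtain ⟨U0, U1, U2, U3, U4, U5⟩ := dU
  obtain ⟨V0, V1, V2, V3, V4, V5⟩ := dV
  have eU0 : compU f z = f z.re + w * (c₁ + c₃) :=
    mul_left_cancel₀ (mul_pos hy hy).ne' (by rw [U0]; ring)
  have eU1 : z.im * D 1 (compU f) z = w * (1 + (b₁ + b₃)) :=
    mul_left_cancel₀ hy.ne' (by rw [← mul_assoc, U1]; ring)
  have eU2 : z.im * D Complex.I (compU f) z = w * (b₁ - b₃ - 2 * (c₁ + c₃)) :=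
    mul_left_cancel₀ hy.ne' (by rw [eU0] at U2; linear_combination U2)
  have eU3 : z.im ^ 2 * D 1 (D 1 (compU f)) z = w * (a₃) := by linear_combination U3
  have eU4 : z.im ^ 2 * D 1 (D Complex.I (compU f)) z = w * (-a₃ - 2 * (b₁ + b₃)) := by
    linear_combination U4 - 2 * eU1
  have eU5 : z.im ^ 2 * D Complex.I (D Complex.I (compU f)) z
      = w * (a₃ - 4 * (b₁ - b₃ - 2 * (c₁ + c₃)) - 2 * (c₁ + c₃)) := by
    linear_combination U5 - 4 * eU2 - 2 * eU0
  have eV0 : compV f z = w * (1 + (c₂ / 2 - c₁ + c₃ - c₄ / 2)) :=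
    mul_left_cancel₀ (mul_pos hy hy).ne' (by rw [V0]; ring)
  have eV1 : z.im * D 1 (compV f) z = w * (b₂ / 2 - b₁ + b₃ - b₄ / 2) :=
    mul_left_cancel₀ hy.ne' (by rw [← mul_assoc, V1]; ring)
  have eV2 : z.im * D Complex.I (compV f) z
      = w * (1 + (b₂ - b₁ - b₃ + b₄ - 2 * (c₂ / 2 - c₁ + c₃ - c₄ / 2))) :=
    mul_left_cancel₀ hy.ne' (by rw [eV0] at V2; linear_combination V2)
  have eV3 : z.im ^ 2 * D 1 (D 1 (compV f)) z = w * (a₂ / 2 + a₃ - a₄ / 2) := by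
    linear_combination V3
  have eV4 : z.im ^ 2 * D 1 (D Complex.I (compV f)) z
      = w * (a₂ - a₃ + a₄ - 2 * (b₂ / 2 - b₁ + b₃ - b₄ / 2)) := by
    linear_combination V4 - 2 * eV1
  have eV5 : z.im ^ 2 * D Complex.I (D Complex.I (compV f)) z
      = w * (2 * a₂ + a₃ - 2 * a₄
        - 4 * (b₂ - b₁ - b₃ + b₄ - 2 * (c₂ / 2 - c₁ + c₃ - c₄ / 2))
        - 2 * (c₂ / 2 - c₁ + c₃ - c₄ / 2)) := by
    linear_combination V5 - 4 * eV2 - 2 * eV0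
  refine ⟨_, _, _, _, _, _, _, _, _, _, _, _, ?_, ?_, ⟨eU0, eU1, eU2, eU3, eU4, eU5⟩,
    ⟨eV0, eV1, eV2, eV3, eV4, eV5⟩⟩
  all_goals
    clear eU0 eU1 eU2 eU3 eU4 eU5 eV0 eV1 eV2 eV3 eV4 eV5 U0 U1 U2 U3 U4 U5 V0 V1 V2 V3 V4 V5
      A₁ B₁ C₁ A₂ B₂ C₂ A₃ B₃ C₃ A₄ B₄ C₄ hA₁
    simp only [abs_le] at *
    refine ⟨⟨?_, ?_⟩, ⟨?_, ?_⟩, ⟨?_, ?_⟩, ⟨?_, ?_⟩, ⟨?_, ?_⟩, ⟨?_, ?_⟩⟩ <;> linarith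

theorem compV_pos (h : QSLine f ε) (hε : 0 ≤ ε) (hε' : ε ≤ 1 / 100000) {z : ℂ} (hz : z ∈ Hset) :
    0 < compV f z := by
  have hw : 0 < f (z.re + z.im) - f z.re :=
    sub_pos.2 (h.mono (by linarith [show 0 < z.im from hz]))
  obtain ⟨u, u₁, u₂, u₃, u₄, u₅, v, v₁, v₂, v₃, v₄, v₅, -, hv, -, eV⟩ :=
    h.comp_normalized hε (by linarith) hz
  rw [eV.1]
  have := abs_le.1 hv.1
  apply mul_pos hw; linarith

theorem comp_close (h : QSLine f ε) (hε : 0 ≤ ε) (hε' : ε ≤ 1 / 100000) {z : ℂ} (hz : z ∈ Hset) :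
    |compU f z - f z.re| ≤ f (z.re + z.im) - f z.re ∧
    (f (z.re + z.im) - f z.re) / 2 ≤ compV f z ∧
    compV f z ≤ 2 * (f (z.re + z.im) - f z.re) := by
  have hw : 0 < f (z.re + z.im) - f z.re :=
    sub_pos.2 (h.mono (by linarith [show 0 < z.im from hz]))
  obtain ⟨u, u₁, u₂, u₃, u₄, u₅, v, v₁, v₂, v₃, v₄, v₅, ⟨hu, -⟩, ⟨hv, -⟩, ⟨eU, -⟩, ⟨eV, -⟩⟩ :=
    h.comp_normalized hε (by linarith) hz
  rw [eU, eV, add_sub_cancel_left, abs_mul, abs_of_pos hw]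
  have := abs_le.1 hv
  have h1 : |u| ≤ 1 := by linarith
  have h2 : 1 / 2 ≤ 1 + v := by linarith
  have h3 : 1 + v ≤ 2 := by linarith
  exact ⟨mul_le_of_le_one_right hw.le h1, by linarith [mul_le_mul_of_nonneg_left h2 hw.le],
    by linarith [mul_le_mul_of_nonneg_left h3 hw.le]⟩

theorem _root_.AdSPaper.sq_div_le_sq {a v ε : ℝ} (hε : 0 ≤ ε) (hv : 1 / 2 ≤ 1 + v)
    (ha : |a| ≤ 2000 * ε) : (a / (1 + v)) ^ 2 ≤ 16000000 * ε ^ 2 := by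
  have hvp : 0 < 1 + v := by linarith
  rw [show 16000000 * ε ^ 2 = (4000 * ε) ^ 2 by ring]
  have hεv : 2000 * ε ≤ 4000 * ε * (1 + v) := by nlinarith
  apply sq_le_sq'
  · rw [le_div_iff₀ hvp]; linarith [(abs_le.1 ha).1]
  · rw [div_le_iff₀ hvp]; linarith [(abs_le.1 ha).2]

set_option maxHeartbeats 1000000 in
theorem comparisonAt (h : QSLine f ε) (hε : 0 ≤ ε) (hε' : ε ≤ 1 / 100000) {p q r : ℂ → ℝ} {z : ℂ}
    (hz : z ∈ Hset) (hp : 0 < p z) (hr : 0 < r z) (hq : q z ^ 2 ≤ p z * r z) :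
    ComparisonAt p q r (compU f) (compV f) (40000 * ε) z := by
  have hy : 0 < z.im := hz
  have hw : 0 < f (z.re + z.im) - f z.re := sub_pos.2 (h.mono (by linarith))
  obtain ⟨u, u₁, u₂, u₃, u₄, u₅, v, v₁, v₂, v₃, v₄, v₅, ⟨hu, hu₁, hu₂, hu₃, hu₄, hu₅⟩,
    ⟨hv, hv₁, hv₂, hv₃, hv₄, hv₅⟩, ⟨eU0, eU1, eU2, eU3, eU4, eU5⟩,
    ⟨eV0, eV1, eV2, eV3, eV4, eV5⟩⟩ := h.comp_normalized hε (by linarith) hz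
  obtain ⟨t1, t2⟩ := abs_tension_le hp hr hq hw (by linarith) hu₁ hu₂ hu₃ hu₄ hu₅ hv hv₁ hv₂ hv₃
    hv₄ hv₅
  set w := f (z.re + z.im) - f z.re with hw'
  have hv' := abs_le.1 hv
  have hv0 : 1 / 2 ≤ 1 + v := by linarith
  have hvp : 0 < 1 + v := by linarith
  have small := fun a ha => sq_div_le_sq (a := a) hε hv0 ha
  refine ⟨?_, ?_, ?_⟩
  · rw [eU1, eU2, eV1, eV2, eV0]
    have e1 : w * (1 + u₁) / (w * (1 + v)) - 1 = (u₁ - v) / (1 + v) := by field_simp; ring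
    have e2 : w * u₂ / (w * (1 + v)) = u₂ / (1 + v) := by field_simp
    have e3 : w * v₁ / (w * (1 + v)) = v₁ / (1 + v) := by field_simp
    have e4 : w * (1 + v₂) / (w * (1 + v)) - 1 = (v₂ - v) / (1 + v) := by field_simp; ring
    rw [e1, e2, e3, e4]
    have s1 := small (u₁ - v) ((abs_sub _ _).trans (by linarith))
    have s2 := small u₂ (by linarith)
    have s3 := small v₁ (by linarith)
    have s4 := small (v₂ - v) ((abs_sub _ _).trans (by linarith))
    linarith [show 0 ≤ ε ^ 2 from sq_nonneg ε]
  · rw [eV0]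
    refine (le_of_eq ?_).trans (t1.trans (le_of_eq (by ring)))
    congr 1
    congr 1
    · unfold Lop
      linear_combination r z * eU3 - 2 * q z * eU4 + p z * eU5 - 2 * q z * eU1
        + (p z - r z) * eU2
    · congr 1
      have : Bf p q r (compU f) (compV f) z = r z * (z.im * D 1 (compU f) z)
          * (z.im * D 1 (compV f) z) - q z * ((z.im * D 1 (compU f) z)
          * (z.im * D Complex.I (compV f) z) + (z.im * D Complex.I (compU f) z)
          * (z.im * D 1 (compV f) z)) + p z * (z.im * D Complex.I (compU f) z)
          * (z.im * D Complex.I (compV f) z) := by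
        unfold Bf; ring
      rw [this, eU1, eU2, eV1, eV2]; ring
  · rw [eV0]
    refine (le_of_eq ?_).trans (t2.trans (le_of_eq (by ring)))
    congr 1
    congr 1
    · unfold Lop
      linear_combination r z * eV3 - 2 * q z * eV4 + p z * eV5 - 2 * q z * eV1
        + (p z - r z) * eV2
    · congr 1
      have : ∀ g : ℂ → ℝ, Bf p q r g g z = r z * (z.im * D 1 g z) * (z.im * D 1 g z)
          - q z * (2 * ((z.im * D 1 g z) * (z.im * D Complex.I g z)))
          + p z * (z.im * D Complex.I g z) * (z.im * D Complex.I g z) := by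
        intro g; unfold Bf; ring
      rw [this, this, eU1, eU2, eV1, eV2]; ring

end QSLine

/-! ### Quasigeodesics stay close to geodesics: an ordinary differential inequality -/

/-- Polar data of a curve in the half-plane: logarithmic radius `lr` and defect `ℓ`. -/
structure QuasiRay (lr lr' ℓ : ℝ → ℝ) (L : ℝ) : Prop where
  one_le : 1 ≤ L
  hasDeriv : ∀ s, HasDerivAt lr (lr' s) s
  deriv_le : ∀ s, |lr' s| ≤ L * exp (-ℓ s)
  lip : ∀ s t, |ℓ s - ℓ t| ≤ 2 * L * |s - t|
  quasi : ∀ s t, |s - t| ≤ L * (2 + ℓ s + ℓ t + |lr s - lr t|)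
  top : Tendsto lr atTop atTop
  bot : Tendsto lr atBot atBot

namespace QuasiRay
variable {lr lr' ℓ : ℝ → ℝ} {L : ℝ}

theorem reverse (h : QuasiRay lr lr' ℓ L) :
    QuasiRay (fun s => -lr (-s)) (fun s => lr' (-s)) (fun s => ℓ (-s)) L where
  one_le := h.one_le
  hasDeriv s := by
    exact ((h.hasDeriv (-s)).comp s (hasDerivAt_neg s)).neg.congr_deriv (by ring)
  deriv_le s := h.deriv_le (-s)
  lip s t := by
    have := h.lip (-s) (-t)
    rwa [show -s - -t = -(s - t) by ring, abs_neg] at this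
  quasi s t := by
    have := h.quasi (-s) (-t)
    rwa [show -s - -t = -(s - t) by ring, abs_neg, show lr (-s) - lr (-t) = -(-lr (-s) - -lr (-t))
      by ring, abs_neg] at this
  top := tendsto_neg_atBot_atTop.comp (h.bot.comp tendsto_neg_atTop_atBot)
  bot := tendsto_neg_atTop_atBot.comp (h.top.comp tendsto_neg_atBot_atTop)

theorem continuous (h : QuasiRay lr lr' ℓ L) : Continuous ℓ := by
  have hL := h.one_le
  have : LipschitzWith (2 * L).toNNReal ℓ := by
    apply LipschitzWith.of_dist_le_mul
    intro s t
    rw [Real.dist_eq, Real.dist_eq, Real.coe_toNNReal _ (by linarith)]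
    exact h.lip s t
  exact this.continuous

theorem lr_sub_le (h : QuasiRay lr lr' ℓ L) {a b : ℝ} (hab : a ≤ b)
    (hl : ∀ s ∈ Ioo a b, log (2 * L ^ 2) < ℓ s) : |lr b - lr a| ≤ (b - a) / (2 * L) := by
  have hL := h.one_le
  rcases hab.eq_or_lt with rfl | hab
  · simp
  obtain ⟨c, hc, e⟩ := exists_hasDerivAt_eq_slope lr lr' hab
    (fun s _ => (h.hasDeriv s).continuousAt.continuousWithinAt) (fun s _ => h.hasDeriv s)
  have h1 : |lr' c| ≤ 1 / (2 * L) := by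
    refine (h.deriv_le c).trans ?_
    have h2 : exp (-ℓ c) ≤ (2 * L ^ 2)⁻¹ := by
      rw [← Real.exp_log (show 0 < 2 * L ^ 2 by positivity), ← Real.exp_neg, Real.exp_le_exp]
      linarith [hl c hc]
    calc L * exp (-ℓ c) ≤ L * (2 * L ^ 2)⁻¹ := by gcongr
      _ = 1 / (2 * L) := by field_simp
  have h3 : lr b - lr a = lr' c * (b - a) := by
    rw [e]; field_simp [(sub_pos.2 hab).ne']
  rw [h3, abs_mul, abs_of_pos (sub_pos.2 hab)]
  calc |lr' c| * (b - a) ≤ 1 / (2 * L) * (b - a) :=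
        mul_le_mul_of_nonneg_right h1 (sub_pos.2 hab).le
    _ = (b - a) / (2 * L) := by ring

theorem exists_le_log (h : QuasiRay lr lr' ℓ L) (s₀ : ℝ) : ∃ s, s₀ ≤ s ∧ ℓ s ≤ log (2 * L ^ 2) := by
  by_contra! hcon
  have hL := h.one_le
  have hLp : 0 < L := by linarith
  have low : ∀ s, s₀ ≤ s → (s - s₀) / (2 * L) - 2 - ℓ s₀ ≤ ℓ s := by
    intro s hs
    have h1 := h.lr_sub_le hs (fun t ht => hcon t ht.1.le)
    have h2 := h.quasi s s₀
    rw [abs_of_nonneg (by linarith)] at h2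
    have h3 : L * |lr s - lr s₀| ≤ (s - s₀) / 2 := by
      calc L * |lr s - lr s₀| ≤ L * ((s - s₀) / (2 * L)) := by gcongr
        _ = (s - s₀) / 2 := by field_simp
    have h4 : (s - s₀) / 2 ≤ L * (2 + ℓ s + ℓ s₀) := by linarith
    have h5 : (s - s₀) / (2 * L) ≤ 2 + ℓ s + ℓ s₀ := by
      rw [div_le_iff₀ (by positivity)]; linarith
    linarith
  set A := exp (2 + ℓ s₀) with hA
  have anti : AntitoneOn (fun s => lr s + 2 * L ^ 2 * A * exp (-((s - s₀) / (2 * L)))) (Ici s₀) := by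
    have hd : ∀ s, HasDerivAt (fun s => lr s + 2 * L ^ 2 * A * exp (-((s - s₀) / (2 * L))))
        (lr' s - L * A * exp (-((s - s₀) / (2 * L)))) s := by
      intro s
      have h1 : HasDerivAt (fun s : ℝ => -((s - s₀) / (2 * L))) (-(1 / (2 * L))) s :=
        (((hasDerivAt_id s).sub_const s₀).div_const (2 * L)).neg
      refine ((h.hasDeriv s).add (h1.exp.const_mul (2 * L ^ 2 * A))).congr_deriv ?_
      field_simp
      ring
    apply antitoneOn_of_deriv_nonpos (convex_Ici _)
    · exact fun s _ => (hd s).continuousAt.continuousWithinAt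
    · exact fun s _ => (hd s).differentiableAt.differentiableWithinAt
    · intro s hs
      rw [interior_Ici] at hs
      rw [(hd s).deriv]
      have h1 := (le_abs_self _).trans (h.deriv_le s)
      have h2 : exp (-ℓ s) ≤ A * exp (-((s - s₀) / (2 * L))) := by
        rw [hA, ← Real.exp_add, Real.exp_le_exp]
        linarith [low s (le_of_lt hs)]
      nlinarith
  obtain ⟨s, hs, hs'⟩ := ((h.top.eventually_gt_atTop
    (lr s₀ + 2 * L ^ 2 * A)).and (eventually_ge_atTop s₀)).exists
  have := anti self_mem_Ici hs' hs'
  simp only [sub_self, zero_div, neg_zero, Real.exp_zero, mul_one] at this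
  have h2 : 0 < 2 * L ^ 2 * A * exp (-((s - s₀) / (2 * L))) := by positivity
  linarith

theorem exists_first (h : QuasiRay lr lr' ℓ L) (s₀ : ℝ) :
    ∃ s, s₀ ≤ s ∧ ℓ s ≤ log (2 * L ^ 2) ∧ ∀ t ∈ Ico s₀ s, log (2 * L ^ 2) < ℓ t := by
  set S := {s | s₀ ≤ s ∧ ℓ s ≤ log (2 * L ^ 2)} with hS
  have hne : S.Nonempty := h.exists_le_log s₀
  have hbd : BddBelow S := ⟨s₀, fun s hs => hs.1⟩
  have hcl : IsClosed S := isClosed_Ici.inter (isClosed_le h.continuous continuous_const)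
  have hm := hcl.csInf_mem hne hbd
  refine ⟨sInf S, hm.1, hm.2, fun t ht => ?_⟩
  by_contra! hc
  exact absurd (csInf_le hbd ⟨ht.1, hc⟩) (not_le.2 ht.2)

/-- The defect of a quasiray is bounded. -/
theorem defect_le (h : QuasiRay lr lr' ℓ L) (s₀ : ℝ) :
    ℓ s₀ ≤ log (2 * L ^ 2) + 4 * L ^ 2 * (2 + 2 * log (2 * L ^ 2)) := by
  have hL := h.one_le
  have hlog : 0 ≤ log (2 * L ^ 2) := Real.log_nonneg (by nlinarith)
  obtain ⟨b, hb, hlb, hb'⟩ := h.exists_first s₀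
  obtain ⟨a', ha, hla, ha'⟩ := h.reverse.exists_first (-s₀)
  set a := -a' with haa
  rw [show a' = -a by rw [haa, neg_neg]] at ha ha'
  have hl : ∀ s ∈ Ioo a b, log (2 * L ^ 2) < ℓ s := by
    intro s hs
    rcases le_total s₀ s with h1 | h1
    · exact hb' s ⟨h1, hs.2⟩
    · have := ha' (-s) ⟨by linarith, by linarith [hs.1]⟩
      rwa [neg_neg] at this
  have hab : a ≤ b := by linarith
  have h1 := h.lr_sub_le hab hl
  have h2 := h.quasi b a
  rw [abs_of_nonneg (by linarith)] at h2
  have h3 : L * |lr b - lr a| ≤ (b - a) / 2 := by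
    calc L * |lr b - lr a| ≤ L * ((b - a) / (2 * L)) := by gcongr
      _ = (b - a) / 2 := by field_simp
  have h4 : b - a ≤ 2 * L * (2 + 2 * log (2 * L ^ 2)) := by nlinarith
  have h5 := (le_abs_self _).trans (h.lip s₀ b)
  rw [abs_sub_comm, abs_of_nonneg (by linarith)] at h5
  have h6 : 2 * L * (b - s₀) ≤ 2 * L * (2 * L * (2 + 2 * log (2 * L ^ 2))) := by
    gcongr; linarith
  linarith

end QuasiRay

/-! ### Lipschitz maps of the hyperbolic plane -/

/-- A differentiable self-map of the half-plane which is `L`-Lipschitz for the hyperbolic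
metric. -/
structure HypLip (G : ℂ → ℂ) (L : ℝ) : Prop where
  diff : ∀ z ∈ Hset, DifferentiableAt ℝ G z
  maps : ∀ z ∈ Hset, G z ∈ Hset
  bound : ∀ z ∈ Hset, ∀ v, ‖fderiv ℝ G z v‖ * z.im ≤ L * ‖v‖ * (G z).im

/-- A curve of hyperbolic speed at most `c`. -/
structure HypCurve (γ γ' : ℝ → ℂ) (c : ℝ) : Prop where
  hasDeriv : ∀ t, HasDerivAt γ (γ' t) t
  mem : ∀ t, γ t ∈ Hset
  speed : ∀ t, ‖γ' t‖ ≤ c * (γ t).im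

theorem hypCurve_horizontal {w : ℂ} (hw : w ∈ Hset) :
    HypCurve (fun t : ℝ => w + t) (fun _ => 1) (1 / w.im) where
  hasDeriv t := by simpa using (Complex.ofRealCLM.hasDerivAt (x := t)).const_add w
  mem t := by simpa [Hset] using hw
  speed t := by
    have : 0 < w.im := hw
    simp [this.ne']

theorem hypCurve_vertical (x : ℝ) :
    HypCurve (fun s : ℝ => (x : ℂ) + (exp s : ℝ) * Complex.I)
      (fun s => (exp s : ℝ) * Complex.I) 1 where
  hasDeriv s := ((Real.hasDerivAt_exp s).ofReal_comp.mul_const Complex.I).const_add (x : ℂ)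
  mem s := by simpa [Hset, -Complex.ofReal_exp] using Real.exp_pos s
  speed s := by simp [-Complex.ofReal_exp]

theorem exp_vertical (z : ℂ) (hz : z ∈ Hset) :
    (z.re : ℂ) + (exp (log z.im) : ℝ) * Complex.I = z := by
  rw [Real.exp_log hz, Complex.re_add_im]

namespace HypLip
variable {G : ℂ → ℂ} {L : ℝ} {γ γ' : ℝ → ℂ} {c : ℝ}

theorem hasDerivAt_comp (h : HypLip G L) (hγ : HypCurve γ γ' c) (t : ℝ) :
    HasDerivAt (fun s => G (γ s)) (fderiv ℝ G (γ t) (γ' t)) t :=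
  (h.diff _ (hγ.mem t)).hasFDerivAt.comp_hasDerivAt t (hγ.hasDeriv t)

theorem speed_comp (h : HypLip G L) (hL : 0 ≤ L) (hγ : HypCurve γ γ' c) (t : ℝ) :
    ‖fderiv ℝ G (γ t) (γ' t)‖ ≤ L * c * (G (γ t)).im := by
  have h1 := h.bound _ (hγ.mem t) (γ' t)
  have h2 : 0 < (γ t).im := hγ.mem t
  have h3 : 0 < (G (γ t)).im := h.maps _ (hγ.mem t)
  have h4 : L * ‖γ' t‖ * (G (γ t)).im ≤ L * (c * (γ t).im) * (G (γ t)).im := by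
    have := hγ.speed t
    gcongr
  have h5 : ‖fderiv ℝ G (γ t) (γ' t)‖ * (γ t).im ≤ (L * c * (G (γ t)).im) * (γ t).im := by
    linarith
  exact le_of_mul_le_mul_right h5 h2

theorem comp_curve (h : HypLip G L) (hL : 0 ≤ L) (hγ : HypCurve γ γ' c) :
    HypCurve (fun t => G (γ t)) (fun t => fderiv ℝ G (γ t) (γ' t)) (L * c) where
  hasDeriv := h.hasDerivAt_comp hγ
  mem t := h.maps _ (hγ.mem t)
  speed := h.speed_comp hL hγ

end HypLip

namespace HypCurve
variable {γ γ' : ℝ → ℂ} {c : ℝ}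

theorem log_im_sub_le (h : HypCurve γ γ' c) (s t : ℝ) :
    |log (γ t).im - log (γ s).im| ≤ c * |t - s| := by
  have him : ∀ t, HasDerivAt (fun s => (γ s).im) (γ' t).im t := fun t =>
    (Complex.imCLM.hasFDerivAt (x := γ t)).comp_hasDerivAt t (h.hasDeriv t)
  have hd : ∀ t, HasDerivAt (fun s => log (γ s).im) ((γ' t).im / (γ t).im) t := fun t =>
    (him t).log (ne_of_gt (h.mem t))
  have := Convex.norm_image_sub_le_of_norm_hasDerivWithin_le (s := univ) (C := c) (x := s) (y := t)
    (fun u _ => (hd u).hasDerivWithinAt) (fun u _ => by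
      have h1 : 0 < (γ u).im := h.mem u
      rw [Real.norm_eq_abs, abs_div, abs_of_pos h1, div_le_iff₀ h1]
      exact (Complex.abs_im_le_norm _).trans (h.speed u)) convex_univ (mem_univ _) (mem_univ _)
  simpa [Real.norm_eq_abs] using this

theorem im_le (h : HypCurve γ γ' c) (s t : ℝ) :
    (γ t).im ≤ exp (c * |t - s|) * (γ s).im := by
  have h1 := (le_abs_self _).trans (h.log_im_sub_le s t)
  have h2 : 0 < (γ t).im := h.mem t
  have h3 : 0 < (γ s).im := h.mem s
  calc (γ t).im = exp (log (γ t).im) := (Real.exp_log h2).symm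
    _ ≤ exp (c * |t - s| + log (γ s).im) := Real.exp_le_exp.2 (by linarith)
    _ = _ := by rw [Real.exp_add, Real.exp_log h3]

theorem norm_sub_le (h : HypCurve γ γ' c) (hc : 0 ≤ c) (t : ℝ) :
    ‖γ t - γ 0‖ ≤ c * |t| * exp (c * |t|) * (γ 0).im := by
  have := Convex.norm_image_sub_le_of_norm_hasDerivWithin_le (s := uIcc 0 t)
    (C := c * exp (c * |t|) * (γ 0).im) (x := 0) (y := t)
    (fun u _ => (h.hasDeriv u).hasDerivWithinAt) (fun u hu => by
      have h1 : 0 < (γ 0).im := h.mem 0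
      have h2 := h.im_le 0 u
      have h3 : |u - 0| ≤ |t| := by
        have := abs_sub_left_of_mem_uIcc hu
        simpa using this
      calc ‖γ' u‖ ≤ c * (γ u).im := h.speed u
        _ ≤ c * (exp (c * |t|) * (γ 0).im) := by
          refine mul_le_mul_of_nonneg_left (h2.trans ?_) hc
          gcongr
        _ = _ := by ring) (convex_uIcc _ _) left_mem_uIcc right_mem_uIcc
  rw [sub_zero, Real.norm_eq_abs] at this
  linarith

end HypCurve

namespace HypLip
variable {G : ℂ → ℂ} {L : ℝ}

theorem log_im_horizontal (h : HypLip G L) (hL : 0 ≤ L) {w : ℂ} (hw : w ∈ Hset) (t : ℝ) :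
    |log (G (w + t)).im - log (G w).im| ≤ L * (|t| / w.im) := by
  have := (h.comp_curve hL (hypCurve_horizontal hw)).log_im_sub_le 0 t
  simp only [Complex.ofReal_zero, add_zero, sub_zero] at this
  refine this.trans (le_of_eq (by ring))

theorem im_horizontal (h : HypLip G L) (hL : 0 ≤ L) {w : ℂ} (hw : w ∈ Hset) (t : ℝ) :
    (G (w + t)).im ≤ exp (L * (|t| / w.im)) * (G w).im := by
  have := (h.comp_curve hL (hypCurve_horizontal hw)).im_le 0 t
  simp only [Complex.ofReal_zero, add_zero, sub_zero] at this
  refine this.trans (le_of_eq (by ring_nf))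

theorem norm_horizontal (h : HypLip G L) (hL : 0 ≤ L) {w : ℂ} (hw : w ∈ Hset) (t : ℝ) :
    ‖G (w + t) - G w‖ ≤ L * (|t| / w.im) * exp (L * (|t| / w.im)) * (G w).im := by
  have hw' : 0 < w.im := hw
  have := (h.comp_curve hL (hypCurve_horizontal hw)).norm_sub_le (by positivity) t
  simp only [Complex.ofReal_zero, add_zero] at this
  refine this.trans (le_of_eq (by ring_nf))

theorem log_im_vertical (h : HypLip G L) (hL : 0 ≤ L) {w w' : ℂ} (hw : w ∈ Hset) (hw' : w' ∈ Hset)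
    (hre : w.re = w'.re) : |log (G w).im - log (G w').im| ≤ L * |log w.im - log w'.im| := by
  have := (h.comp_curve hL (hypCurve_vertical w.re)).log_im_sub_le (log w'.im) (log w.im)
  simp only [exp_vertical w hw] at this
  rw [hre, exp_vertical w' hw', mul_one] at this
  exact this

/-- Comparison with the point of the vertical line over `a` at the same distance from `a`. -/
theorem log_im_polar (h : HypLip G L) (hL : 0 ≤ L) {w : ℂ} (hw : w ∈ Hset) (a : ℝ) :
    |log (G w).im - log (G (a + (‖w - a‖ : ℝ) * Complex.I)).im|
      ≤ L * (log ‖w - a‖ - log w.im + 1) := by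
  have hw' : 0 < w.im := hw
  have h1 : w.im ≤ ‖w - a‖ := by
    have := Complex.abs_im_le_norm (w - a)
    rw [Complex.sub_im, Complex.ofReal_im, sub_zero] at this
    exact (le_abs_self _).trans this
  have h2 : |w.re - a| ≤ ‖w - a‖ := by simpa using Complex.abs_re_le_norm (w - a)
  set ρ := ‖w - a‖
  have hρ : 0 < ρ := by linarith
  have m1 : (w.re : ℂ) + (ρ : ℝ) * Complex.I ∈ Hset := by simpa [Hset] using hρ
  have m2 : (a : ℂ) + (ρ : ℝ) * Complex.I ∈ Hset := by simpa [Hset] using hρ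
  have v := h.log_im_vertical hL hw m1 (by simp)
  have k := h.log_im_horizontal hL m2 (w.re - a)
  rw [show (a : ℂ) + (ρ : ℝ) * Complex.I + ((w.re - a : ℝ) : ℂ) = (w.re : ℂ) + (ρ : ℝ) * Complex.I by
    push_cast; ring] at k
  have e1 : ((w.re : ℂ) + (ρ : ℝ) * Complex.I).im = ρ := by simp
  have e2 : ((a : ℂ) + (ρ : ℝ) * Complex.I).im = ρ := by simp
  rw [e1] at v
  rw [e2] at k
  have e3 : |log w.im - log ρ| = log ρ - log w.im := by
    rw [abs_sub_comm, abs_of_nonneg]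
    linarith [Real.log_le_log hw' h1]
  rw [e3] at v
  have e4 : L * (|w.re - a| / ρ) ≤ L * 1 := by
    gcongr
    rw [div_le_one hρ]; exact h2
  refine (abs_sub_le _ (log (G ((w.re : ℂ) + (ρ : ℝ) * Complex.I)).im) _).trans ?_
  linarith

end HypLip

/-- The vertical line over `x`, parametrized by hyperbolic arc length. -/
def vert (x s : ℝ) : ℂ := (x : ℂ) + (exp s : ℝ) * Complex.I

theorem vert_re (x s : ℝ) : (vert x s).re = x := by simp [vert, -Complex.ofReal_exp]
theorem vert_im (x s : ℝ) : (vert x s).im = exp s := by simp [vert, -Complex.ofReal_exp]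
theorem vert_mem (x s : ℝ) : vert x s ∈ Hset := by
  show 0 < (vert x s).im
  rw [vert_im]; exact Real.exp_pos s
theorem vert_log {z : ℂ} (hz : z ∈ Hset) : vert z.re (log z.im) = z := exp_vertical z hz

/-- The image of a vertical line under a hyperbolic bilipschitz map, in polar coordinates. -/
theorem quasiRay_of_hypLip {G F : ℂ → ℂ} {L : ℝ} (hL : 1 ≤ L) (hG : HypLip G L) (hF : HypLip F L)
    (hFG : ∀ z ∈ Hset, F (G z) = z) {x a : ℝ}
    (h0 : Tendsto (fun s => G (vert x s)) atBot (𝓝 (a : ℂ)))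
    (hi : Tendsto (fun s => ‖G (vert x s)‖) atTop atTop) :
    ∃ lr', QuasiRay (fun s => log ‖G (vert x s) - a‖) lr'
      (fun s => log ‖G (vert x s) - a‖ - log (G (vert x s)).im) L := by
  have hL0 : 0 ≤ L := by linarith
  have hγ := hG.comp_curve hL0 (hypCurve_vertical x)
  rw [mul_one] at hγ
  change HypCurve (fun s => G (vert x s)) _ L at hγ
  set γ' : ℝ → ℂ := fun t => fderiv ℝ G ((x : ℂ) + (exp t : ℝ) * Complex.I)
    ((exp t : ℝ) * Complex.I) with hγ'
  have him : ∀ s, (G (vert x s)).im ≤ ‖G (vert x s) - a‖ := by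
    intro s
    have := Complex.abs_im_le_norm (G (vert x s) - a)
    rw [Complex.sub_im, Complex.ofReal_im, sub_zero] at this
    exact (le_abs_self _).trans this
  have hip : ∀ s, 0 < (G (vert x s)).im := fun s => hγ.mem s
  have hρ : ∀ s, 0 < ‖G (vert x s) - a‖ := fun s => (hip s).trans_le (him s)
  have hle : ∀ s, log (G (vert x s)).im ≤ log ‖G (vert x s) - a‖ := fun s =>
    Real.log_le_log (hip s) (him s)
  have hd : ∀ s, HasDerivAt (fun s => log ‖G (vert x s) - a‖)
      (inner ℝ (G (vert x s) - a) (γ' s) / ‖G (vert x s) - a‖ ^ 2) s := by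
    intro s
    have h1 := ((hγ.hasDeriv s).sub_const (a : ℂ)).norm_sq
    have h2 := (h1.log (by have := hρ s; positivity)).div_const 2
    have h3 : (fun s => log ‖G (vert x s) - a‖) = fun s => log (‖G (vert x s) - a‖ ^ 2) / 2 := by
      funext s; rw [Real.log_pow]; push_cast; ring
    rw [h3]
    refine h2.congr_deriv (by ring)
  have hdl : ∀ s, |inner ℝ (G (vert x s) - a) (γ' s) / ‖G (vert x s) - a‖ ^ 2|
      ≤ L * exp (-(log ‖G (vert x s) - a‖ - log (G (vert x s)).im)) := by
    intro s
    have h1 := abs_real_inner_le_norm (G (vert x s) - a) (γ' s)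
    have h2 := hγ.speed s
    have h3 := hρ s
    rw [neg_sub, Real.exp_sub, Real.exp_log (hip s), Real.exp_log h3, abs_div,
      abs_of_pos (show 0 < ‖G (vert x s) - a‖ ^ 2 by positivity), div_le_iff₀ (by positivity)]
    calc _ ≤ _ := h1
      _ ≤ ‖G (vert x s) - a‖ * (L * (G (vert x s)).im) := by gcongr
      _ = _ := by field_simp
  refine ⟨_, ⟨hL, hd, hdl, ?_, ?_, ?_, ?_⟩⟩
  · intro s t
    have h1 := hγ.log_im_sub_le t s
    have h2 := Convex.norm_image_sub_le_of_norm_hasDerivWithin_le (s := univ) (C := L) (x := t)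
      (y := s) (fun u _ => (hd u).hasDerivWithinAt) (fun u _ => by
        refine (hdl u).trans ?_
        have : exp (-(log ‖G (vert x u) - a‖ - log (G (vert x u)).im)) ≤ 1 :=
          Real.exp_le_one_iff.2 (by linarith [hle u])
        nlinarith) convex_univ (mem_univ _) (mem_univ _)
    rw [Real.norm_eq_abs, Real.norm_eq_abs] at h2
    rw [abs_le] at h1 h2 ⊢
    constructor <;> linarith [h1.1, h1.2, h2.1, h2.2]
  · intro s t
    have p1 := hF.log_im_polar hL0 (hγ.mem s) a
    have p2 := hF.log_im_polar hL0 (hγ.mem t) a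
    have m : ∀ s, (a : ℂ) + (‖G (vert x s) - a‖ : ℝ) * Complex.I ∈ Hset := fun s => by
      simpa [Hset] using norm_pos_iff.1 (hρ s)
    have p3 := hF.log_im_vertical hL0 (m s) (m t) (by simp)
    have e : ∀ s, ((a : ℂ) + (‖G (vert x s) - a‖ : ℝ) * Complex.I).im = ‖G (vert x s) - a‖ := by
      intro s; simp
    rw [e, e] at p3
    simp only [hFG _ (vert_mem x _), vert_im, Real.log_exp] at p1 p2
    have h1 : |s - t| ≤ L * (log ‖G (vert x s) - a‖ - log (G (vert x s)).im + 1)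
        + L * |log ‖G (vert x s) - a‖ - log ‖G (vert x t) - a‖|
        + L * (log ‖G (vert x t) - a‖ - log (G (vert x t)).im + 1) := by
      rw [abs_le] at p1 p2 p3 ⊢
      constructor <;> linarith [p1.1, p1.2, p2.1, p2.2, p3.1, p3.2]
    linarith
  · apply Real.tendsto_log_atTop.comp
    refine tendsto_atTop_mono (fun s => ?_) (tendsto_atTop_add_const_right _ (-‖(a : ℂ)‖) hi)
    have := norm_sub_norm_le (G (vert x s)) (a : ℂ)
    linarith
  · have h1 : Tendsto (fun s => ‖G (vert x s) - a‖) atBot (𝓝[≠] 0) := by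
      rw [tendsto_nhdsWithin_iff]
      refine ⟨?_, Eventually.of_forall fun s => (hρ s).ne'⟩
      have := (h0.sub_const (a : ℂ)).norm
      simpa using this
    exact Real.tendsto_log_nhdsNE_zero.comp h1

/-- The constant controlling the distance of a quasigeodesic to a geodesic. -/
def rayConst (L : ℝ) : ℝ := exp (log (2 * L ^ 2) + 4 * L ^ 2 * (2 + 2 * log (2 * L ^ 2)))

theorem norm_sub_le_rayConst {G F : ℂ → ℂ} {L : ℝ} (hL : 1 ≤ L) (hG : HypLip G L)
    (hF : HypLip F L) (hFG : ∀ z ∈ Hset, F (G z) = z) {f : ℝ → ℝ}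
    (h0 : ∀ x, Tendsto (fun s => G (vert x s)) atBot (𝓝 (f x : ℂ)))
    (hi : ∀ x, Tendsto (fun s => ‖G (vert x s)‖) atTop atTop) {z : ℂ} (hz : z ∈ Hset) :
    ‖G z - f z.re‖ ≤ rayConst L * (G z).im := by
  obtain ⟨lr', hQ⟩ := quasiRay_of_hypLip hL hG hF hFG (h0 z.re) (hi z.re)
  have h1 := hQ.defect_le (log z.im)
  rw [vert_log hz] at h1
  have hip : 0 < (G z).im := hG.maps z hz
  have hρ : 0 < ‖G z - f z.re‖ := by
    have := Complex.abs_im_le_norm (G z - f z.re)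
    rw [Complex.sub_im, Complex.ofReal_im, sub_zero] at this
    exact hip.trans_le ((le_abs_self _).trans this)
  have h2 := Real.exp_le_exp.2 h1
  rwa [Real.exp_sub, Real.exp_log hρ, Real.exp_log hip, div_le_iff₀ hip] at h2

/-- A hyperbolic bilipschitz diffeomorphism extending a map of the line fixing infinity. -/
structure BilipExt (G F : ℂ → ℂ) (f : ℝ → ℝ) (L : ℝ) : Prop where
  one_le : 1 ≤ L
  lip : HypLip G L
  lip_inv : HypLip F L
  left_inv : ∀ z ∈ Hset, F (G z) = z
  bdry : ∀ x, Tendsto (fun s => G (vert x s)) atBot (𝓝 (f x : ℂ))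
  bdry_top : ∀ x, Tendsto (fun s => ‖G (vert x s)‖) atTop atTop

namespace BilipExt
variable {G F : ℂ → ℂ} {f : ℝ → ℝ} {L ε : ℝ}

theorem norm_sub_le (h : BilipExt G F f L) {z : ℂ} (hz : z ∈ Hset) :
    ‖G z - f z.re‖ ≤ rayConst L * (G z).im :=
  norm_sub_le_rayConst h.one_le h.lip h.lip_inv h.left_inv h.bdry h.bdry_top hz

theorem rayConst_pos (L : ℝ) : 0 < rayConst L := Real.exp_pos _

theorem increment_le (h : BilipExt G F f L) {z : ℂ} (hz : z ∈ Hset) :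
    f (z.re + z.im) - f z.re
      ≤ (rayConst L * exp L + L * exp L + rayConst L) * (G z).im := by
  have hL0 : 0 ≤ L := by linarith [h.one_le]
  have hy : 0 < z.im := hz
  have hw : z + (z.im : ℝ) ∈ Hset := by simpa [Hset] using hy
  have h1 := h.norm_sub_le hz
  have h2 := h.norm_sub_le hw
  have h3 := h.lip.norm_horizontal hL0 hz z.im
  have h4 := h.lip.im_horizontal hL0 hz z.im
  rw [abs_of_pos hy, div_self hy.ne', mul_one] at h3 h4
  rw [show (z + (z.im : ℝ) : ℂ).re = z.re + z.im by simp] at h2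
  have h5 : f (z.re + z.im) - f z.re ≤ ‖((f (z.re + z.im) : ℂ) - f z.re)‖ := by
    rw [← Complex.ofReal_sub, Complex.norm_real]; exact le_abs_self _
  have h6 : ‖((f (z.re + z.im) : ℂ) - f z.re)‖ ≤ ‖G (z + (z.im : ℝ)) - f (z.re + z.im)‖
      + ‖G (z + (z.im : ℝ)) - G z‖ + ‖G z - f z.re‖ := by
    rw [← norm_neg (G (z + (z.im : ℝ)) - f (z.re + z.im))]
    refine le_trans (le_of_eq ?_) (norm_add₃_le)
    congr 1; ring
  have h7 : rayConst L * (G (z + (z.im : ℝ))).im ≤ rayConst L * (exp L * (G z).im) :=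
    mul_le_mul_of_nonneg_left h4 (rayConst_pos L).le
  linarith

theorem exists_same_height (h : BilipExt G F f L) (x : ℝ) {c : ℝ} (hc : 0 < c) :
    ∃ s, (G (vert x s)).im = c := by
  have hcont : Continuous fun s => (G (vert x s)).im := by
    refine Complex.continuous_im.comp (continuous_iff_continuousAt.2 fun s => ?_)
    exact ((h.lip.comp_curve (by linarith [h.one_le]) (hypCurve_vertical x)).hasDeriv s).continuousAt
  apply mem_range_of_exists_le_of_exists_ge hcont
  · have h1 : Tendsto (fun s => (G (vert x s)).im) atBot (𝓝 0) := by
      have := (Complex.continuous_im.tendsto _).comp (h.bdry x)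
      rw [Complex.ofReal_im] at this
      exact this
    obtain ⟨s, hs⟩ := (h1.eventually_lt_const hc).exists
    exact ⟨s, hs.le⟩
  · obtain ⟨s, hs⟩ := ((h.bdry_top x).eventually_ge_atTop
      (rayConst L * c + ‖(f x : ℂ)‖)).exists
    refine ⟨s, ?_⟩
    have h1 := h.norm_sub_le (vert_mem x s)
    rw [vert_re] at h1
    have h2 := norm_sub_norm_le (G (vert x s)) (f x : ℂ)
    exact le_of_mul_le_mul_left (by linarith) (rayConst_pos L)

theorem im_lt_increment (h : BilipExt G F f L) {z : ℂ} (hz : z ∈ Hset) {N : ℝ}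
    (hmono : StrictMono f) (hN0 : 0 < N)
    (hN : L * (2 * rayConst L + 1) * exp (L * (2 * rayConst L + 1)) < N) :
    (G z).im < f (z.re + N * z.im) - f z.re := by
  by_contra! hcon
  have hL0 : 0 ≤ L := by linarith [h.one_le]
  have hy : 0 < z.im := hz
  have hY : 0 < (G z).im := h.lip.maps z hz
  obtain ⟨s, hs⟩ := h.exists_same_height (z.re + N * z.im) hY
  set z' := vert (z.re + N * z.im) s with hz'
  have hm : z' ∈ Hset := vert_mem _ _
  have h1 := h.norm_sub_le hz
  have h2 := h.norm_sub_le hm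
  rw [show z'.re = z.re + N * z.im from vert_re _ _, hs] at h2
  have hpos : 0 < f (z.re + N * z.im) - f z.re := sub_pos.2 (hmono (by nlinarith))
  set t := (G z').re - (G z).re with ht
  have e : G z' = G z + (t : ℝ) := by
    apply Complex.ext
    · simp [ht]
    · simp [hs]
  have htb : |t| / (G z).im ≤ 2 * rayConst L + 1 := by
    rw [div_le_iff₀ hY]
    have h3 : ((t : ℝ) : ℂ) = (G z' - f (z.re + N * z.im)) + (f (z.re + N * z.im) - f z.re : ℝ)
        - (G z - f z.re) := by
      have : ((t : ℝ) : ℂ) = G z' - G z := by rw [e]; ring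
      rw [this]; push_cast; ring
    have h4 : |t| = ‖((t : ℝ) : ℂ)‖ := by rw [Complex.norm_real, Real.norm_eq_abs]
    rw [h4, h3]
    refine (_root_.norm_sub_le _ _).trans ?_
    have h5 := norm_add_le (G z' - f (z.re + N * z.im)) ((f (z.re + N * z.im) - f z.re : ℝ) : ℂ)
    rw [Complex.norm_real, Real.norm_eq_abs, abs_of_pos hpos] at h5
    linarith
  have h6 := h.lip_inv.norm_horizontal hL0 (h.lip.maps z hz) t
  rw [← e, h.left_inv z hz, h.left_inv z' hm] at h6
  have hRp := rayConst_pos L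
  have h7 : L * (|t| / (G z).im) * exp (L * (|t| / (G z).im)) * z.im
      ≤ L * (2 * rayConst L + 1) * exp (L * (2 * rayConst L + 1)) * z.im := by
    gcongr
  have h8 : N * z.im ≤ ‖z' - z‖ := by
    have := Complex.abs_re_le_norm (z' - z)
    rw [Complex.sub_re, show z'.re = z.re + N * z.im from vert_re _ _] at this
    exact (le_abs_self _).trans (le_trans (le_of_eq (by ring_nf)) this)
  have h9 : L * (2 * rayConst L + 1) * exp (L * (2 * rayConst L + 1)) * z.im < N * z.im :=
    mul_lt_mul_of_pos_right hN hy
  linarith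

theorem _root_.AdSPaper.QSLine.doubling (h : QSLine f ε) (hε : ε ≤ 1) (x : ℝ) {y : ℝ} (hy : 0 < y)
    (n : ℕ) : f (x + 2 ^ n * y) - f x ≤ 3 ^ n * (f (x + y) - f x) := by
  induction n with
  | zero => simp
  | succ n ih =>
    have hp : 0 < 2 ^ n * y := by positivity
    have h1 := h.right_le (x + 2 ^ n * y) (2 ^ n * y) hp
    rw [show x + 2 ^ n * y + 2 ^ n * y = x + 2 ^ (n + 1) * y by ring, add_sub_cancel_right] at h1
    have h2 : 0 < f (x + 2 ^ n * y) - f x := sub_pos.2 (h.mono (by linarith))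
    have h3 : (3 : ℝ) ^ (n + 1) = 3 * 3 ^ n := by ring
    rw [h3]
    nlinarith

/-- The extension stays at bounded distance from the comparison map. -/
theorem exists_coshDist_le (h : BilipExt G F f L) (hf : QSLine f ε) (hε : 0 ≤ ε)
    (hε' : ε ≤ 1 / 100000) : ∃ K, ∀ z ∈ Hset,
      coshDist (fun z => (G z).re) (fun z => (G z).im) (compU f) (compV f) z ≤ K := by
  obtain ⟨n, hn⟩ := pow_unbounded_of_one_lt
    (L * (2 * rayConst L + 1) * exp (L * (2 * rayConst L + 1))) (show (1 : ℝ) < 2 by norm_num)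
  set A := rayConst L * exp L + L * exp L + rayConst L with hA
  have hR := rayConst_pos L
  have hL := h.one_le
  have hA0 : 0 < A := by positivity
  set B : ℝ := 3 ^ n with hB
  have hB0 : 0 < B := by positivity
  refine ⟨((rayConst L * B + 1) ^ 2 + B ^ 2 + 4) * A, fun z hz => ?_⟩
  have hY : 0 < (G z).im := h.lip.maps z hz
  have h1 := h.increment_le hz
  have h2 := (h.im_lt_increment hz hf.mono (by positivity) hn).trans_le
    (hf.doubling (by linarith) z.re hz n)
  have h3 := h.norm_sub_le hz
  obtain ⟨c1, c2, c3⟩ := hf.comp_close hε hε' hz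
  have hw : 0 < f (z.re + z.im) - f z.re :=
    sub_pos.2 (hf.mono (by linarith [show 0 < z.im from hz]))
  have h4 : |(G z).re - f z.re| ≤ rayConst L * (G z).im := by
    have := Complex.abs_re_le_norm (G z - f z.re)
    simp only [Complex.sub_re, Complex.ofReal_re] at this
    exact this.trans h3
  set w := f (z.re + z.im) - f z.re
  rw [← hA] at h1
  rw [← hB] at h2
  have h5 : rayConst L * (G z).im ≤ rayConst L * (B * w) := mul_le_mul_of_nonneg_left h2.le hR.le
  have h6 : |(G z).re - compU f z| ≤ (rayConst L * B + 1) * w := by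
    have := abs_sub_le (G z).re (f z.re) (compU f z)
    rw [abs_sub_comm (f z.re)] at this
    linarith
  have h7 : ((G z).re - compU f z) ^ 2 ≤ ((rayConst L * B + 1) * w) ^ 2 := sq_le_sq.2 (by
    rwa [abs_of_pos (show 0 < (rayConst L * B + 1) * w by positivity)])
  have hV : 0 < compV f z := by linarith
  unfold coshDist
  rw [div_le_iff₀ (by positivity)]
  have h8 : (G z).im ^ 2 ≤ (B * w) ^ 2 := by gcongr
  have h9 : compV f z ^ 2 ≤ (2 * w) ^ 2 := by gcongr
  have h10 : w ^ 2 ≤ A * (2 * ((G z).im * compV f z)) := by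
    have : w * w ≤ (A * (G z).im) * (2 * compV f z) := by
      apply mul_le_mul h1 (by linarith) hw.le (by positivity)
    linarith
  have h11 : 0 ≤ (rayConst L * B + 1) ^ 2 + B ^ 2 + 4 := by positivity
  have h12 := mul_le_mul_of_nonneg_left h10 h11
  nlinarith

end BilipExt

/-! ### Pointwise dilatation of a minimal Lagrangian map -/

theorem quadForm_nonneg {A Q B a b : ℝ} (hA : 0 ≤ A) (hB : 0 ≤ B) (h : Q ^ 2 ≤ A * B) :
    0 ≤ A * a ^ 2 + 2 * Q * a * b + B * b ^ 2 := by
  rcases hA.eq_or_lt with rfl | hA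
  · have : Q = 0 := by nlinarith [sq_nonneg Q]
    subst this; nlinarith [sq_nonneg b]
  · have : A * (A * a ^ 2 + 2 * Q * a * b + B * b ^ 2)
        = (A * a + Q * b) ^ 2 + (A * B - Q ^ 2) * b ^ 2 := by ring
    have h2 : 0 ≤ A * (A * a ^ 2 + 2 * Q * a * b + B * b ^ 2) := by
      rw [this]; have := sub_nonneg.2 h; positivity
    exact nonneg_of_mul_nonneg_right h2 hA

theorem quadForm_le {P Q R s a b : ℝ} (h : P * R - Q ^ 2 = 1) (hs : 1 ≤ s)
    (hPR : s * (P + R) ≤ s ^ 2 + 1) :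
    P * a ^ 2 + 2 * Q * a * b + R * b ^ 2 ≤ s * (a ^ 2 + b ^ 2) := by
  have hm : Q ^ 2 ≤ (s - P) * (s - R) := by nlinarith
  have hsum : 0 ≤ (s - P) + (s - R) := by
    have : P + R ≤ 2 * s := by nlinarith
    linarith
  have h1 : 0 ≤ s - P := by nlinarith [sq_nonneg Q]
  have h2 : 0 ≤ s - R := by nlinarith [sq_nonneg Q]
  have := quadForm_nonneg (Q := -Q) (a := a) (b := b) h1 h2 (by nlinarith)
  nlinarith

theorem le_quadForm {P Q R s a b : ℝ} (hP : 0 ≤ P) (hR : 0 ≤ R) (h : P * R - Q ^ 2 = 1)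
    (hs : 1 ≤ s) (hPR : s * (P + R) ≤ s ^ 2 + 1) :
    a ^ 2 + b ^ 2 ≤ s * (P * a ^ 2 + 2 * Q * a * b + R * b ^ 2) := by
  have h2 : 2 ≤ P + R := by nlinarith [sq_nonneg (P - R), sq_nonneg Q]
  have hm : (s * Q) ^ 2 ≤ (s * P - 1) * (s * R - 1) := by nlinarith
  have hsum : 0 ≤ (s * P - 1) + (s * R - 1) := by nlinarith
  have h3 : 0 ≤ s * P - 1 := by nlinarith [sq_nonneg (s * Q)]
  have h4 : 0 ≤ s * R - 1 := by nlinarith [sq_nonneg (s * Q)]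
  have := quadForm_nonneg (a := a) (b := b) h3 h4 hm
  nlinarith

namespace MinLagData
variable {p q r : ℂ → ℝ} {Φ : ℂ → ℂ}

/-- The pull-back metric in terms of the symmetric field. -/
theorem norm_fderiv_sq
    (h : MinLagData p q r (fun z => (Φ z).re) (fun z => (Φ z).im)) {z : ℂ} (hz : z ∈ Hset)
    (hd : DifferentiableAt ℝ Φ z) (v : ℂ) :
    ‖fderiv ℝ Φ z v‖ ^ 2 * z.im ^ 2 = (Φ z).im ^ 2 *
      ((p z ^ 2 + q z ^ 2) * v.re ^ 2 + 2 * (q z * (p z + r z)) * v.re * v.im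
        + (q z ^ 2 + r z ^ 2) * v.im ^ 2) := by
  have hX : ∀ w, D w (fun z => (Φ z).re) z = (fderiv ℝ Φ z w).re := fun w => by
    have := (Complex.reCLM.hasFDerivAt (x := Φ z)).comp z hd.hasFDerivAt
    have e := this.fderiv
    unfold D
    have : (fun z => (Φ z).re) = ⇑Complex.reCLM ∘ Φ := rfl
    rw [this, e]; rfl
  have hY : ∀ w, D w (fun z => (Φ z).im) z = (fderiv ℝ Φ z w).im := fun w => by
    have := (Complex.imCLM.hasFDerivAt (x := Φ z)).comp z hd.hasFDerivAt
    have e := this.fderiv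
    unfold D
    have : (fun z => (Φ z).im) = ⇑Complex.imCLM ∘ Φ := rfl
    rw [this, e]; rfl
  have h1 := h.met₁₁ z hz
  have h2 := h.met₁₂ z hz
  have h3 := h.met₂₂ z hz
  rw [hX, hY] at h1
  rw [hX, hX, hY, hY] at h2
  rw [hX, hY] at h3
  have hv : fderiv ℝ Φ z v = v.re • fderiv ℝ Φ z 1 + v.im • fderiv ℝ Φ z Complex.I := by
    rw [← map_smul, ← map_smul, ← map_add]
    congr 1
    apply Complex.ext <;> simp
  rw [Complex.sq_norm, Complex.normSq_apply, hv]
  simp only [Complex.add_re, Complex.add_im, Complex.real_smul, Complex.re_ofReal_mul,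
    Complex.im_ofReal_mul]
  linear_combination v.re ^ 2 * h1 + 2 * v.re * v.im * h2 + v.im ^ 2 * h3

end MinLagData

theorem bddAbove_unit (A : ℂ →L[ℝ] ℂ) :
    BddAbove (range fun v : {v : ℂ // ‖v‖ = 1} => ‖A (v : ℂ)‖) := by
  refine ⟨‖A‖, ?_⟩
  rintro _ ⟨v, rfl⟩
  simpa [v.2] using A.le_opNorm (v : ℂ)

theorem bddBelow_unit (A : ℂ →L[ℝ] ℂ) :
    BddBelow (range fun v : {v : ℂ // ‖v‖ = 1} => ‖A (v : ℂ)‖) := by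
  refine ⟨0, ?_⟩
  rintro _ ⟨v, rfl⟩
  exact norm_nonneg _

instance : Nonempty {v : ℂ // ‖v‖ = 1} := ⟨⟨1, by simp⟩⟩

theorem dilatationAt_nonneg (Φ : ℂ → ℂ) (z : ℂ) : 0 ≤ dilatationAt Φ z :=
  div_nonneg (Real.iSup_nonneg fun _ => norm_nonneg _) (Real.iInf_nonneg fun _ => norm_nonneg _)

theorem dilatationAt_le {Φ : ℂ → ℂ} {z : ℂ} {m M : ℝ} (hm : 0 < m)
    (h : ∀ v : ℂ, ‖v‖ = 1 → m ≤ ‖fderiv ℝ Φ z v‖ ∧ ‖fderiv ℝ Φ z v‖ ≤ M) :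
    dilatationAt Φ z ≤ M / m := by
  unfold dilatationAt
  have h1 : (⨆ v : {v : ℂ // ‖v‖ = 1}, ‖fderiv ℝ Φ z (v : ℂ)‖) ≤ M := ciSup_le fun v => (h v v.2).2
  have h2 : m ≤ ⨅ v : {v : ℂ // ‖v‖ = 1}, ‖fderiv ℝ Φ z (v : ℂ)‖ := le_ciInf fun v => (h v v.2).1
  have h3 : 0 ≤ M := (norm_nonneg _).trans (h 1 (by simp)).2
  gcongr

theorem mul_le_of_dilatationAt_le {Φ : ℂ → ℂ} {z v w : ℂ} {m K : ℝ} (hm : 0 < m)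
    (hlow : ∀ v : ℂ, ‖v‖ = 1 → m ≤ ‖fderiv ℝ Φ z v‖) (hK : dilatationAt Φ z ≤ K)
    (hv : ‖v‖ = 1) (hw : w ≠ 0) :
    ‖fderiv ℝ Φ z v‖ * ‖w‖ ≤ K * ‖fderiv ℝ Φ z w‖ := by
  have hwn : 0 < ‖w‖ := norm_pos_iff.2 hw
  have h2 : m ≤ ⨅ v : {v : ℂ // ‖v‖ = 1}, ‖fderiv ℝ Φ z (v : ℂ)‖ := le_ciInf fun v => hlow v v.2
  have hsup := le_ciSup (bddAbove_unit (fderiv ℝ Φ z)) ⟨v, hv⟩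
  have hw1 : ‖((‖w‖⁻¹ : ℝ) • w)‖ = 1 := by
    rw [norm_smul, norm_inv, norm_norm, inv_mul_cancel₀ hwn.ne']
  have hinf := ciInf_le (bddBelow_unit (fderiv ℝ Φ z)) ⟨(‖w‖⁻¹ : ℝ) • w, hw1⟩
  simp only at hsup hinf
  rw [map_smul, norm_smul, norm_inv, norm_norm] at hinf
  have hK0 : 0 ≤ K := (dilatationAt_nonneg Φ z).trans hK
  unfold dilatationAt at hK
  rw [div_le_iff₀ (hm.trans_le h2)] at hK
  have h4 : ‖fderiv ℝ Φ z v‖ ≤ K * (‖w‖⁻¹ * ‖fderiv ℝ Φ z w‖) :=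
    hsup.trans (hK.trans (mul_le_mul_of_nonneg_left hinf hK0))
  calc ‖fderiv ℝ Φ z v‖ * ‖w‖ ≤ K * (‖w‖⁻¹ * ‖fderiv ℝ Φ z w‖) * ‖w‖ := by gcongr
    _ = K * ‖fderiv ℝ Φ z w‖ := by field_simp

namespace MinLagData
variable {p q r : ℂ → ℝ} {Φ : ℂ → ℂ}

theorem quadForm_det (h : MinLagData p q r (fun z => (Φ z).re) (fun z => (Φ z).im)) {z : ℂ}
    (hz : z ∈ Hset) :
    (p z ^ 2 + q z ^ 2) * (q z ^ 2 + r z ^ 2) - (q z * (p z + r z)) ^ 2 = 1 := by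
  have := h.det z hz
  linear_combination (p z * r z - q z ^ 2 + 1) * this

theorem trace_sq (h : MinLagData p q r (fun z => (Φ z).re) (fun z => (Φ z).im)) {z : ℂ}
    (hz : z ∈ Hset) :
    (p z ^ 2 + q z ^ 2) + (q z ^ 2 + r z ^ 2) = (p z + r z) ^ 2 - 2 := by
  have := h.det z hz
  linear_combination -2 * this

/-- Upper and lower bounds for the differential. -/
theorem fderiv_bounds (h : MinLagData p q r (fun z => (Φ z).re) (fun z => (Φ z).im)) {z : ℂ}
    (hz : z ∈ Hset) (hd : DifferentiableAt ℝ Φ z) {k : ℝ} (hk : 1 ≤ k)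
    (hτ : k * (p z + r z) ≤ k ^ 2 + 1) (v : ℂ) :
    ‖fderiv ℝ Φ z v‖ * z.im ≤ k * ‖v‖ * (Φ z).im ∧
    ‖v‖ * (Φ z).im ≤ k * ‖fderiv ℝ Φ z v‖ * z.im := by
  have hy : 0 < z.im := hz
  have hY : 0 < (Φ z).im := h.Ypos z hz
  have hN := h.norm_fderiv_sq hz hd v
  have hdet := h.quadForm_det hz
  have htr := h.trace_sq hz
  have ht := h.trace_ge hz
  have hs : k ^ 2 * ((p z ^ 2 + q z ^ 2) + (q z ^ 2 + r z ^ 2)) ≤ (k ^ 2) ^ 2 + 1 := by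
    rw [htr]
    have : (k * (p z + r z)) ^ 2 ≤ (k ^ 2 + 1) ^ 2 := by gcongr
    nlinarith
  have hk2 : (1 : ℝ) ≤ k ^ 2 := by nlinarith
  have hv : v.re ^ 2 + v.im ^ 2 = ‖v‖ ^ 2 := by
    rw [Complex.sq_norm, Complex.normSq_apply]; ring
  have u := quadForm_le (a := v.re) (b := v.im) hdet hk2 hs
  have l := le_quadForm (a := v.re) (b := v.im) (by positivity) (by positivity) hdet hk2 hs
  rw [hv] at u l
  constructor
  · refine (abs_le_of_sq_le_sq' ?_ ?_).2
    · rw [mul_pow, hN]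
      calc _ ≤ (Φ z).im ^ 2 * (k ^ 2 * ‖v‖ ^ 2) := by gcongr
        _ = _ := by ring
    · positivity
  · refine (abs_le_of_sq_le_sq' ?_ ?_).2
    · calc _ = (Φ z).im ^ 2 * ‖v‖ ^ 2 := by ring
        _ ≤ (Φ z).im ^ 2 * (k ^ 2 * _) := by gcongr
        _ = k ^ 2 * (‖fderiv ℝ Φ z v‖ ^ 2 * z.im ^ 2) := by rw [hN]; ring
        _ = _ := by ring
    · positivity

theorem dilatationAt_le (h : MinLagData p q r (fun z => (Φ z).re) (fun z => (Φ z).im)) {z : ℂ}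
    (hz : z ∈ Hset) (hd : DifferentiableAt ℝ Φ z) {k : ℝ} (hk : 1 ≤ k)
    (hτ : k * (p z + r z) ≤ k ^ 2 + 1) : dilatationAt Φ z ≤ k ^ 2 := by
  have hy : 0 < z.im := hz
  have hY : 0 < (Φ z).im := h.Ypos z hz
  have := AdSPaper.dilatationAt_le (Φ := Φ) (z := z) (m := (Φ z).im / (k * z.im))
    (M := k * (Φ z).im / z.im) (by positivity) fun v hv => by
      obtain ⟨h1, h2⟩ := h.fderiv_bounds hz hd hk hτ v
      rw [hv] at h1 h2
      constructor
      · rw [div_le_iff₀ (by positivity)]; linarith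
      · rw [le_div_iff₀ hy]; linarith
  refine this.trans (le_of_eq ?_)
  field_simp

theorem trace_le_of_dilatationAt_le
    (h : MinLagData p q r (fun z => (Φ z).re) (fun z => (Φ z).im)) {z : ℂ}
    (hz : z ∈ Hset) (hd : DifferentiableAt ℝ Φ z) {K : ℝ} (hK : dilatationAt Φ z ≤ K) :
    p z + r z ≤ K + 2 := by
  have hy : 0 < z.im := hz
  have hY : 0 < (Φ z).im := h.Ypos z hz
  have ht := h.trace_ge hz
  have hdet := h.det z hz
  have htr := h.trace_sq hz
  have hK0 : 0 ≤ K := (dilatationAt_nonneg Φ z).trans hK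
  have hlow : ∀ v : ℂ, ‖v‖ = 1 → (Φ z).im / ((p z + r z) * z.im) ≤ ‖fderiv ℝ Φ z v‖ :=
    fun v hv => by
      have h2 := (h.fderiv_bounds hz hd (k := p z + r z) (by linarith) (by nlinarith) v).2
      rw [hv] at h2
      rw [div_le_iff₀ (by positivity)]; linarith
  have hm : 0 < (Φ z).im / ((p z + r z) * z.im) := by positivity
  have key : ∀ (v w : ℂ) (A : ℝ), ‖v‖ = 1 → 0 < A → ‖w‖ ^ 2 = A →
      ‖fderiv ℝ Φ z v‖ ^ 2 * z.im ^ 2 = (Φ z).im ^ 2 * A →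
      ‖fderiv ℝ Φ z w‖ ^ 2 * z.im ^ 2 = (Φ z).im ^ 2 → A ≤ K := by
    intro v w A hv hA hw h1 h2
    have hw0 : w ≠ 0 := by rintro rfl; simp at hw; linarith
    have h3 := mul_le_of_dilatationAt_le hm hlow hK hv hw0
    have h4 : (‖fderiv ℝ Φ z v‖ * ‖w‖) ^ 2 ≤ (K * ‖fderiv ℝ Φ z w‖) ^ 2 := by gcongr
    have h5 : (‖fderiv ℝ Φ z v‖ * ‖w‖) ^ 2 * z.im ^ 2 ≤ (K * ‖fderiv ℝ Φ z w‖) ^ 2 * z.im ^ 2 := by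
      gcongr
    have h6 : (Φ z).im ^ 2 * A ^ 2 ≤ (Φ z).im ^ 2 * K ^ 2 := by
      calc (Φ z).im ^ 2 * A ^ 2 = (‖fderiv ℝ Φ z v‖ * ‖w‖) ^ 2 * z.im ^ 2 := by
            rw [mul_pow, hw]; linear_combination -A * h1
        _ ≤ _ := h5
        _ = _ := by linear_combination K ^ 2 * h2
    exact (abs_le_of_sq_le_sq' (le_of_mul_le_mul_left h6 (by positivity)) hK0).2
  have e1 : (q z ^ 2 + r z ^ 2) ≤ K := by
    apply key Complex.I ⟨r z, -q z⟩ _ (by simp)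
    · have := h.pos' hz; positivity
    · rw [Complex.sq_norm, Complex.normSq_mk]; ring
    · rw [h.norm_fderiv_sq hz hd]; simp
    · rw [h.norm_fderiv_sq hz hd]
      linear_combination (Φ z).im ^ 2 * (p z * r z - q z ^ 2 + 1) * hdet
  have e2 : (p z ^ 2 + q z ^ 2) ≤ K := by
    apply key 1 ⟨-q z, p z⟩ _ (by simp)
    · have := h.pos z hz; positivity
    · rw [Complex.sq_norm, Complex.normSq_mk]; ring
    · rw [h.norm_fderiv_sq hz hd]; simp
    · rw [h.norm_fderiv_sq hz hd]
      linear_combination (Φ z).im ^ 2 * (p z * r z - q z ^ 2 + 1) * hdet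
  nlinarith

theorem hypLip (h : MinLagData p q r (fun z => (Φ z).re) (fun z => (Φ z).im)) {M : ℝ}
    (hd : ∀ z ∈ Hset, DifferentiableAt ℝ Φ z) (hM : ∀ z ∈ Hset, p z + r z ≤ M) : HypLip Φ M where
  diff := hd
  maps z hz := h.Ypos z hz
  bound z hz v := by
    have ht := h.trace_ge hz
    have h1 := (h.fderiv_bounds hz (hd z hz) (k := p z + r z) (by linarith) (by nlinarith) v).1
    have hY : 0 < (Φ z).im := h.Ypos z hz
    refine h1.trans ?_
    have := hM z hz
    gcongr

theorem hypLip_inv (h : MinLagData p q r (fun z => (Φ z).re) (fun z => (Φ z).im)) {M : ℝ}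
    {Ψ : ℂ → ℂ} (hd : ∀ z ∈ Hset, DifferentiableAt ℝ Φ z)
    (hd' : ∀ z ∈ Hset, DifferentiableAt ℝ Ψ z) (hmaps : MapsTo Ψ Hset Hset)
    (hinv : ∀ w ∈ Hset, Φ (Ψ w) = w) (hM : ∀ z ∈ Hset, p z + r z ≤ M) : HypLip Ψ M where
  diff := hd'
  maps := hmaps
  bound w hw v := by
    have hz : Ψ w ∈ Hset := hmaps hw
    have ht := h.trace_ge hz
    have h1 := (h.fderiv_bounds hz (hd _ hz) (k := p (Ψ w) + r (Ψ w)) (by linarith) (by nlinarith)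
      (fderiv ℝ Ψ w v)).2
    have hc : fderiv ℝ Φ (Ψ w) (fderiv ℝ Ψ w v) = v := by
      have e1 : HasFDerivAt (Φ ∘ Ψ) (ContinuousLinearMap.id ℝ ℂ) w :=
        (hasFDerivAt_id w).congr_of_eventuallyEq
          (eventually_of_mem (Hset_mem_nhds hw) fun u hu => hinv u hu)
      have e2 := (hd _ hz).hasFDerivAt.comp w (hd' w hw).hasFDerivAt
      have := e2.unique e1
      exact congrArg (fun A : ℂ →L[ℝ] ℂ => A v) this
    rw [hc, hinv w hw] at h1
    refine h1.trans ?_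
    have := hM _ hz
    have : 0 < (Ψ w).im := hz
    gcongr

end MinLagData

/-! ### Regularity of the Codazzi field of a minimal Lagrangian map -/

theorem det_eq_basis (A : ℂ →ₗ[ℝ] ℂ) :
    LinearMap.det A = (A 1).re * (A Complex.I).im - (A Complex.I).re * (A 1).im := by
  rw [← LinearMap.det_toMatrix Complex.basisOneI, Matrix.det_fin_two]
  simp [LinearMap.toMatrix_apply, Complex.coe_basisOneI_repr]

theorem c2_fderiv_apply {g : ℂ → ℝ} (hg : ContDiffOn ℝ (⊤ : ℕ∞) g Hset) (v : ℂ) : C2 (D v g) := by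
  have h1 : ContDiffOn ℝ 2 (fderiv ℝ g) Hset :=
    ContDiffOn.fderiv_of_isOpen hg isOpen_Hset
      (WithTop.coe_le_coe.2 (le_top : (3 : ℕ∞) ≤ ⊤))
  exact h1.clm_apply contDiffOn_const

theorem D_congr_eventually {f g : ℂ → ℝ} {z : ℂ} (h : f =ᶠ[𝓝 z] g) (v : ℂ) : D v f z = D v g z := by
  unfold D; rw [h.fderiv_eq]

theorem re_fderiv {f : ℂ → ℂ} {z : ℂ} (hd : DifferentiableAt ℝ f z) (v : ℂ) :
    (fderiv ℝ f z v).re = D v (fun z => (f z).re) z := by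
  have e := ((Complex.reCLM.hasFDerivAt (x := f z)).comp z hd.hasFDerivAt).fderiv
  have : (fun z => (f z).re) = ⇑Complex.reCLM ∘ f := rfl
  rw [D, this, e]; rfl

theorem im_fderiv {f : ℂ → ℂ} {z : ℂ} (hd : DifferentiableAt ℝ f z) (v : ℂ) :
    (fderiv ℝ f z v).im = D v (fun z => (f z).im) z := by
  have e := ((Complex.imCLM.hasFDerivAt (x := f z)).comp z hd.hasFDerivAt).fderiv
  have : (fun z => (f z).im) = ⇑Complex.imCLM ∘ f := rfl
  rw [D, this, e]; rfl

/-- A pointwise Codazzi tensor which agrees up to sign with a smooth positive field makes the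
latter a Codazzi field. -/
theorem CodazziField.of_pointwise {p q r : ℂ → ℝ} (hp : C2 p) (hq : C2 q) (hr : C2 r)
    (pos : ∀ z ∈ Hset, 0 < p z) (det : ∀ z ∈ Hset, p z * r z - q z ^ 2 = 1)
    {A B : ℂ → ℂ} (hAB : ∀ z ∈ Hset, (A z = ⟨p z, q z⟩ ∧ B z = ⟨q z, r z⟩) ∨
      (A z = ⟨-p z, -q z⟩ ∧ B z = ⟨-q z, -r z⟩))
    (hcod : ∀ z ∈ Hset, fderiv ℝ B z 1 + Gamma z 1 (B z) = fderiv ℝ A z Complex.I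
      + Gamma z Complex.I (A z)) : CodazziField p q r := by
  have rpos : ∀ z ∈ Hset, 0 < r z := fun z hz => by
    have h1 := det z hz
    have h2 := pos z hz
    by_contra! h3
    nlinarith [sq_nonneg (q z), mul_nonneg h2.le (neg_nonneg.2 h3)]
  -- the values of the Christoffel terms
  have hG : ∀ (z : ℂ) (w : ℂ), (Gamma z 1 w) = ⟨-w.im / z.im, w.re / z.im⟩ := fun z w => by
    apply Complex.ext <;> simp [Gamma, Complex.div_re, Complex.div_im, Complex.normSq_apply] <;>
      field_simp
  have hG' : ∀ (z : ℂ) (w : ℂ), (Gamma z Complex.I w) = ⟨-w.re / z.im, -w.im / z.im⟩ := fun z w => by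
    apply Complex.ext <;> simp [Gamma, Complex.div_re, Complex.div_im, Complex.normSq_apply] <;>
      field_simp
  -- local constancy of the sign
  have key : ∀ z ∈ Hset, (ContinuousAt A z ∨ ContinuousAt B z) →
      (z.im * (D 1 q z - D Complex.I p z) = r z - p z) ∧
      (z.im * (D 1 r z - D Complex.I q z) = -2 * q z) := by
    intro z hz hc
    have hy : 0 < z.im := hz
    have hsign : (∀ᶠ u in 𝓝 z, A u = ⟨p u, q u⟩ ∧ B u = ⟨q u, r u⟩) ∨
        (∀ᶠ u in 𝓝 z, A u = ⟨-p u, -q u⟩ ∧ B u = ⟨-q u, -r u⟩) := by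
      have hH := Hset_mem_nhds hz
      rcases hc with hc | hc
      · have hc' : ContinuousAt (fun u => (A u).re) z := Complex.continuous_re.continuousAt.comp hc
        rcases hAB z hz with ⟨h1, -⟩ | ⟨h1, -⟩
        · left
          have : 0 < (A z).re := by rw [h1]; exact pos z hz
          filter_upwards [hH, hc'.eventually_const_lt this] with u hu hu'
          rcases hAB u hu with h2 | h2
          · exact h2
          · rw [h2.1] at hu'; simp only at hu'; linarith [pos u hu]
        · right
          have : (A z).re < 0 := by rw [h1]; simpa using pos z hz
          filter_upwards [hH, hc'.eventually_lt_const this] with u hu hu'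
          rcases hAB u hu with h2 | h2
          · rw [h2.1] at hu'; simp only at hu'; linarith [pos u hu]
          · exact h2
      · have hc' : ContinuousAt (fun u => (B u).im) z := Complex.continuous_im.continuousAt.comp hc
        rcases hAB z hz with ⟨-, h1⟩ | ⟨-, h1⟩
        · left
          have : 0 < (B z).im := by rw [h1]; exact rpos z hz
          filter_upwards [hH, hc'.eventually_const_lt this] with u hu hu'
          rcases hAB u hu with h2 | h2
          · exact h2
          · rw [h2.2] at hu'; simp only at hu'; linarith [rpos u hu]
        · right
          have : (B z).im < 0 := by rw [h1]; simpa using rpos z hz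
          filter_upwards [hH, hc'.eventually_lt_const this] with u hu hu'
          rcases hAB u hu with h2 | h2
          · rw [h2.2] at hu'; simp only at hu'; linarith [rpos u hu]
          · exact h2
    have hmk : ∀ {f g : ℂ → ℝ}, C2 f → C2 g →
        DifferentiableAt ℝ (fun u => (⟨f u, g u⟩ : ℂ)) z := by
      intro f g hf hg
      have : (fun u => (⟨f u, g u⟩ : ℂ)) = fun u => Complex.equivRealProdCLM.symm (f u, g u) := by
        funext u; apply Complex.ext <;> simp
      rw [this]
      exact Complex.equivRealProdCLM.symm.differentiableAt.comp z
        ((hf.differentiableAt hz).prodMk (hg.differentiableAt hz))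
    have hneg : ∀ {f : ℂ → ℝ}, C2 f → C2 (fun u => -f u) := fun hf => ContDiffOn.neg hf
    have hDneg : ∀ (f : ℂ → ℝ) (v : ℂ), D v (fun u => -f u) z = -D v f z := fun f v => by
      unfold D; rw [fderiv_fun_neg]; rfl
    have e := hcod z hz
    rw [hG, hG'] at e
    rcases hsign with hs | hs
    · have hA : A =ᶠ[𝓝 z] fun u => ⟨p u, q u⟩ := hs.mono fun u hu => hu.1
      have hB : B =ᶠ[𝓝 z] fun u => ⟨q u, r u⟩ := hs.mono fun u hu => hu.2
      rw [hA.fderiv_eq, hB.fderiv_eq, hA.eq_of_nhds, hB.eq_of_nhds] at e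
      have e1 := congrArg Complex.re e
      have e2 := congrArg Complex.im e
      simp only [Complex.add_re, Complex.add_im] at e1 e2
      rw [re_fderiv (hmk hq hr), re_fderiv (hmk hp hq)] at e1
      rw [im_fderiv (hmk hq hr), im_fderiv (hmk hp hq)] at e2
      field_simp at e1 e2
      constructor <;> linarith
    · have hA : A =ᶠ[𝓝 z] fun u => ⟨-p u, -q u⟩ := hs.mono fun u hu => hu.1
      have hB : B =ᶠ[𝓝 z] fun u => ⟨-q u, -r u⟩ := hs.mono fun u hu => hu.2
      rw [hA.fderiv_eq, hB.fderiv_eq, hA.eq_of_nhds, hB.eq_of_nhds] at e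
      have e1 := congrArg Complex.re e
      have e2 := congrArg Complex.im e
      simp only [Complex.add_re, Complex.add_im] at e1 e2
      rw [re_fderiv (hmk (hneg hq) (hneg hr)), re_fderiv (hmk (hneg hp) (hneg hq))] at e1
      rw [im_fderiv (hmk (hneg hq) (hneg hr)), im_fderiv (hmk (hneg hp) (hneg hq))] at e2
      simp only [hDneg] at e1 e2
      field_simp at e1 e2
      constructor <;> linarith
  have key' : ∀ z ∈ Hset, ¬ (ContinuousAt A z ∨ ContinuousAt B z) →
      p z = 1 ∧ q z = 0 ∧ r z = 1 := by
    intro z hz hc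
    push Not at hc
    have hy : 0 < z.im := hz
    have e := hcod z hz
    rw [fderiv_zero_of_not_differentiableAt fun h => hc.1 h.continuousAt,
      fderiv_zero_of_not_differentiableAt fun h => hc.2 h.continuousAt, hG, hG'] at e
    have e1 := congrArg Complex.re e
    have e2 := congrArg Complex.im e
    have hd := det z hz
    have hpz := pos z hz
    have hpr : r z = p z ∧ q z = 0 := by
      rcases hAB z hz with ⟨h1, h2⟩ | ⟨h1, h2⟩ <;> rw [h1, h2] at e1 e2 <;>
        simp at e1 e2 <;> field_simp at e1 e2 <;> constructor <;> linarith
    obtain ⟨h1, h2⟩ := hpr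
    rw [h1, h2] at hd
    have : p z = 1 := by nlinarith
    exact ⟨this, h2, h1.trans this⟩
  have main : ∀ (E : ℂ → ℝ), ContinuousOn E Hset →
      (∀ z ∈ Hset, (ContinuousAt A z ∨ ContinuousAt B z) → E z = 0) →
      (∀ z ∈ Hset, (∀ᶠ u in 𝓝 z, p u = 1 ∧ q u = 0 ∧ r u = 1) → E z = 0) →
      ∀ z ∈ Hset, E z = 0 := by
    intro E hE h1 h2 z hz
    by_contra hne
    have hcE : ContinuousAt E z := hE.continuousAt (Hset_mem_nhds hz)
    refine hne (h2 z hz ?_)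
    filter_upwards [Hset_mem_nhds hz, hcE.eventually_ne hne] with u hu hu'
    exact key' u hu fun hc => hu' (h1 u hu hc)
  have contD : ∀ {f : ℂ → ℝ}, C2 f → ∀ v, ContinuousOn (D v f) Hset := fun hf v =>
    ContDiffOn.continuousOn (hf.D v)
  have cont : ∀ {f : ℂ → ℝ}, C2 f → ContinuousOn f Hset := fun hf => ContDiffOn.continuousOn hf
  have hconst : ∀ {f : ℂ → ℝ} {c : ℝ} {z v : ℂ}, (∀ᶠ u in 𝓝 z, f u = c) → D v f z = 0 :=
    fun {f c z v} h => by rw [D_congr_eventually (g := fun _ => c) h v, D_const]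
  refine ⟨hp, hq, hr, pos, det, fun z hz => ?_, fun z hz => ?_⟩
  · refine sub_eq_zero.1 (main (fun z => z.im * (D 1 q z - D Complex.I p z) - (r z - p z)) ?_
      (fun z hz hc => sub_eq_zero.2 (key z hz hc).1) ?_ z hz)
    · exact (Complex.continuous_im.continuousOn.mul ((contD hq _).sub (contD hp _))).sub
        ((cont hr).sub (cont hp))
    · intro z hz hev
      rw [hconst (hev.mono fun u hu => hu.2.1), hconst (hev.mono fun u hu => hu.1),
        hev.self_of_nhds.1, hev.self_of_nhds.2.2]
      ring
  · refine sub_eq_zero.1 (main (fun z => z.im * (D 1 r z - D Complex.I q z) - (-2 * q z)) ?_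
      (fun z hz hc => sub_eq_zero.2 (key z hz hc).2) ?_ z hz)
    · exact (Complex.continuous_im.continuousOn.mul ((contD hr _).sub (contD hq _))).sub
        (continuousOn_const.mul (cont hq))
    · intro z hz hev
      rw [hconst (hev.mono fun u hu => hu.2.1), hconst (hev.mono fun u hu => hu.2.2),
        hev.self_of_nhds.2.1]
      ring

theorem IsMinimalLagrangian.exists_minLagData {Φ : ℂ → ℂ} (h : IsMinimalLagrangian Φ) :
    ∃ p q r, MinLagData p q r (fun z => (Φ z).re) (fun z => (Φ z).im) := by
  obtain ⟨hsm, hbij, -, b, hsym, hdet, hmet, hcod⟩ := h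
  set X : ℂ → ℝ := fun z => (Φ z).re with hX
  set Y : ℂ → ℝ := fun z => (Φ z).im with hY
  have sX : ContDiffOn ℝ (⊤ : ℕ∞) X Hset := Complex.reCLM.contDiff.comp_contDiffOn hsm
  have sY : ContDiffOn ℝ (⊤ : ℕ∞) Y Hset := Complex.imCLM.contDiff.comp_contDiffOn hsm
  have hd : ∀ z ∈ Hset, DifferentiableAt ℝ Φ z := fun z hz =>
    (hsm.contDiffAt (Hset_mem_nhds hz)).differentiableAt (by simp)
  have Ypos : ∀ z ∈ Hset, 0 < Y z := fun z hz => hbij.mapsTo hz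
  have c2X : C2 X := sX.of_le (WithTop.coe_le_coe.2 (le_top : (2 : ℕ∞) ≤ ⊤))
  have c2Y : C2 Y := sY.of_le (WithTop.coe_le_coe.2 (le_top : (2 : ℕ∞) ≤ ⊤))
  -- coefficients of the metric
  let G : ℂ → ℂ → ℂ → ℝ := fun v w z =>
    (z.im * z.im * (D v X z * D w X z + D v Y z * D w Y z)) / (Y z * Y z)
  have c2G : ∀ v w, C2 (G v w) := fun v w =>
    ((C2.im.mul C2.im).mul (((c2_fderiv_apply sX v).mul (c2_fderiv_apply sX w)).add
      ((c2_fderiv_apply sY v).mul (c2_fderiv_apply sY w)))).div (c2Y.mul c2Y)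
      fun z hz => (mul_pos (Ypos z hz) (Ypos z hz)).ne'
  have hG : ∀ v w, ∀ z ∈ Hset, G v w z = rinner (b z v) (b z w) := by
    intro v w z hz
    have h1 := hmet z hz v w
    have hy : 0 < z.im := hz
    have hYz : 0 < (Φ z).im := Ypos z hz
    unfold rinner at h1 ⊢
    rw [re_fderiv (hd z hz), re_fderiv (hd z hz), im_fderiv (hd z hz), im_fderiv (hd z hz)] at h1
    simp only [G]
    rw [div_eq_div_iff (by positivity) (by positivity)] at h1
    rw [div_eq_iff (by positivity)]
    simp only [hX, hY]
    linear_combination h1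
  set α : ℂ → ℝ := fun z => (b z 1).re with hα
  set β : ℂ → ℝ := fun z => (b z 1).im with hβ
  set γ : ℂ → ℝ := fun z => (b z Complex.I).im with hγ
  have hβ' : ∀ z ∈ Hset, (b z Complex.I).re = β z := fun z hz => by
    have := hsym z hz 1 Complex.I
    simpa [rinner] using this.symm
  have hdet' : ∀ z ∈ Hset, α z * γ z - β z ^ 2 = 1 := fun z hz => by
    have := hdet z hz
    rw [det_eq_basis] at this
    simp only [ContinuousLinearMap.coe_coe] at this
    rw [hβ' z hz] at this
    rw [← this, sq]
  have g11 : ∀ z ∈ Hset, G 1 1 z = α z ^ 2 + β z ^ 2 := fun z hz => by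
    rw [hG _ _ z hz, rinner]; ring
  have g12 : ∀ z ∈ Hset, G 1 Complex.I z = β z * (α z + γ z) := fun z hz => by
    rw [hG _ _ z hz, rinner, hβ' z hz]; ring
  have g22 : ∀ z ∈ Hset, G Complex.I Complex.I z = β z ^ 2 + γ z ^ 2 := fun z hz => by
    rw [hG _ _ z hz, rinner, hβ' z hz]; ring
  let τ : ℂ → ℝ := fun z => √(2 + G 1 1 z + G Complex.I Complex.I z)
  have hτ : ∀ z ∈ Hset, τ z = |α z + γ z| := fun z hz => by
    simp only [τ]
    rw [← Real.sqrt_sq_eq_abs]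
    congr 1
    linear_combination g11 z hz + g22 z hz - 2 * hdet' z hz
  have hne : ∀ z ∈ Hset, α z + γ z ≠ 0 := fun z hz h0 => by
    have h1 := hdet' z hz
    have h2 : γ z = -α z := by linarith
    rw [h2] at h1
    nlinarith [sq_nonneg (α z), sq_nonneg (β z)]
  have τpos : ∀ z ∈ Hset, 0 < τ z := fun z hz => by rw [hτ z hz]; exact abs_pos.2 (hne z hz)
  have c2τ : C2 τ := C2.sqrt (((C2.const 2).add (c2G _ _)).add (c2G _ _)) fun z hz => by
    have := (Real.sqrt_pos.1 (τpos z hz)).ne'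
    exact this
  let p : ℂ → ℝ := fun z => (1 + G 1 1 z) / τ z
  let q : ℂ → ℝ := fun z => G 1 Complex.I z / τ z
  let r : ℂ → ℝ := fun z => (1 + G Complex.I Complex.I z) / τ z
  have hp : C2 p := ((C2.const 1).add (c2G _ _)).div c2τ fun z hz => (τpos z hz).ne'
  have hq : C2 q := (c2G _ _).div c2τ fun z hz => (τpos z hz).ne'
  have hr : C2 r := ((C2.const 1).add (c2G _ _)).div c2τ fun z hz => (τpos z hz).ne'
  have hpqr : ∀ z ∈ Hset, (α z = p z ∧ β z = q z ∧ γ z = r z) ∨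
      (α z = -p z ∧ β z = -q z ∧ γ z = -r z) := by
    intro z hz
    have h1 := hdet' z hz
    have e1 : 1 + G 1 1 z = α z * (α z + γ z) := by rw [g11 z hz]; linear_combination -h1
    have e3 : 1 + G Complex.I Complex.I z = γ z * (α z + γ z) := by
      rw [g22 z hz]; linear_combination -h1
    have e2 := g12 z hz
    simp only [p, q, r]
    rw [e1, e2, e3, hτ z hz]
    rcases lt_or_gt_of_ne (hne z hz) with hs | hs
    · right
      rw [abs_of_neg hs]
      refine ⟨?_, ?_, ?_⟩ <;> rw [div_neg, neg_neg, mul_div_cancel_right₀ _ hs.ne]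
    · left
      rw [abs_of_pos hs]
      refine ⟨?_, ?_, ?_⟩ <;> rw [mul_div_cancel_right₀ _ hs.ne']
  have pos : ∀ z ∈ Hset, 0 < p z := fun z hz => by
    have : 0 ≤ G 1 1 z := by rw [g11 z hz]; positivity
    have := τpos z hz
    simp only [p]; positivity
  have det : ∀ z ∈ Hset, p z * r z - q z ^ 2 = 1 := fun z hz => by
    have h1 := hdet' z hz
    rcases hpqr z hz with ⟨a, b, c⟩ | ⟨a, b, c⟩ <;> rw [a, b, c] at h1 <;> linarith
  have hcz : CodazziField p q r := by
    refine CodazziField.of_pointwise hp hq hr pos det (A := fun z => b z 1)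
      (B := fun z => b z Complex.I) (fun z hz => ?_) fun z hz => ?_
    · rcases hpqr z hz with ⟨a1, a2, a3⟩ | ⟨a1, a2, a3⟩
      · left
        rw [← a1, ← a2, ← a3]
        exact ⟨rfl, Complex.ext (hβ' z hz) rfl⟩
      · right
        rw [← a1, ← a2, ← a3]
        exact ⟨rfl, Complex.ext (hβ' z hz) rfl⟩
    · have := hcod z hz 1 Complex.I
      have hs : Gamma z Complex.I 1 = Gamma z 1 Complex.I := by unfold Gamma; ring
      rw [hs] at this
      exact sub_left_injective this
  refine ⟨p, q, r, hcz, c2X, c2Y, Ypos, fun z hz => ?_, fun z hz => ?_, fun z hz => ?_⟩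
  all_goals
    have hYz := Ypos z hz
  · have e : G 1 1 z = p z * p z + q z * q z := by
      rw [g11 z hz]; rcases hpqr z hz with ⟨a, b, c⟩ | ⟨a, b, c⟩ <;> rw [a, b] <;> ring
    simp only [G] at e
    rw [div_eq_iff (by positivity)] at e
    rw [e]; ring
  · have e : G 1 Complex.I z = q z * (p z + r z) := by
      rw [g12 z hz]; rcases hpqr z hz with ⟨a, b, c⟩ | ⟨a, b, c⟩ <;> rw [a, b, c] <;> ring
    simp only [G] at e
    rw [div_eq_iff (by positivity)] at e
    rw [e]; ring
  · have e : G Complex.I Complex.I z = q z * q z + r z * r z := by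
      rw [g22 z hz]; rcases hpqr z hz with ⟨a, b, c⟩ | ⟨a, b, c⟩ <;> rw [b, c] <;> ring
    simp only [G] at e
    rw [div_eq_iff (by positivity)] at e
    rw [e]; ring

/-! ### Normalization by a rotation of the hyperbolic plane -/

/-- The Möbius transformation with matrix `[[c, d], [-d, c]]`. -/
def rot (c d : ℝ) (w : ℂ) : ℂ := (c * w + d) / (-d * w + c)

section
variable {c d : ℝ}

theorem rot_den_ne_zero (h : 0 < c ^ 2 + d ^ 2) {w : ℂ} (hw : w ∈ Hset) :
    -(d : ℂ) * w + c ≠ 0 := by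
  intro h0
  have hw' : 0 < w.im := hw
  have e1 := congrArg Complex.re h0
  have e2 := congrArg Complex.im h0
  simp at e1 e2
  have hd : d = 0 := e2.resolve_right hw'.ne'
  subst hd
  simp at e1
  subst e1
  simp at h

theorem rot_im (h : 0 < c ^ 2 + d ^ 2) {w : ℂ} (hw : w ∈ Hset) :
    (rot c d w).im = (c ^ 2 + d ^ 2) * w.im / Complex.normSq (-(d : ℂ) * w + c) := by
  have h0 := Complex.normSq_pos.2 (rot_den_ne_zero h hw)
  rw [rot, Complex.div_im, ← sub_div]
  congr 1
  simp
  ring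

theorem rot_mapsTo (h : 0 < c ^ 2 + d ^ 2) : MapsTo (rot c d) Hset Hset := fun w hw => by
  have h0 := Complex.normSq_pos.2 (rot_den_ne_zero h hw)
  have hw' : 0 < w.im := hw
  change 0 < (rot c d w).im
  rw [rot_im h hw]
  positivity

theorem rot_rot_neg (h : 0 < c ^ 2 + d ^ 2) {w : ℂ} (hw : w ∈ Hset) :
    rot c (-d) (rot c d w) = w := by
  have h0 := rot_den_ne_zero h hw
  have hn : ((c : ℂ) ^ 2 + d ^ 2) ≠ 0 := by exact_mod_cast h.ne'
  have e1 : (c : ℂ) * rot c d w + (-d : ℝ) = (c ^ 2 + d ^ 2) * w / (-d * w + c) := by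
    rw [rot, eq_div_iff h0, add_mul, mul_assoc, div_mul_cancel₀ _ h0]; push_cast; ring
  have e2 : -((-d : ℝ) : ℂ) * rot c d w + c = (c ^ 2 + d ^ 2) / (-d * w + c) := by
    rw [rot, eq_div_iff h0, add_mul, mul_assoc, div_mul_cancel₀ _ h0]; push_cast; ring
  rw [rot, e1, e2, div_div_div_cancel_right₀ h0, mul_div_cancel_left₀ w hn]

theorem rot_neg_rot (h : 0 < c ^ 2 + d ^ 2) {w : ℂ} (hw : w ∈ Hset) :
    rot c d (rot c (-d) w) = w := by
  have := rot_rot_neg (c := c) (d := -d) (by simpa using h) hw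
  rwa [neg_neg] at this

theorem rot_hasDerivAt (h : 0 < c ^ 2 + d ^ 2) {w : ℂ} (hw : w ∈ Hset) :
    HasDerivAt (rot c d) ((c ^ 2 + d ^ 2) / (-d * w + c) ^ 2) w := by
  have h0 := rot_den_ne_zero h hw
  have h1 : HasDerivAt (fun w : ℂ => (c : ℂ) * w + d) c w := by
    simpa using ((hasDerivAt_id w).const_mul (c : ℂ)).add_const (d : ℂ)
  have h2 : HasDerivAt (fun w : ℂ => -(d : ℂ) * w + c) (-d) w := by
    simpa using ((hasDerivAt_id w).const_mul (-(d : ℂ))).add_const (c : ℂ)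
  have := h1.div h2 h0
  refine this.congr_deriv ?_
  congr 1; ring

theorem rot_contDiffOn (h : 0 < c ^ 2 + d ^ 2) : ContDiffOn ℝ (⊤ : ℕ∞) (rot c d) Hset := by
  have e : rot c d = fun w : ℂ => ((c : ℂ) * w + d) * (-d * w + c)⁻¹ := by
    funext w; rw [rot, div_eq_mul_inv]
  rw [e]
  exact ContDiffOn.mul ((contDiff_const.mul contDiff_id).add contDiff_const).contDiffOn
    (ContDiffOn.inv ((contDiff_const.mul contDiff_id).add contDiff_const).contDiffOn
      fun _ hw => rot_den_ne_zero h hw)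

theorem fderiv_rot_comp (h : 0 < c ^ 2 + d ^ 2) {Φ : ℂ → ℂ} {z : ℂ} (hw : Φ z ∈ Hset)
    (hd : DifferentiableAt ℝ Φ z) (v : ℂ) :
    fderiv ℝ (fun z => rot c d (Φ z)) z v
      = (c ^ 2 + d ^ 2) / (-d * Φ z + c) ^ 2 * fderiv ℝ Φ z v := by
  have h1 := ((rot_hasDerivAt h hw).hasFDerivAt.restrictScalars ℝ).comp z hd.hasFDerivAt
  have : (fun z => rot c d (Φ z)) = rot c d ∘ Φ := rfl
  rw [this, h1.fderiv]
  simp [mul_comm]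

theorem rinner_mul (a v w : ℂ) : rinner (a * v) (a * w) = Complex.normSq a * rinner v w := by
  simp [rinner, Complex.normSq_apply]; ring

theorem IsMinimalLagrangian.rot_comp (h : 0 < c ^ 2 + d ^ 2) {Φ : ℂ → ℂ}
    (hΦ : IsMinimalLagrangian Φ) : IsMinimalLagrangian fun z => rot c d (Φ z) := by
  obtain ⟨hsm, hbij, ⟨Ψ, hΨ, hinv⟩, b, hsym, hdet, hmet, hcod⟩ := hΦ
  have h' : 0 < c ^ 2 + (-d) ^ 2 := by simpa using h
  have hri : InvOn (rot c (-d)) (rot c d) Hset Hset :=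
    ⟨fun w hw => rot_rot_neg h hw, fun w hw => rot_neg_rot h hw⟩
  have hrb : BijOn (rot c d) Hset Hset := hri.bijOn (rot_mapsTo h) (rot_mapsTo h')
  have hΨm : MapsTo Ψ Hset Hset := fun w hw => by
    obtain ⟨z, hz, rfl⟩ := hbij.surjOn hw
    rwa [hinv.1 hz]
  refine ⟨(rot_contDiffOn h).comp hsm hbij.mapsTo, hrb.comp hbij,
    ⟨fun w => Ψ (rot c (-d) w), hΨ.comp (rot_contDiffOn h') (rot_mapsTo h'), ?_, ?_⟩,
    b, hsym, hdet, fun z hz v w => ?_, hcod⟩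
  · intro z hz
    simp only [rot_rot_neg h (hbij.mapsTo hz)]
    exact hinv.1 hz
  · intro w hw
    simp only [hinv.2 (rot_mapsTo h' hw)]
    exact rot_neg_rot h hw
  · have hw : Φ z ∈ Hset := hbij.mapsTo hz
    have hd : DifferentiableAt ℝ Φ z :=
      (hsm.contDiffAt (Hset_mem_nhds hz)).differentiableAt (by simp)
    have h0 := Complex.normSq_pos.2 (rot_den_ne_zero h hw)
    have hw' : 0 < (Φ z).im := hw
    rw [← hmet z hz v w, fderiv_rot_comp h hw hd, fderiv_rot_comp h hw hd, rinner_mul, rot_im h hw,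
      Complex.normSq_div, map_pow]
    have e : Complex.normSq ((c : ℂ) ^ 2 + d ^ 2) = (c ^ 2 + d ^ 2) ^ 2 := by
      rw [← Complex.ofReal_pow, ← Complex.ofReal_pow, ← Complex.ofReal_add, Complex.normSq_ofReal]; ring
    rw [e]
    generalize Complex.normSq (-(d : ℂ) * Φ z + c) = N at h0
    field_simp

theorem dilatationAt_rot_comp (h : 0 < c ^ 2 + d ^ 2) {Φ : ℂ → ℂ} {z : ℂ} (hw : Φ z ∈ Hset)
    (hd : DifferentiableAt ℝ Φ z) : dilatationAt (fun z => rot c d (Φ z)) z = dilatationAt Φ z := by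
  unfold dilatationAt
  have hn : ((c : ℂ) ^ 2 + d ^ 2) ≠ 0 := by exact_mod_cast h.ne'
  have ha : 0 < ‖((c : ℂ) ^ 2 + d ^ 2) / (-d * Φ z + c) ^ 2‖ :=
    norm_pos_iff.2 (div_ne_zero hn (pow_ne_zero 2 (rot_den_ne_zero h hw)))
  simp only [fderiv_rot_comp h hw hd, norm_mul]
  rw [← Real.mul_iSup_of_nonneg ha.le, ← Real.mul_iInf_of_nonneg ha.le,
    mul_div_mul_left _ _ ha.ne']

end

/-! ### The boundary map in an affine chart -/

theorem det2_rep_ne_zero {a b : RP1} (h : a ≠ b) : det2 a.rep b.rep ≠ 0 := by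
  intro h0
  apply h
  rw [← a.mk_rep, ← b.mk_rep, Projectivization.mk_eq_mk_iff']
  unfold det2 at h0
  by_cases hb : b.rep 0 = 0
  · have hb1 : b.rep 1 ≠ 0 := fun h1 => b.rep_nonzero (by ext i; fin_cases i <;> simp [hb, h1])
    refine ⟨a.rep 1 / b.rep 1, ?_⟩
    have ha : a.rep 0 = 0 := by
      rw [hb, mul_zero, sub_zero] at h0
      exact (mul_eq_zero.1 h0).resolve_right hb1
    ext i
    fin_cases i
    · simp [hb, ha]
    · simp [hb1]
  · refine ⟨a.rep 0 / b.rep 0, ?_⟩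
    ext i
    fin_cases i
    · simp [hb]
    · simp only [Fin.mk_one, Pi.smul_apply, smul_eq_mul]
      rw [div_mul_eq_mul_div, div_eq_iff hb]
      linarith

theorem exists_rep_mk (v : Fin 2 → ℝ) (hv : v ≠ 0) :
    ∃ k : ℝ, k ≠ 0 ∧ ∀ i, (Projectivization.mk ℝ v hv).rep i = k * v i := by
  obtain ⟨a, ha⟩ := Projectivization.exists_smul_eq_mk_rep ℝ v hv
  refine ⟨a, a.ne_zero, fun i => ?_⟩
  rw [← ha]; rfl

/-- The point at infinity. -/
def infPt : RP1 := Projectivization.mk ℝ ![1, 0] (fun h => by simpa using congrFun h 0)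

/-- The finite point with affine coordinate `x`. -/
def finPt (x : ℝ) : RP1 := Projectivization.mk ℝ ![x, 1] (fun h => by simpa using congrFun h 1)

theorem infPt_rep : infPt.rep 0 ≠ 0 ∧ infPt.rep 1 = 0 := by
  obtain ⟨k, hk, h⟩ := exists_rep_mk ![1, 0] (fun h => by simpa using congrFun h 0)
  exact ⟨by rw [infPt, h]; simpa using hk, by rw [infPt, h]; simp⟩

theorem finPt_rep (x : ℝ) : (finPt x).rep 1 ≠ 0 ∧ (finPt x).rep 0 = x * (finPt x).rep 1 := by
  obtain ⟨k, hk, h⟩ := exists_rep_mk ![x, 1] (fun h => by simpa using congrFun h 1)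
  exact ⟨by rw [finPt, h]; simpa using hk, by rw [finPt, h, h]; simp [mul_comm]⟩

theorem finPt_ne_infPt (x : ℝ) : finPt x ≠ infPt := fun h => by
  have := (finPt_rep x).1
  rw [h] at this
  exact this infPt_rep.2

theorem exists_finPt {ξ : RP1} (h : ξ ≠ infPt) : ∃ x, finPt x = ξ := by
  have h1 : ξ.rep 1 ≠ 0 := fun h1 => det2_rep_ne_zero h (by simp [det2, h1, infPt_rep.2])
  refine ⟨ξ.rep 0 / ξ.rep 1, ?_⟩
  by_contra hne
  apply det2_rep_ne_zero hne
  rw [det2, (finPt_rep _).2]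
  field_simp
  ring

section
variable (φ : RP1 ≃ₜ RP1)

/-- The pairing of a point with the image of infinity. -/
def chartDen (x : ℝ) : ℝ := -(φ infPt).rep 1 * (φ (finPt x)).rep 0 + (φ infPt).rep 0 * (φ (finPt x)).rep 1

/-- The circle map in the affine chart, rotated so as to fix infinity. -/
def lineMap (x : ℝ) : ℝ :=
  ((φ infPt).rep 0 * (φ (finPt x)).rep 0 + (φ infPt).rep 1 * (φ (finPt x)).rep 1) / chartDen φ x

theorem repSq_pos (a : RP1) : 0 < a.rep 0 ^ 2 + a.rep 1 ^ 2 := by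
  by_contra! h
  apply a.rep_nonzero
  have h0 : a.rep 0 = 0 := by nlinarith [sq_nonneg (a.rep 0), sq_nonneg (a.rep 1)]
  have h1 : a.rep 1 = 0 := by nlinarith [sq_nonneg (a.rep 0), sq_nonneg (a.rep 1)]
  ext i; fin_cases i <;> simp [h0, h1]

theorem chartDen_eq (x : ℝ) : det2 (φ infPt).rep (φ (finPt x)).rep = chartDen φ x := by
  rw [det2, chartDen]; ring

theorem chartDen_ne_zero (x : ℝ) : chartDen φ x ≠ 0 := by
  rw [← chartDen_eq]
  exact det2_rep_ne_zero fun h => finPt_ne_infPt x (φ.injective h.symm)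

theorem det2_eq_lineMap_sub (x y : ℝ) :
    det2 (φ (finPt x)).rep (φ (finPt y)).rep =
      (lineMap φ x - lineMap φ y) * (chartDen φ x * chartDen φ y) /
        ((φ infPt).rep 0 ^ 2 + (φ infPt).rep 1 ^ 2) := by
  have hx := chartDen_ne_zero φ x
  have hy := chartDen_ne_zero φ y
  have hn := repSq_pos (φ infPt)
  rw [eq_div_iff hn.ne', lineMap, lineMap, div_sub_div _ _ hx hy, div_mul_cancel₀ _ (mul_ne_zero hx hy),
    det2, chartDen, chartDen]
  ring

variable {φ}

theorem lineMap_strictMono (h : OrientationPreserving φ) : StrictMono (lineMap φ) := by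
  intro x y hxy
  have h1 : 0 < tripleOrient (finPt x) (finPt y) infPt := by
    obtain ⟨hx1, hx0⟩ := finPt_rep x
    obtain ⟨hy1, hy0⟩ := finPt_rep y
    obtain ⟨hi0, hi1⟩ := infPt_rep
    have : tripleOrient (finPt x) (finPt y) infPt =
        (y - x) * ((finPt x).rep 1 * (finPt y).rep 1 * infPt.rep 0) ^ 2 := by
      simp only [tripleOrient, det2]
      rw [hx0, hy0, hi1]; ring
    rw [this]
    exact mul_pos (sub_pos.2 hxy) (by positivity)
  have h2 := h _ _ _ h1
  have hn := repSq_pos (φ infPt)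
  have e : tripleOrient (φ (finPt x)) (φ (finPt y)) (φ infPt) =
      (lineMap φ y - lineMap φ x) * ((chartDen φ x * chartDen φ y) ^ 2 /
        ((φ infPt).rep 0 ^ 2 + (φ infPt).rep 1 ^ 2)) := by
    have : det2 (φ (finPt y)).rep (φ infPt).rep = - chartDen φ y := by
      rw [← chartDen_eq]; unfold det2; ring
    rw [tripleOrient, this, chartDen_eq, det2_eq_lineMap_sub]; ring
  rw [e] at h2
  exact sub_pos.1 (pos_of_mul_pos_left h2 (by positivity))

variable (φ) in
theorem lineMap_surjective : Function.Surjective (lineMap φ) := by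
  intro y
  set c := (φ infPt).rep 0 with hc
  set d := (φ infPt).rep 1 with hd
  have hn : 0 < c ^ 2 + d ^ 2 := repSq_pos (φ infPt)
  have hv : ![c * y - d, d * y + c] ≠ 0 := fun h => by
    have h0 : c * y - d = 0 := by simpa using congrFun h 0
    have h1 : d * y + c = 0 := by simpa using congrFun h 1
    have : c ^ 2 + d ^ 2 = 0 := by linear_combination -d * h0 + c * h1
    linarith
  obtain ⟨k, hk, hrep⟩ := exists_rep_mk _ hv
  set P : RP1 := Projectivization.mk ℝ _ hv
  have h0 : P.rep 0 = k * (c * y - d) := by simpa using hrep 0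
  have h1 : P.rep 1 = k * (d * y + c) := by simpa using hrep 1
  have hne : φ.symm P ≠ infPt := fun h => by
    have hP : P = φ infPt := by rw [← h, φ.apply_symm_apply]
    rw [hP] at h0 h1
    rw [← hc] at h0
    rw [← hd] at h1
    have : k * (c ^ 2 + d ^ 2) = 0 := by linear_combination d * h0 - c * h1
    rcases mul_eq_zero.1 this with h | h
    · exact hk h
    · linarith
  obtain ⟨x, hx⟩ := exists_finPt hne
  refine ⟨x, ?_⟩
  have hφ : φ (finPt x) = P := by rw [hx, φ.apply_symm_apply]
  rw [lineMap, div_eq_iff (chartDen_ne_zero φ x), chartDen, hφ, h0, h1, ← hc, ← hd]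
  ring

theorem abs_log_ratio_le (hφ : Quasisymmetric φ) {x h : ℝ} (hh : 0 < h) :
    |log ((lineMap φ (x + h) - lineMap φ x) / (lineMap φ x - lineMap φ (x - h)))| ≤ crNorm φ := by
  have hm := lineMap_strictMono hφ.1
  have hpos : 0 < (lineMap φ (x + h) - lineMap φ x) / (lineMap φ x - lineMap φ (x - h)) :=
    div_pos (sub_pos.2 (hm (by linarith))) (sub_pos.2 (hm (by linarith)))
  refine le_csSup hφ.2 ⟨finPt (x - h), finPt x, finPt (x + h), infPt, ?_, ?_⟩
  · obtain ⟨a1, a0⟩ := finPt_rep (x - h)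
    obtain ⟨b1, b0⟩ := finPt_rep x
    obtain ⟨c1, c0⟩ := finPt_rep (x + h)
    obtain ⟨i0, i1⟩ := infPt_rep
    simp only [crossRatio, det2]
    rw [a0, b0, c0, i1, div_eq_iff]
    · ring
    · have : (x * (finPt x).rep 1 * (finPt (x - h)).rep 1 -
          (finPt x).rep 1 * ((x - h) * (finPt (x - h)).rep 1)) *
          ((x + h) * (finPt (x + h)).rep 1 * 0 - (finPt (x + h)).rep 1 * infPt.rep 0) =
          -(h * (finPt x).rep 1 * (finPt (x - h)).rep 1 * (finPt (x + h)).rep 1 * infPt.rep 0) := by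
        ring
      rw [this, neg_ne_zero]
      positivity
  · have hn := repSq_pos (φ infPt)
    have e : crossRatio (φ (finPt (x - h))) (φ (finPt x)) (φ (finPt (x + h))) (φ infPt) =
        -((lineMap φ (x + h) - lineMap φ x) / (lineMap φ x - lineMap φ (x - h))) := by
      have : det2 (φ (finPt (x + h))).rep (φ infPt).rep = - chartDen φ (x + h) := by
        rw [← chartDen_eq]; unfold det2; ring
      have k1 : lineMap φ x - lineMap φ (x - h) ≠ 0 := (sub_pos.2 (hm (by linarith))).ne'
      have k2 := chartDen_ne_zero φ x
      have k3 := chartDen_ne_zero φ (x - h)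
      have k4 := chartDen_ne_zero φ (x + h)
      rw [crossRatio, this, chartDen_eq, det2_eq_lineMap_sub, det2_eq_lineMap_sub]
      field_simp
    rw [e, abs_neg, abs_of_pos hpos]

theorem qsLine_lineMap (hφ : Quasisymmetric φ) :
    QSLine (lineMap φ) (exp (crNorm φ) - 1) := by
  have hm := lineMap_strictMono hφ.1
  refine ⟨hm.monotone.continuous_of_surjective (lineMap_surjective φ), hm, fun x h hh => ?_,
    fun x h hh => ?_⟩
  all_goals
    have h1 : 0 < lineMap φ (x + h) - lineMap φ x := sub_pos.2 (hm (by linarith))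
    have h2 : 0 < lineMap φ x - lineMap φ (x - h) := sub_pos.2 (hm (by linarith))
    have h3 := abs_le.1 (abs_log_ratio_le hφ (x := x) hh)
    rw [Real.log_div h1.ne' h2.ne'] at h3
    rw [add_sub_cancel]
  · rw [← Real.exp_log h1, ← Real.exp_log h2, ← Real.exp_add]
    exact Real.exp_le_exp.2 (by linarith)
  · rw [← Real.exp_log h1, ← Real.exp_log h2, ← Real.exp_add]
    exact Real.exp_le_exp.2 (by linarith)

theorem crNorm_nonneg (φ : RP1 → RP1) : 0 ≤ crNorm φ := by
  apply Real.sSup_nonneg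
  rintro _ ⟨_, _, _, _, -, rfl⟩
  exact abs_nonneg _

end

/-! ### Boundary values along vertical lines -/

theorem tendsto_coe_sphere {α : Type*} {l : Filter α} {g : α → ℂ} {ξ : RP1} (h1 : ξ.rep 1 ≠ 0) :
    Tendsto (fun a => OnePoint.some (g a)) l (𝓝 (rp1ToSphere ξ)) ↔
      Tendsto g l (𝓝 ((ξ.rep 0 / ξ.rep 1 : ℝ) : ℂ)) := by
  rw [rp1ToSphere, if_neg h1, ← OnePoint.comap_coe_nhds ((ξ.rep 0 / ξ.rep 1 : ℝ) : ℂ),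
    tendsto_comap_iff]
  rfl

theorem tendsto_infty_sphere {α : Type*} {l : Filter α} {g : α → ℂ} {ξ : RP1} (h1 : ξ.rep 1 = 0) :
    Tendsto (fun a => OnePoint.some (g a)) l (𝓝 (rp1ToSphere ξ)) ↔
      Tendsto g l (Bornology.cobounded ℂ) := by
  rw [rp1ToSphere, if_pos h1, Metric.cobounded_eq_cocompact, ← coclosedCompact_eq_cocompact,
    ← OnePoint.comap_coe_nhds_infty, tendsto_comap_iff]
  rfl

theorem ExtendsToBoundary.tendsto_comp {Φ : ℂ → ℂ} {φ : RP1 → RP1} (h : ExtendsToBoundary Φ φ)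
    {α : Type*} {l : Filter α} {g : α → ℂ} {ξ : RP1} (hg : ∀ a, g a ∈ Hset)
    (hl : Tendsto (fun a => OnePoint.some (g a)) l (𝓝 (rp1ToSphere ξ))) :
    Tendsto (fun a => OnePoint.some (Φ (g a))) l (𝓝 (rp1ToSphere (φ ξ))) := by
  refine (h ξ).comp (tendsto_inf.2 ⟨tendsto_comap_iff.2 hl, ?_⟩)
  exact tendsto_principal.2 (Eventually.of_forall hg)

theorem tendsto_vert_atBot (x : ℝ) : Tendsto (vert x) atBot (𝓝 (x : ℂ)) := by
  have h1 : Tendsto (fun s : ℝ => ((exp s : ℝ) : ℂ)) atBot (𝓝 ((0 : ℝ) : ℂ)) :=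
    (Complex.continuous_ofReal.tendsto 0).comp Real.tendsto_exp_atBot
  have := (h1.mul_const Complex.I).const_add (x : ℂ)
  simp only [Complex.ofReal_zero, zero_mul, add_zero] at this
  exact this

theorem tendsto_vert_atTop (x : ℝ) : Tendsto (vert x) atTop (Bornology.cobounded ℂ) := by
  rw [← tendsto_norm_atTop_iff_cobounded]
  refine tendsto_atTop_mono (fun s => ?_) Real.tendsto_exp_atTop
  have := Complex.abs_im_le_norm (vert x s)
  rw [vert_im, abs_of_pos (exp_pos s)] at this
  exact this

variable {φ : RP1 ≃ₜ RP1} {Φ : ℂ → ℂ}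

theorem ExtendsToBoundary.tendsto_rot_atBot (h : ExtendsToBoundary Φ φ) (x : ℝ) :
    Tendsto (fun s => rot ((φ infPt).rep 0) ((φ infPt).rep 1) (Φ (vert x s))) atBot
      (𝓝 (lineMap φ x : ℂ)) := by
  have h1 : Tendsto (fun s => OnePoint.some (vert x s)) atBot (𝓝 (rp1ToSphere (finPt x))) := by
    obtain ⟨a1, a0⟩ := finPt_rep x
    rw [tendsto_coe_sphere a1, a0, mul_div_cancel_right₀ _ a1]
    exact tendsto_vert_atBot x
  have h2 := h.tendsto_comp (vert_mem x) h1
  have hden := chartDen_ne_zero φ x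
  unfold lineMap
  unfold chartDen at hden ⊢
  set c := (φ infPt).rep 0
  set d := (φ infPt).rep 1
  by_cases hv : (φ (finPt x)).rep 1 = 0
  · rw [tendsto_infty_sphere hv] at h2
    rw [hv] at hden ⊢
    have hd : d ≠ 0 := fun h0 => by simp [h0] at hden
    have hv0 : (φ (finPt x)).rep 0 ≠ 0 := fun h0 => by simp [h0] at hden
    have h3 := (tendsto_inv₀_cobounded (α := ℂ)).comp h2
    have h4 : Tendsto (fun s => ((c : ℂ) + d * (Φ (vert x s))⁻¹) / (-d + c * (Φ (vert x s))⁻¹)) atBot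
        (𝓝 (((c : ℂ) + d * 0) / (-d + c * 0))) :=
      Tendsto.div ((h3.const_mul _).const_add _) ((h3.const_mul _).const_add _) (by simpa using hd)
    have e : (((c * (φ (finPt x)).rep 0 + d * 0) / (-d * (φ (finPt x)).rep 0 + c * 0) : ℝ) : ℂ)
        = ((c : ℂ) + d * 0) / (-d + c * 0) := by
      simp only [mul_zero, add_zero]
      rw [mul_div_mul_right _ _ hv0]
      push_cast; rfl
    rw [e]
    refine h4.congr' ?_
    have h5 : ∀ᶠ s in atBot, Φ (vert x s) ≠ 0 := by
      filter_upwards [(tendsto_norm_atTop_iff_cobounded.2 h2).eventually_gt_atTop 0] with s hs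
      exact norm_pos_iff.1 hs
    filter_upwards [h5] with s hs
    rw [rot, ← mul_div_mul_right _ _ hs]
    congr 1 <;> rw [add_mul, mul_assoc, inv_mul_cancel₀ hs, mul_one]
  · rw [tendsto_coe_sphere hv] at h2
    set t : ℝ := (φ (finPt x)).rep 0 / (φ (finPt x)).rep 1 with ht
    have hden' : -d * t + c ≠ 0 := by
      rw [ht, mul_div_assoc']
      intro h0
      rw [div_add' _ _ _ hv, div_eq_zero_iff] at h0
      exact h0.elim hden hv
    have e : (((c * (φ (finPt x)).rep 0 + d * (φ (finPt x)).rep 1) /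
        (-d * (φ (finPt x)).rep 0 + c * (φ (finPt x)).rep 1) : ℝ) : ℂ) = (c * t + d) / (-d * t + c) := by
      have : (c * (φ (finPt x)).rep 0 + d * (φ (finPt x)).rep 1) /
        (-d * (φ (finPt x)).rep 0 + c * (φ (finPt x)).rep 1) = (c * t + d) / (-d * t + c) := by
        rw [← mul_div_mul_right (c * t + d) _ hv]
        congr 1 <;> rw [ht] <;> field_simp
      rw [this]; push_cast; rfl
    rw [e]
    exact Tendsto.div ((h2.const_mul _).add_const _) ((h2.const_mul _).add_const _)
      (by exact_mod_cast hden')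

theorem ExtendsToBoundary.tendsto_rot_atTop (h : ExtendsToBoundary Φ φ)
    (hΦ : MapsTo Φ Hset Hset) (x : ℝ) :
    Tendsto (fun s => ‖rot ((φ infPt).rep 0) ((φ infPt).rep 1) (Φ (vert x s))‖) atTop atTop := by
  have h1 : Tendsto (fun s => OnePoint.some (vert x s)) atTop (𝓝 (rp1ToSphere infPt)) := by
    rw [tendsto_infty_sphere infPt_rep.2]
    exact tendsto_vert_atTop x
  have h2 := h.tendsto_comp (vert_mem x) h1
  have hn : 0 < (φ infPt).rep 0 ^ 2 + (φ infPt).rep 1 ^ 2 := repSq_pos (φ infPt)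
  by_cases hd : (φ infPt).rep 1 = 0
  · rw [tendsto_infty_sphere hd, ← tendsto_norm_atTop_iff_cobounded] at h2
    refine h2.congr fun s => ?_
    have hc : (φ infPt).rep 0 ≠ 0 := fun h0 => by simp [h0, hd] at hn
    have hc' : ((φ infPt).rep 0 : ℂ) ≠ 0 := by exact_mod_cast hc
    rw [hd, rot]
    congr 1
    simp [mul_div_cancel_left₀ _ hc']
  · rw [tendsto_coe_sphere hd] at h2
    set c := (φ infPt).rep 0
    set d := (φ infPt).rep 1
    have hd' : (d : ℂ) ≠ 0 := by exact_mod_cast hd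
    have h3 : Tendsto (fun s => ‖(c : ℂ) * Φ (vert x s) + d‖) atTop
        (𝓝 ‖(c : ℂ) * ((c / d : ℝ) : ℂ) + d‖) := ((h2.const_mul _).add_const _).norm
    have h4 : Tendsto (fun s => -(d : ℂ) * Φ (vert x s) + c) atTop
        (𝓝 (-(d : ℂ) * ((c / d : ℝ) : ℂ) + c)) := (h2.const_mul _).add_const _
    rw [show -(d : ℂ) * ((c / d : ℝ) : ℂ) + c = 0 by push_cast; field_simp; ring] at h4
    have h5 : 0 < ‖(c : ℂ) * ((c / d : ℝ) : ℂ) + d‖ := by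
      have : (c : ℂ) * ((c / d : ℝ) : ℂ) + d = (((c ^ 2 + d ^ 2) / d : ℝ) : ℂ) := by
        push_cast; field_simp
      rw [this, norm_pos_iff]
      exact_mod_cast div_ne_zero hn.ne' hd
    have h6 : Tendsto (fun s => ‖-(d : ℂ) * Φ (vert x s) + c‖) atTop (𝓝[>] 0) :=
      tendsto_nhdsWithin_iff.2 ⟨by simpa using h4.norm, Eventually.of_forall fun s =>
        norm_pos_iff.2 (rot_den_ne_zero hn (hΦ (vert_mem x s)))⟩
    simp only [rot, norm_div]
    simp only [div_eq_mul_inv]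
    exact h3.pos_mul_atTop h5 (tendsto_inv_nhdsGT_zero.comp h6)

/-! ### The main estimate -/

theorem IsMinimalLagrangianExtension.dilatationAt_le (hφ : Quasisymmetric φ)
    (hsmall : crNorm φ < 1 / 10 ^ 8) (hΦ : IsMinimalLagrangianExtension Φ φ)
    (hbdd : BddAbove (range fun z : Hset => dilatationAt Φ (z : ℂ))) {z : ℂ} (hz : z ∈ Hset) :
    dilatationAt Φ z ≤ (1 + 10 ^ 7 * crNorm φ) ^ 2 := by
  set c := (φ infPt).rep 0 with hc
  set d := (φ infPt).rep 1 with hd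
  have hn : 0 < c ^ 2 + d ^ 2 := repSq_pos (φ infPt)
  have hmaps : MapsTo Φ Hset Hset := hΦ.1.2.1.mapsTo
  have hdiff : ∀ z ∈ Hset, DifferentiableAt ℝ Φ z := fun z hz =>
    (hΦ.1.1.contDiffAt (Hset_mem_nhds hz)).differentiableAt (by simp)
  have hdil : ∀ z ∈ Hset, dilatationAt (fun z => rot c d (Φ z)) z = dilatationAt Φ z :=
    fun z hz => dilatationAt_rot_comp hn (hmaps hz) (hdiff z hz)
  have hG := hΦ.1.rot_comp hn
  set G : ℂ → ℂ := fun z => rot c d (Φ z) with hGdef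
  obtain ⟨p, q, r, hML⟩ := hG.exists_minLagData
  obtain ⟨Gsm, Gbij, ⟨F, Fsm, hinv⟩, -⟩ := hG
  have Gdiff : ∀ z ∈ Hset, DifferentiableAt ℝ G z := fun z hz =>
    (Gsm.contDiffAt (Hset_mem_nhds hz)).differentiableAt (by simp)
  have Fdiff : ∀ z ∈ Hset, DifferentiableAt ℝ F z := fun z hz =>
    (Fsm.contDiffAt (Hset_mem_nhds hz)).differentiableAt (by simp)
  have Fmaps : MapsTo F Hset Hset := fun w hw => by
    obtain ⟨z, hz, rfl⟩ := Gbij.surjOn hw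
    rwa [hinv.1 hz]
  obtain ⟨K, hK⟩ := hbdd
  have hM : ∀ z ∈ Hset, p z + r z ≤ K + 2 := fun z hz =>
    hML.trace_le_of_dilatationAt_le hz (Gdiff z hz)
      ((hdil z hz).le.trans (hK (mem_range_self (⟨z, hz⟩ : Hset))))
  have hL : 1 ≤ K + 2 := by linarith [hM z hz, hML.trace_ge hz]
  have hext : BilipExt G F (lineMap φ) (K + 2) :=
    ⟨hL, hML.hypLip Gdiff hM, hML.hypLip_inv Gdiff Fdiff Fmaps (fun w hw => hinv.2 hw) hM,
      fun w hw => hinv.1 hw, fun x => hΦ.2.tendsto_rot_atBot x,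
      fun x => hΦ.2.tendsto_rot_atTop hmaps x⟩
  have hqs := qsLine_lineMap hφ
  have hcr := crNorm_nonneg φ
  have hε0 : 0 ≤ exp (crNorm φ) - 1 := by linarith [Real.add_one_le_exp (crNorm φ)]
  have hε : exp (crNorm φ) - 1 ≤ 2 * crNorm φ := by
    have := Real.abs_exp_sub_one_le (x := crNorm φ) (by rw [abs_of_nonneg hcr]; linarith)
    rwa [abs_of_nonneg hε0, abs_of_nonneg hcr] at this
  set ε := exp (crNorm φ) - 1
  have hε1 : ε ≤ 1 / 100000 := by linarith
  obtain ⟨K', hK'⟩ := hext.exists_coshDist_le hqs hε0 hε1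
  have hF := hML.curvSq_le (U := compU (lineMap φ)) (V := compV (lineMap φ)) (e := 40000 * ε)
    hqs.c2_compU hqs.c2_compV (fun z hz => hqs.compV_pos hε0 hε1 hz) (by positivity) (by linarith)
    (fun z hz => hqs.comparisonAt hε0 hε1 hz (hML.pos z hz) (hML.pos' hz)
      (by linarith [hML.det z hz])) hM hK' z hz
  rw [← hdil z hz]
  set t := 10 ^ 7 * crNorm φ with ht
  have ht0 : 0 ≤ t := by positivity
  have ht1 : t ≤ 1 := by linarith
  have het : 40000 * ε ≤ t / 100 := by linarith
  refine hML.dilatationAt_le hz (Gdiff z hz) (by linarith) ?_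
  have h2 := hML.trace_ge hz
  set τ := p z + r z with hτ
  have hF2 : τ - 2 ≤ 528 * (t / 100) ^ 2 * (τ + 2) := by
    have : (τ - 2) / (τ + 2) ≤ 528 * (t / 100) ^ 2 := by
      refine hF.trans ?_
      gcongr
    rwa [div_le_iff₀ (by linarith)] at this
  nlinarith [sq_nonneg t, mul_nonneg ht0 ht0]

/-- **Theorem D.** There exist universal constants `δ > 0` and `C₁ > 0` such that, for any
quasisymmetric homeomorphism `φ` of `ℝP¹` with cross-ratio norm `‖φ‖_cr < δ`, the minimal
Lagrangian extension `Φ_ML : ℍ² → ℍ²` of `φ` has maximal dilatation bounded by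
`ln K(Φ_ML) ≤ C₁·‖φ‖_cr`. -/
theorem log_maxDilatation_le_of_small_crNorm :
    ∃ δ C₁ : ℝ, 0 < δ ∧ 0 < C₁ ∧
      ∀ φ : RP1 ≃ₜ RP1, Quasisymmetric φ → crNorm ⇑φ < δ →
        ∀ Φ : ℂ → ℂ, IsMinimalLagrangianExtension Φ ⇑φ →
          Real.log (maxDilatation Φ) ≤ C₁ * crNorm ⇑φ := by
  refine ⟨1 / 10 ^ 8, 2 * 10 ^ 7, by norm_num, by norm_num, fun φ hφ hsmall Φ hΦ => ?_⟩
  have hcr := crNorm_nonneg φ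
  by_cases hbdd : BddAbove (range fun z : Hset => dilatationAt Φ (z : ℂ))
  · have : Nonempty Hset := ⟨⟨Complex.I, by simp [Hset]⟩⟩
    have h1 : maxDilatation Φ ≤ (1 + 10 ^ 7 * crNorm φ) ^ 2 := ciSup_le fun z =>
      IsMinimalLagrangianExtension.dilatationAt_le hφ hsmall hΦ hbdd z.2
    have h0 : 0 ≤ maxDilatation Φ := Real.iSup_nonneg fun z => dilatationAt_nonneg Φ z
    rcases h0.eq_or_lt with h0 | h0
    · rw [← h0, Real.log_zero]
      positivity
    · have h2 := Real.log_le_log h0 h1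
      have h3 := Real.log_le_sub_one_of_pos (show 0 < 1 + 10 ^ 7 * crNorm φ by positivity)
      rw [Real.log_pow] at h2
      push_cast at h2
      linarith
  · rw [maxDilatation, Real.iSup_of_not_bddAbove hbdd, Real.log_zero]
    positivity

end AdSPaper
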